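/- Let d₀ ≥ 2, M = 𝕋^{d₀} with normalized Haar measure ν and quotient metric d, and let T be the algebraic automorphism of 𝕋^{d₀} induced by S ∈ SL_{d₀}(ℤ) none of whose eigenvalues is a root of unity. Let η > 0 and let f : M → ℝ be bounded, η-Hölder continuous, with ∫_M f dν = 0. Let (S_n)_{n≥0} be a simple symmetric random walk on ℤ, independent of the M-valued coordinate (i.e., work on the product of (M, ν) with the probability space carrying (S_n)), and set ξ_k := f∘T^k and σ² := Σ_{m∈ℤ} ∫_M f·(f∘T^{|m|}) dν. Then for every real t, the difference E[exp((it/n^{3/4}) Σ_{k=1}^n ξ_{S_k})] − E[exp(−(t² σ²/(2 n^{3/2})) Σ_{ℓ∈ℤ} N_n(ℓ)²)] converges to 0 as n → ∞. -/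

import Mathlib

open MeasureTheory ProbabilityTheory Filter

noncomputable section

/-- Number of visits of the walk `S` to site `k` among times `1,...,n` (local time). -/
def localTime {Ω : Type*} (S : ℕ → Ω → ℤ) (n : ℕ) (k : ℤ) (ω : Ω) : ℝ :=
  ((Finset.Icc 1 n).filter (fun j => S j ω = k)).card

/-- `S` is a simple symmetric random walk on `ℤ`: `S 0 = 0` and the increments are
i.i.d. uniform on `{-1, 1}`. -/
structure IsSSRW {Ω : Type*} [MeasurableSpace Ω] (μ : Measure Ω) (S : ℕ → Ω → ℤ) : Prop where
  meas : ∀ n, Measurable (S n)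
  init : ∀ ω, S 0 ω = 0
  indep : iIndepFun (fun n ω => S (n + 1) ω - S n ω) μ
  step_one : ∀ n, μ {ω | S (n + 1) ω - S n ω = 1} = 1 / 2
  step_neg_one : ∀ n, μ {ω | S (n + 1) ω - S n ω = -1} = 1 / 2

/-- Stationarity of the sequence `(ξ k)_{k ∈ ℤ}`: all finite dimensional distributions
are invariant under a shift of the index. -/
def IsStationarySeq {Ω : Type*} [MeasurableSpace Ω] (μ : Measure Ω) (ξ : ℤ → Ω → ℝ) : Prop :=
  ∀ (j : ℤ) (q : ℕ) (k : Fin q → ℤ),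
    Measure.map (fun ω i => ξ (k i + j) ω) μ = Measure.map (fun ω i => ξ (k i) ω) μ

/-- Covariance of two complex-valued random variables. -/
def covC {Ω : Type*} [MeasurableSpace Ω] (μ : Measure Ω) (U V : Ω → ℂ) : ℂ :=
  ∫ ω, U ω * V ω ∂μ - (∫ ω, U ω ∂μ) * (∫ ω, V ω ∂μ)

/-- Condition (3): `(ξ k)` is stationary, centered, with finite fourth moments. -/
def Cond3 {Ω : Type*} [MeasurableSpace Ω] (μ : Measure Ω) (ξ : ℤ → Ω → ℝ) : Prop :=
  IsStationarySeq μ ξ ∧ (∀ k, ∫ ω, ξ k ω ∂μ = 0) ∧ ∀ k, Integrable (fun ω => (ξ k ω) ^ 4) μ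

/-- Condition (4). -/
def Cond4 {Ω : Type*} [MeasurableSpace Ω] (μ : Measure Ω) (ξ : ℤ → Ω → ℝ) : Prop :=
  Summable (fun p : ℕ => Real.sqrt (1 + (p : ℝ)) * |∫ ω, ξ 0 ω * ξ (p : ℤ) ω ∂μ|) ∧
  ∃ B : ℝ, ∀ N : ℕ, 1 ≤ N →
    ∑ k₁ ∈ Finset.range N, ∑ k₂ ∈ Finset.range N, ∑ k₃ ∈ Finset.range N,
      ∑ k₄ ∈ Finset.range N,
        |∫ ω, ξ (k₁ : ℤ) ω * ξ (k₂ : ℤ) ω * ξ (k₃ : ℤ) ω * ξ (k₄ : ℤ) ω ∂μ| ≤ B * (N : ℝ) ^ 2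

/-- The covariance inequality of condition (5), for a given constant `C` and
family `φ`. -/
def Cond5Bound {Ω : Type*} [MeasurableSpace Ω] (μ : Measure Ω) (ξ : ℤ → Ω → ℝ)
    (C : ℝ) (φ : ℕ → ℕ → ℝ) : Prop :=
  ∀ n₁ n₂ n₃ n₄ : ℕ, n₁ ≤ n₂ → n₂ ≤ n₃ → n₃ ≤ n₄ → ∀ α β : ℕ → ℝ,
    ‖covC μ
        (fun ω => Complex.exp (Complex.I * ((∑ k ∈ Finset.Icc n₁ n₂, α k * ξ (k : ℤ) ω : ℝ) : ℂ)))
        (fun ω => Complex.exp (Complex.I * ((∑ k ∈ Finset.Icc n₃ n₄, β k * ξ (k : ℤ) ω : ℝ) : ℂ)))‖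
      ≤ C * (1 + ∑ k ∈ Finset.Icc n₁ n₂, |α k| + ∑ k ∈ Finset.Icc n₃ n₄, |β k|) *
          φ (n₃ - n₂) (n₄ - n₃)

/-- Condition (5). -/
def Cond5 {Ω : Type*} [MeasurableSpace Ω] (μ : Measure Ω) (ξ : ℤ → Ω → ℝ) : Prop :=
  ∃ C : ℝ, 0 < C ∧ ∃ (φ : ℕ → ℕ → ℝ) (r : ℕ), 1 ≤ r ∧
    (∀ p s, 0 ≤ φ p s) ∧ (∀ p s, φ (p + 1) s ≤ φ p s) ∧
    Tendsto (fun s : ℕ => Real.sqrt s * φ (r * s) s) atTop (nhds 0) ∧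
    Cond5Bound μ ξ C φ

/-- The iterate `T^k` for `k ∈ ℤ` of an invertible transformation `T`
with inverse `Tinv`. -/
def Titer {M : Type*} (T Tinv : M → M) : ℤ → M → M
  | Int.ofNat n => T^[n]
  | Int.negSucc n => Tinv^[n + 1]

open scoped ENNReal
/-- The `d`-dimensional torus `ℝ^d/ℤ^d`, realised as `(ℝ/ℤ)^d`; it carries the product
(normalised Haar) measure `volume`. -/
abbrev Torus (d : ℕ) : Type := Fin d → AddCircle (1 : ℝ)

/-- The quotient metric on the torus induced by the Euclidean metric on `ℝ^d`
(here `‖·‖` is the quotient norm on `ℝ/ℤ`). -/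
def torusDist {d : ℕ} (x y : Torus d) : ℝ := Real.sqrt (∑ i, ‖x i - y i‖ ^ 2)

/-- The algebraic endomorphism of the torus induced by an integer matrix `S`. -/
def torusAut {d : ℕ} (S : Matrix (Fin d) (Fin d) ℤ) (x : Torus d) : Torus d :=
  fun i => ∑ j, S i j • x j

/-- `S` has no eigenvalue which is a root of unity. -/
def NoRootOfUnityEigenvalue {d : ℕ} (S : Matrix (Fin d) (Fin d) ℤ) : Prop :=
  ∀ z : ℂ, (Matrix.charpoly (S.map (fun a => (a : ℂ)))).IsRoot z →
    ∀ n : ℕ, n ≠ 0 → z ^ n ≠ 1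

/-- The η-Hölder constant `C_g^{(η)}` of `g` (with value `∞` if `g` is not η-Hölder),
for the Euclidean quotient metric on the torus. -/
def holderC {d : ℕ} (η : ℝ) (g : Torus d → ℂ) : ℝ≥0∞ :=
  ⨆ (x : Torus d) (y : Torus d) (_ : x ≠ y),
    ENNReal.ofReal (‖g x - g y‖ / torusDist x y ^ η)

/-- A real function on the torus is η-Hölder continuous (for the Euclidean quotient
metric). -/
def IsHolder {d : ℕ} (η : ℝ) (f : Torus d → ℝ) : Prop :=
  ∃ c : ℝ, ∀ x y : Torus d, |f x - f y| ≤ c * torusDist x y ^ η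

/-- Kronecker: an algebraic integer that is neither zero nor a root of unity has a conjugate
outside the closed unit disc. -/
lemma exists_conjugate_norm_gt_one {z : ℂ} (hz0 : z ≠ 0) (hz : IsIntegral ℤ z)
    (hroot : ∀ n : ℕ, n ≠ 0 → z ^ n ≠ 1) :
    ∃ w : ℂ, Polynomial.aeval w (minpoly ℚ z) = 0 ∧ 1 < ‖w‖ := by
  by_contra! hcon
  have hzQ : IsIntegral ℚ z := hz.tower_top
  let K := IntermediateField.adjoin ℚ {z}
  have : FiniteDimensional ℚ K := IntermediateField.adjoin.finiteDimensional hzQ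
  have : NumberField K := ⟨⟩
  let x : K := IntermediateField.AdjoinSimple.gen ℚ z
  have hxz : algebraMap K ℂ x = z := IntermediateField.AdjoinSimple.algebraMap_gen ℚ z
  have hx0 : x ≠ 0 := by
    intro h
    rw [h, map_zero] at hxz
    exact hz0 hxz.symm
  have hxi : IsIntegral ℤ x := by
    rw [← isIntegral_algebraMap_iff (FaithfulSMul.algebraMap_injective K ℂ), hxz]
    exact hz
  obtain ⟨n, hn, h1⟩ := NumberField.Embeddings.pow_eq_one_of_norm_le_one K ℂ hx0 hxi (by
    intro φ
    apply hcon
    have h2 : minpoly ℚ z = minpoly ℚ x := by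
      rw [← hxz]
      exact minpoly.algebraMap_eq (FaithfulSMul.algebraMap_injective K ℂ) x
    rw [h2]
    have h3 := congrArg φ.toRatAlgHom (minpoly.aeval ℚ x)
    rw [map_zero, ← Polynomial.aeval_algHom_apply] at h3
    exact h3)
  apply hroot n hn.ne'
  rw [← hxz, ← map_pow, h1, map_one]

/-- A nonzero vector has a monic polynomial of minimal degree annihilating it; no nonzero polynomial
of smaller degree annihilates it. -/
lemma exists_minimal_annihilator {d : ℕ} (A : Matrix (Fin d) (Fin d) ℚ) (v : Fin d → ℚ) :
    ∃ p : Polynomial ℚ, p.Monic ∧ (Polynomial.aeval A p).mulVec v = 0 ∧ p ∣ A.charpoly ∧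
      ∀ q : Polynomial ℚ, q.degree < p.degree → (Polynomial.aeval A q).mulVec v = 0 → q = 0 := by
  classical
  let I : Ideal (Polynomial ℚ) :=
    { carrier := {q | (Polynomial.aeval A q).mulVec v = 0}
      add_mem' := by
        intro a b ha hb
        simp only [Set.mem_ofPred_eq] at *
        rw [map_add, Matrix.add_mulVec, ha, hb, add_zero]
      zero_mem' := by simp
      smul_mem' := by
        intro c a ha
        simp only [Set.mem_ofPred_eq, smul_eq_mul] at *
        rw [map_mul, ← Matrix.mulVec_mulVec, ha, Matrix.mulVec_zero] }
  have hmem : ∀ q, q ∈ I ↔ (Polynomial.aeval A q).mulVec v = 0 := fun q => Iff.rfl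
  obtain ⟨p₀, hp₀⟩ := (IsPrincipalIdealRing.principal I).principal
  have hchar : A.charpoly ∈ I := by
    rw [hmem, Matrix.aeval_self_charpoly, Matrix.zero_mulVec]
  have hp₀ne : p₀ ≠ 0 := by
    rintro rfl
    rw [hp₀] at hchar
    simp only [Submodule.span_zero_singleton, Submodule.mem_bot] at hchar
    exact (Matrix.charpoly_monic A).ne_zero hchar
  have hdvd : ∀ q, q ∈ I ↔ p₀ ∣ q := by
    intro q
    rw [hp₀]
    exact Ideal.mem_span_singleton
  have hass : Associated p₀ (normalize p₀) := (normalize_associated p₀).symm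
  refine ⟨normalize p₀, Polynomial.monic_normalize hp₀ne, ?_, ?_, ?_⟩
  · rw [← hmem, hdvd]
    exact hass.dvd
  · exact hass.symm.dvd.trans ((hdvd _).1 hchar)
  · intro q hq h
    rw [← hmem, hdvd] at h
    exact Polynomial.eq_zero_of_dvd_of_degree_lt (hass.symm.dvd.trans h) hq

lemma norm_det_le_of_norm_le {e : ℕ} (M : Matrix (Fin e) (Fin e) ℂ) (β : Fin e → ℝ)
    (h : ∀ k i, ‖M k i‖ ≤ β i) : ‖M.det‖ ≤ (e.factorial : ℝ) * ∏ i, β i := by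
  rw [Matrix.det_apply]
  calc ‖∑ σ : Equiv.Perm (Fin e), Equiv.Perm.sign σ • ∏ i, M (σ i) i‖
      ≤ ∑ σ : Equiv.Perm (Fin e), ∏ i, β i := by
        refine norm_sum_le_of_le _ fun σ _ => ?_
        have : ‖Equiv.Perm.sign σ • ∏ i, M (σ i) i‖ = ∏ i, ‖M (σ i) i‖ := by
          rcases Int.units_eq_one_or (Equiv.Perm.sign σ) with h | h <;> simp [h, norm_prod]
        rw [this]
        exact Finset.prod_le_prod (fun i _ => norm_nonneg _) fun i _ => h _ _
    _ = _ := by simp [Finset.card_univ, Fintype.card_perm]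

/-- The complexification of an integer matrix. -/
abbrev complexMatrix {d : ℕ} (A : Matrix (Fin d) (Fin d) ℤ) : Matrix (Fin d) (Fin d) ℂ :=
  A.map (fun a => (a : ℂ))

/-- The complexification of an integer vector. -/
abbrev complexVec {d : ℕ} (χ : Fin d → ℤ) : Fin d → ℂ := fun i => (χ i : ℂ)

lemma complexMatrix_mul {d : ℕ} (A B : Matrix (Fin d) (Fin d) ℤ) :
    complexMatrix (A * B) = complexMatrix A * complexMatrix B :=
  Matrix.map_mul (f := Int.castRingHom ℂ)

lemma complexMatrix_one {d : ℕ} : complexMatrix (1 : Matrix (Fin d) (Fin d) ℤ) = 1 := by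
  simp [complexMatrix]

lemma complexMatrix_pow {d : ℕ} (A : Matrix (Fin d) (Fin d) ℤ) (k : ℕ) :
    complexMatrix (A ^ k) = complexMatrix A ^ k := by
  induction k with
  | zero => simp
  | succ k ih => rw [pow_succ, pow_succ, complexMatrix_mul, ih]

lemma complexMatrix_mulVec {d : ℕ} (A : Matrix (Fin d) (Fin d) ℤ) (χ : Fin d → ℤ) :
    (complexMatrix A).mulVec (complexVec χ) = complexVec (A.mulVec χ) := by
  ext i
  simp [Matrix.mulVec, dotProduct, complexVec]

lemma norm_complexVec {d : ℕ} (χ : Fin d → ℤ) : ‖complexVec χ‖ = ‖χ‖ := by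
  simp [Pi.norm_def, complexVec, nnnorm, Int.norm_eq_abs]

lemma one_le_norm_of_ne_zero {d : ℕ} {χ : Fin d → ℤ} (h : χ ≠ 0) : 1 ≤ ‖χ‖ := by
  obtain ⟨i, hi⟩ := Function.ne_iff.1 h
  refine le_trans ?_ (norm_le_pi_norm χ i)
  rw [Int.norm_eq_abs]
  exact_mod_cast Int.one_le_abs hi

lemma aeval_mulVec_eq_sum {R : Type*} [CommRing R] {d : ℕ} (A : Matrix (Fin d) (Fin d) R)
    (q : Polynomial R) (v : Fin d → R) {e : ℕ} (he : q.natDegree < e) :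
    (Polynomial.aeval A q).mulVec v = ∑ k ∈ Finset.range e, q.coeff k • (A ^ k).mulVec v := by
  rw [Polynomial.aeval_eq_sum_range' he, Matrix.sum_mulVec]
  simp [Matrix.smul_mulVec]

/-- The Gram determinant of linearly independent integer vectors is at least one. -/
lemma one_le_abs_det_gram {d e : ℕ} (B : Matrix (Fin d) (Fin e) ℤ)
    (h : ∀ w : Fin e → ℤ, B.mulVec w = 0 → w = 0) : 1 ≤ |(B.transpose * B).det| := by
  apply Int.one_le_abs
  intro h0
  obtain ⟨w, hw, h1⟩ := Matrix.exists_mulVec_eq_zero_iff.2 h0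
  apply hw
  apply h
  have h2 : dotProduct (B.mulVec w) (B.mulVec w) = 0 := by
    have : dotProduct w ((B.transpose * B).mulVec w) = 0 := by rw [h1]; simp
    rwa [← Matrix.mulVec_mulVec, Matrix.dotProduct_mulVec, Matrix.vecMul_transpose] at this
  exact dotProduct_self_eq_zero.1 h2

lemma norm_mulVec_le {d e : ℕ} (M : Matrix (Fin d) (Fin e) ℂ) :
    ∃ C : ℝ, 0 ≤ C ∧ ∀ v, ‖M.mulVec v‖ ≤ C * ‖v‖ := by
  refine ⟨‖LinearMap.toContinuousLinearMap (Matrix.mulVecLin M)‖, norm_nonneg _, fun v => ?_⟩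
  exact (LinearMap.toContinuousLinearMap (Matrix.mulVecLin M)).le_opNorm v

/-- Lower bound for a vector `z` which is a monic polynomial of degree `e - 1` in `A`, applied to an
integer vector `χ` whose first `e` iterates under `A` are linearly independent. -/
lemma one_le_of_linearIndependent_iterates {d e : ℕ} (A : Matrix (Fin d) (Fin d) ℤ)
    (χ : Fin d → ℤ) (r : Polynomial ℂ) (hr : r.Monic) (hre : r.natDegree + 1 = e)
    (hind : ∀ w : Fin e → ℤ, ∑ k : Fin e, w k • (A ^ (k : ℕ)).mulVec χ = 0 → w = 0)
    (D : ℝ) (hD0 : 0 ≤ D) (hD : ∀ k < e, ‖(A ^ k).mulVec χ‖ ≤ D) :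
    1 ≤ (e.factorial : ℝ) * ((d * D ^ 2) ^ (e - 1) *
      (d * D * ‖(Polynomial.aeval (complexMatrix A) r).mulVec (complexVec χ)‖)) := by
  set z := (Polynomial.aeval (complexMatrix A) r).mulVec (complexVec χ) with hz
  let B : Matrix (Fin d) (Fin e) ℤ := fun i k => (A ^ (k : ℕ)).mulVec χ i
  have hBw : ∀ w : Fin e → ℤ, B.mulVec w = ∑ k : Fin e, w k • (A ^ (k : ℕ)).mulVec χ := by
    intro w
    ext i
    simp [B, Matrix.mulVec, dotProduct, Finset.sum_apply, mul_comm]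
  have hB : ∀ i k, ‖(B i k : ℂ)‖ ≤ D := by
    intro i k
    rw [Complex.norm_intCast, ← Int.norm_eq_abs]
    exact (norm_le_pi_norm _ i).trans (hD k k.2)
  have h1 := one_le_abs_det_gram B (fun w hw => hind w (by rw [← hBw, hw]))
  let G : Matrix (Fin e) (Fin e) ℂ := (B.transpose * B).map (Int.castRingHom ℂ)
  have hG : 1 ≤ ‖G.det‖ := by
    have : G.det = ((B.transpose * B).det : ℂ) := by
      simp only [G]
      rw [← RingHom.mapMatrix_apply, ← RingHom.map_det]
      rfl
    rw [this, Complex.norm_intCast]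
    exact_mod_cast h1
  have hGe : ∀ k i, G k i = ∑ x, (B x k : ℂ) * (B x i : ℂ) := by
    intro k i
    simp [G, Matrix.mul_apply]
  let last : Fin e := ⟨e - 1, by omega⟩
  have hdet := Matrix.det_updateCol_sum G last (fun k => r.coeff k)
  have hlast : r.coeff ((last : Fin e) : ℕ) = 1 := by
    have : ((last : Fin e) : ℕ) = r.natDegree := by simp only [last]; omega
    rw [this]
    exact hr
  simp only [hlast, one_smul] at hdet
  rw [← hdet] at hG
  have hzx : ∀ x, z x = ∑ i : Fin e, r.coeff i * (B x i : ℂ) := by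
    intro x
    rw [hz, aeval_mulVec_eq_sum (e := e) _ _ _ (by omega), Finset.sum_apply, ← Fin.sum_univ_eq_sum_range
      (fun k => (r.coeff k • (complexMatrix A ^ k).mulVec (complexVec χ)) x)]
    refine Finset.sum_congr rfl fun i _ => ?_
    rw [← complexMatrix_pow, complexMatrix_mulVec]
    simp [B, complexVec]
  have hcol : ∀ k, ∑ i : Fin e, r.coeff i • G k i = ∑ x, (B x k : ℂ) * z x := by
    intro k
    simp_rw [hGe, hzx, Finset.smul_sum, Finset.mul_sum]
    rw [Finset.sum_comm]
    refine Finset.sum_congr rfl fun x _ => Finset.sum_congr rfl fun i _ => ?_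
    simp only [smul_eq_mul]
    ring
  have hbound := norm_det_le_of_norm_le
    (G.updateCol last fun k => ∑ i : Fin e, r.coeff i • G k i)
    (fun i => if i = last then d * D * ‖z‖ else d * D ^ 2) (by
      intro k i
      by_cases hi : i = last
      · subst hi
        rw [Matrix.updateCol_self, hcol, if_pos rfl]
        calc ‖∑ x, (B x k : ℂ) * z x‖ ≤ ∑ _x : Fin d, D * ‖z‖ := by
              refine norm_sum_le_of_le _ fun x _ => ?_
              rw [norm_mul]
              exact mul_le_mul (hB x k) (norm_le_pi_norm z x) (norm_nonneg _) hD0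
          _ = d * D * ‖z‖ := by simp [mul_assoc]
      · rw [Matrix.updateCol_ne hi, hGe, if_neg hi]
        calc ‖∑ x, (B x k : ℂ) * (B x i : ℂ)‖ ≤ ∑ _x : Fin d, D * D := by
              refine norm_sum_le_of_le _ fun x _ => ?_
              rw [norm_mul]
              exact mul_le_mul (hB x k) (hB x i) (norm_nonneg _) hD0
          _ = d * D ^ 2 := by simp [sq])
  refine hG.trans (hbound.trans (le_of_eq ?_))
  congr 1
  rw [Finset.prod_ite, Finset.prod_const, Finset.prod_const, mul_comm]
  have c1 : (Finset.univ.filter (fun i : Fin e => i = last)).card = 1 := by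
    rw [Finset.filter_eq' Finset.univ last]; simp
  have c2 : (Finset.univ.filter (fun i : Fin e => ¬ i = last)).card = e - 1 := by
    rw [Finset.filter_ne' Finset.univ last, Finset.card_erase_of_mem (Finset.mem_univ _)]; simp
  rw [c1, c2, pow_one]

/-- The monic polynomial with a given multiset of roots. -/
abbrev rootsPoly (s : Multiset ℂ) : Polynomial ℂ :=
  (s.map (fun a => Polynomial.X - Polynomial.C a)).prod

lemma exists_pow_mulVec_bound {d : ℕ} (A : Matrix (Fin d) (Fin d) ℤ) :
    ∃ Q : ℝ, 1 ≤ Q ∧ ∀ k < d, ∀ χ, ‖(A ^ k).mulVec χ‖ ≤ Q * ‖χ‖ := by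
  choose C hC0 hC using fun k : ℕ => norm_mulVec_le (complexMatrix (A ^ k))
  refine ⟨1 + ∑ k ∈ Finset.range d, C k, ?_, ?_⟩
  · linarith [Finset.sum_nonneg (fun k (_ : k ∈ Finset.range d) => hC0 k)]
  · intro k hk χ
    have h1 := hC k (complexVec χ)
    rw [complexMatrix_mulVec, norm_complexVec, norm_complexVec] at h1
    refine h1.trans (mul_le_mul_of_nonneg_right ?_ (norm_nonneg _))
    have := Finset.single_le_sum (fun k _ => hC0 k) (Finset.mem_range.2 hk)
    linarith

lemma aeval_mulVec_map {d : ℕ} (A : Matrix (Fin d) (Fin d) ℤ) (χ : Fin d → ℤ)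
    (q : Polynomial ℚ) :
    (Polynomial.aeval (complexMatrix A) (q.map (algebraMap ℚ ℂ))).mulVec (complexVec χ) =
      fun i => (((Polynomial.aeval (A.map (fun a => (a : ℚ))) q).mulVec
        (fun i => (χ i : ℚ)) i : ℚ) : ℂ) := by
  have hpow : ∀ k : ℕ, ((A.map (fun a => (a : ℚ))) ^ k).mulVec (fun i => (χ i : ℚ)) =
      fun i => (((A ^ k).mulVec χ i : ℤ) : ℚ) := by
    intro k
    have h1 : (A.map (fun a => (a : ℚ))) ^ k = (A ^ k).map (fun a => (a : ℚ)) :=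
      (Matrix.map_pow A (Int.castRingHom ℚ) k).symm
    rw [h1]
    ext i
    simp [Matrix.mulVec, dotProduct]
  rw [aeval_mulVec_eq_sum (e := q.natDegree + 1) _ _ _
      (Nat.lt_succ_of_le Polynomial.natDegree_map_le),
    aeval_mulVec_eq_sum (e := q.natDegree + 1) _ _ _ (Nat.lt_succ_self _)]
  ext i
  simp only [hpow, ← complexMatrix_pow, complexMatrix_mulVec]
  simp [Finset.sum_apply, complexVec]

/-- The charpoly of an integer matrix has only algebraic integers as roots. -/
lemma isIntegral_of_charpoly_root {d : ℕ} (A : Matrix (Fin d) (Fin d) ℤ) {z : ℂ}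
    (hz : (complexMatrix A).charpoly.IsRoot z) : IsIntegral ℤ z := by
  refine ⟨A.charpoly, A.charpoly_monic, ?_⟩
  have : (complexMatrix A).charpoly = A.charpoly.map (Int.castRingHom ℂ) :=
    Matrix.charpoly_map A (Int.castRingHom ℂ)
  rw [this, Polynomial.IsRoot, Polynomial.eval_map] at hz
  exact hz

lemma ne_zero_of_charpoly_root {d : ℕ} (A : Matrix (Fin d) (Fin d) ℤ) (hdet : A.det = 1) {z : ℂ}
    (hz : (complexMatrix A).charpoly.IsRoot z) : z ≠ 0 := by
  rintro rfl
  have h1 : (complexMatrix A).det = 1 := by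
    have := (RingHom.map_det (Int.castRingHom ℂ) A).symm
    rw [hdet, map_one] at this
    exact this
  have h2 := Matrix.det_eq_sign_charpoly_coeff (complexMatrix A)
  rw [Polynomial.IsRoot, ← Polynomial.coeff_zero_eq_eval_zero] at hz
  rw [hz, h1] at h2
  simp at h2

/-- Every nonzero integer vector is sent by a divisor of the characteristic polynomial to an
expanding eigenvector of size at least a negative power of its own size. -/
lemma exists_expanding_eigenvector {d : ℕ} (A : Matrix (Fin d) (Fin d) ℤ) (hdet : A.det = 1)
    (hE : NoRootOfUnityEigenvalue A) :
    ∃ C : ℝ, 0 < C ∧ ∀ χ : Fin d → ℤ, χ ≠ 0 →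
      ∃ s ≤ (complexMatrix A).charpoly.roots, ∃ l ∈ (complexMatrix A).charpoly.roots, 1 < ‖l‖ ∧
        (complexMatrix A).mulVec
            ((Polynomial.aeval (complexMatrix A) (rootsPoly s)).mulVec (complexVec χ)) =
          l • (Polynomial.aeval (complexMatrix A) (rootsPoly s)).mulVec (complexVec χ) ∧
        1 ≤ C * ‖χ‖ ^ (2 * d) *
          ‖(Polynomial.aeval (complexMatrix A) (rootsPoly s)).mulVec (complexVec χ)‖ := by
  obtain ⟨Q, hQ1, hQ⟩ := exists_pow_mulVec_bound A
  refine ⟨(d.factorial : ℝ) * ((d + 1) * Q ^ 2) ^ d, by positivity, fun χ hχ => ?_⟩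
  have hχ1 := one_le_norm_of_ne_zero hχ
  obtain ⟨p, hpm, hpA, hpd, hpmin⟩ :=
    exists_minimal_annihilator (A.map (fun a => (a : ℚ))) (fun i => (χ i : ℚ))
  have hcharQ : (complexMatrix A).charpoly =
      (A.map (fun a => (a : ℚ))).charpoly.map (algebraMap ℚ ℂ) := by
    rw [← Matrix.charpoly_map]
    congr 1
  have hchar0 : (complexMatrix A).charpoly ≠ 0 := (Matrix.charpoly_monic _).ne_zero
  set pc := p.map (algebraMap ℚ ℂ) with hpc
  have hpcm : pc.Monic := hpm.map _
  have hpcd : pc ∣ (complexMatrix A).charpoly := by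
    rw [hcharQ]
    exact Polynomial.map_dvd _ hpd
  have hpdeg : p.natDegree ≠ 0 := by
    intro h0
    rw [hpm.natDegree_eq_zero] at h0
    rw [h0] at hpA
    simp only [map_one, Matrix.one_mulVec] at hpA
    apply hχ
    ext i
    simpa using congrFun hpA i
  have hdegc : pc.natDegree = p.natDegree := Polynomial.natDegree_map _
  obtain ⟨z0, hz0⟩ : ∃ z, pc.IsRoot z := by
    apply IsAlgClosed.exists_root
    rw [Polynomial.degree_eq_natDegree hpcm.ne_zero, hdegc]
    exact_mod_cast hpdeg
  have hz0c : (complexMatrix A).charpoly.IsRoot z0 := hz0.dvd hpcd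
  obtain ⟨l, hl, hl1⟩ := exists_conjugate_norm_gt_one (ne_zero_of_charpoly_root A hdet hz0c)
    (isIntegral_of_charpoly_root A hz0c) (hE z0 hz0c)
  have hlroot : pc.IsRoot l := by
    have h1 : minpoly ℚ z0 ∣ p := by
      apply minpoly.dvd
      rw [Polynomial.IsRoot, hpc, Polynomial.eval_map_algebraMap] at hz0
      exact hz0
    obtain ⟨q, hq⟩ := h1
    rw [Polynomial.IsRoot, hpc, Polynomial.eval_map_algebraMap, hq, map_mul, hl, zero_mul]
  have hlmem : l ∈ pc.roots := (Polynomial.mem_roots hpcm.ne_zero).2 hlroot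
  have hle : pc.roots ≤ (complexMatrix A).charpoly.roots :=
    Polynomial.roots.le_of_dvd hchar0 hpcd
  have hsplit : pc = rootsPoly pc.roots :=
    Polynomial.Splits.eq_prod_roots_of_monic (IsAlgClosed.splits pc) hpcm
  have hpr : pc = (Polynomial.X - Polynomial.C l) * rootsPoly (pc.roots.erase l) := by
    conv_lhs => rw [hsplit, ← Multiset.cons_erase hlmem]
    simp [rootsPoly]
  set r := rootsPoly (pc.roots.erase l) with hr
  have hrm : r.Monic := Polynomial.monic_multiset_prod_of_monic _ _
    (fun a _ => Polynomial.monic_X_sub_C a)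
  refine ⟨pc.roots.erase l, (Multiset.erase_le _ _).trans hle, l, Multiset.mem_of_le hle hlmem,
    hl1, ?_, ?_⟩
  · have h1 : (Polynomial.aeval (complexMatrix A) pc).mulVec (complexVec χ) = 0 := by
      rw [hpc, aeval_mulVec_map, hpA]
      ext i
      simp
    rw [hpr, map_mul, ← Matrix.mulVec_mulVec, map_sub, Polynomial.aeval_X, Polynomial.aeval_C,
      Matrix.sub_mulVec, sub_eq_zero] at h1
    rw [h1, Algebra.algebraMap_eq_smul_one, Matrix.smul_mulVec, Matrix.one_mulVec]
  · have he : r.natDegree + 1 = p.natDegree := by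
      rw [← hdegc, hpr, Polynomial.natDegree_mul (Polynomial.X_sub_C_ne_zero l) hrm.ne_zero,
        Polynomial.natDegree_X_sub_C, add_comm]
    have hed : p.natDegree ≤ d := by
      have := Polynomial.natDegree_le_of_dvd hpd (Matrix.charpoly_monic _).ne_zero
      rwa [Matrix.charpoly_natDegree_eq_dim, Fintype.card_fin] at this
    have key := one_le_of_linearIndependent_iterates A χ r hrm he (by
      intro w hw
      let q : Polynomial ℚ := ∑ k : Fin p.natDegree, Polynomial.C (w k : ℚ) * Polynomial.X ^ (k : ℕ)
      have hq0 : q = 0 := by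
        apply hpmin
        · rw [Polynomial.degree_eq_natDegree hpm.ne_zero]
          exact Polynomial.degree_sum_fin_lt _
        · have hc := aeval_mulVec_map A χ q
          have hz : (Polynomial.aeval (complexMatrix A) (q.map (algebraMap ℚ ℂ))).mulVec
              (complexVec χ) = 0 := by
            simp only [q, Polynomial.map_sum, map_sum, Polynomial.map_mul, Polynomial.map_C,
              Polynomial.map_pow, Polynomial.map_X, map_mul, Polynomial.aeval_C, map_pow,
              Polynomial.aeval_X, Matrix.sum_mulVec]
            have : ∀ k : Fin p.natDegree, ((algebraMap ℂ (Matrix (Fin d) (Fin d) ℂ))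
                ((algebraMap ℚ ℂ) (w k : ℚ)) * complexMatrix A ^ (k : ℕ)).mulVec (complexVec χ) =
                complexVec (w k • (A ^ (k : ℕ)).mulVec χ) := by
              intro k
              rw [← Matrix.mulVec_mulVec, ← complexMatrix_pow, complexMatrix_mulVec,
                Algebra.algebraMap_eq_smul_one, Matrix.smul_mulVec, Matrix.one_mulVec]
              ext i
              simp [complexVec]
            simp only [this]
            ext i
            have hi := congrFun hw i
            simp only [Finset.sum_apply, Pi.zero_apply] at hi ⊢
            simp only [complexVec]
            exact_mod_cast hi
          rw [hz] at hc
          ext i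
          have hi := congrFun hc i
          simp only [Pi.zero_apply] at hi ⊢
          exact_mod_cast hi.symm
      ext k
      have hk := congrArg (fun q => Polynomial.coeff q k) hq0
      simp only [q, Polynomial.finsetSum_coeff, Polynomial.coeff_C_mul_X_pow,
        Polynomial.coeff_zero] at hk
      rw [Finset.sum_eq_single k] at hk
      · simpa using hk
      · intro b _ hb
        rw [if_neg]
        intro h
        exact hb (Fin.ext h.symm)
      · simp) (Q * ‖χ‖) (by positivity)
      (fun k hk => hQ k (lt_of_lt_of_le hk hed) χ)
    refine key.trans ?_
    set z := (Polynomial.aeval (complexMatrix A) r).mulVec (complexVec χ)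
    set e := p.natDegree
    have hQχ : 1 ≤ Q * ‖χ‖ := one_le_mul_of_one_le_of_one_le hQ1 hχ1
    have hb1 : 1 ≤ ((d : ℝ) + 1) * (Q * ‖χ‖) ^ 2 := by
      refine one_le_mul_of_one_le_of_one_le ?_ (one_le_pow₀ hQχ)
      linarith [(Nat.cast_nonneg d : (0 : ℝ) ≤ d)]
    calc (e.factorial : ℝ) * ((d * (Q * ‖χ‖) ^ 2) ^ (e - 1) * (d * (Q * ‖χ‖) * ‖z‖))
        ≤ (d.factorial : ℝ) * ((((d : ℝ) + 1) * (Q * ‖χ‖) ^ 2) ^ (e - 1) *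
            ((((d : ℝ) + 1) * (Q * ‖χ‖) ^ 2) * ‖z‖)) := by
          gcongr
          · linarith
          · linarith
          · exact le_self_pow₀ hQχ two_ne_zero
      _ = (d.factorial : ℝ) * ((((d : ℝ) + 1) * (Q * ‖χ‖) ^ 2) ^ e * ‖z‖) := by
          rw [← mul_assoc (_ ^ (e - 1)), ← pow_succ, Nat.sub_add_cancel (by omega)]
      _ ≤ (d.factorial : ℝ) * ((((d : ℝ) + 1) * (Q * ‖χ‖) ^ 2) ^ d * ‖z‖) := by
          gcongr
      _ = _ := by
          rw [pow_mul, mul_pow Q, ← mul_assoc ((d : ℝ) + 1), mul_pow _ (‖χ‖ ^ 2)]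
          ring

lemma exists_gt_one_le_norm (s : Multiset ℂ) :
    ∃ ρ : ℝ, 1 < ρ ∧ ∀ l ∈ s, 1 < ‖l‖ → ρ ≤ ‖l‖ := by
  induction s using Multiset.induction_on with
  | empty => exact ⟨2, by norm_num, by simp⟩
  | cons a s ih =>
    obtain ⟨ρ, h1, h2⟩ := ih
    by_cases ha : 1 < ‖a‖
    · refine ⟨min ρ ‖a‖, lt_min h1 ha, fun l hl hl1 => ?_⟩
      rcases Multiset.mem_cons.1 hl with rfl | hl
      · exact min_le_right _ _
      · exact (min_le_left _ _).trans (h2 l hl hl1)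
    · refine ⟨ρ, h1, fun l hl hl1 => ?_⟩
      rcases Multiset.mem_cons.1 hl with rfl | hl
      · exact absurd hl1 ha
      · exact h2 l hl hl1

lemma pow_mulVec_of_eigenvector {d : ℕ} {M : Matrix (Fin d) (Fin d) ℂ} {z : Fin d → ℂ} {l : ℂ}
    (h : M.mulVec z = l • z) (k : ℕ) : (M ^ k).mulVec z = l ^ k • z := by
  induction k with
  | zero => simp
  | succ k ih => rw [pow_succ, ← Matrix.mulVec_mulVec, h, Matrix.mulVec_smul, ih, smul_smul,
      pow_succ, mul_comm]

lemma aeval_mulVec_of_eigenvector {d : ℕ} {M : Matrix (Fin d) (Fin d) ℂ} {z : Fin d → ℂ} {l : ℂ}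
    (h : M.mulVec z = l • z) (q : Polynomial ℂ) :
    (Polynomial.aeval M q).mulVec z = q.eval l • z := by
  rw [aeval_mulVec_eq_sum (e := q.natDegree + 1) _ _ _ (Nat.lt_succ_self _),
    Polynomial.eval_eq_sum_range, Finset.sum_smul]
  simp only [pow_mulVec_of_eigenvector h, smul_smul]

lemma aeval_mulVec_comm {d : ℕ} (M : Matrix (Fin d) (Fin d) ℂ) (q r : Polynomial ℂ)
    (v : Fin d → ℂ) :
    (Polynomial.aeval M q).mulVec ((Polynomial.aeval M r).mulVec v) =
      (Polynomial.aeval M r).mulVec ((Polynomial.aeval M q).mulVec v) := by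
  rw [Matrix.mulVec_mulVec, Matrix.mulVec_mulVec, ← map_mul, mul_comm, map_mul]

/-- Exponential growth of the orbit of a nonzero integer vector, with polynomial control on the
starting point. -/
lemma exists_growth {d : ℕ} (A : Matrix (Fin d) (Fin d) ℤ) (hdet : A.det = 1)
    (hE : NoRootOfUnityEigenvalue A) :
    ∃ c ρ : ℝ, 0 < c ∧ 1 < ρ ∧ ∀ χ : Fin d → ℤ, χ ≠ 0 → ∀ m : ℕ,
      c * ρ ^ m ≤ ‖χ‖ ^ (2 * d) * ‖(A ^ m).mulVec χ‖ := by
  classical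
  obtain ⟨C, hC, hCχ⟩ := exists_expanding_eigenvector A hdet hE
  obtain ⟨ρ, hρ, hρl⟩ := exists_gt_one_le_norm (complexMatrix A).charpoly.roots
  choose D hD0 hD using fun s : Multiset ℂ =>
    norm_mulVec_le (Polynomial.aeval (complexMatrix A) (rootsPoly s))
  set t := (complexMatrix A).charpoly.roots.powerset.toFinset
  have hDt : 0 ≤ ∑ s ∈ t, D s := Finset.sum_nonneg fun s _ => hD0 s
  set E := 1 + ∑ s ∈ t, D s
  have hE0 : 0 < E := by linarith
  refine ⟨(C * E)⁻¹, ρ, by positivity, hρ, fun χ hχ m => ?_⟩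
  obtain ⟨s, hs, l, hl, hl1, heig, hz⟩ := hCχ χ hχ
  set z := (Polynomial.aeval (complexMatrix A) (rootsPoly s)).mulVec (complexVec χ) with hzdef
  have h1 : ρ ^ m * ‖z‖ ≤ E * ‖(A ^ m).mulVec χ‖ := by
    calc ρ ^ m * ‖z‖ ≤ ‖l‖ ^ m * ‖z‖ := by
          gcongr
          exact hρl l hl hl1
      _ = ‖(complexMatrix A ^ m).mulVec z‖ := by
          rw [pow_mulVec_of_eigenvector heig, norm_smul, norm_pow]
      _ = ‖(Polynomial.aeval (complexMatrix A) (rootsPoly s)).mulVec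
            (complexVec ((A ^ m).mulVec χ))‖ := by
          have := aeval_mulVec_comm (complexMatrix A) (Polynomial.X ^ m) (rootsPoly s)
            (complexVec χ)
          rw [map_pow, Polynomial.aeval_X] at this
          rw [this, ← complexMatrix_pow, complexMatrix_mulVec]
      _ ≤ D s * ‖(A ^ m).mulVec χ‖ := by
          rw [← norm_complexVec ((A ^ m).mulVec χ)]
          exact hD s _
      _ ≤ E * ‖(A ^ m).mulVec χ‖ := by
          gcongr
          have hst : s ∈ t := by
            simp only [t, Multiset.mem_toFinset, Multiset.mem_powerset]
            exact hs
          have := Finset.single_le_sum (fun s _ => hD0 s) hst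
          simp only [E]
          linarith
  rw [inv_mul_le_iff₀ (by positivity)]
  calc ρ ^ m ≤ ρ ^ m * (C * ‖χ‖ ^ (2 * d) * ‖z‖) := le_mul_of_one_le_right (by positivity) hz
    _ = C * ‖χ‖ ^ (2 * d) * (ρ ^ m * ‖z‖) := by ring
    _ ≤ C * ‖χ‖ ^ (2 * d) * (E * ‖(A ^ m).mulVec χ‖) := by gcongr
    _ = _ := by ring

/-- Vectors killed by a polynomial with expanding roots contract exponentially in backward time. -/
lemma exists_backward_decay {d : ℕ} (M N : Matrix (Fin d) (Fin d) ℂ) (hNM : N * M = 1)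
    {θ : ℝ} (hθ : 0 < θ) (s : Multiset ℂ) (hs : ∀ l ∈ s, 1 < θ * ‖l‖) :
    ∀ w : Fin d → ℂ, (Polynomial.aeval M (rootsPoly s)).mulVec w = 0 →
      ∃ C : ℝ, 0 ≤ C ∧ ∀ n : ℕ, ‖(N ^ n).mulVec w‖ ≤ C * θ ^ n := by
  induction s using Multiset.induction_on with
  | empty =>
    intro w hw
    have : w = 0 := by simpa [rootsPoly] using hw
    exact ⟨0, le_rfl, by simp [this]⟩
  | cons l s ih =>
    intro w hw
    have hl := hs l (Multiset.mem_cons_self l s)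
    obtain ⟨C, hC0, hC⟩ := ih (fun a ha => hs a (Multiset.mem_cons_of_mem ha))
      (M.mulVec w - l • w) (by
        rw [rootsPoly, Multiset.map_cons, Multiset.prod_cons, mul_comm, map_mul,
          ← Matrix.mulVec_mulVec, map_sub, Polynomial.aeval_X, Polynomial.aeval_C,
          Matrix.sub_mulVec, Algebra.algebraMap_eq_smul_one, Matrix.smul_mulVec,
          Matrix.one_mulVec] at hw
        exact hw)
    have hpos : 0 < θ * ‖l‖ - 1 := by linarith
    have hl0 : 0 < ‖l‖ := by
      rcases (norm_nonneg l).eq_or_lt with h | h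
      · rw [← h] at hl; linarith
      · exact h
    set C' := ‖w‖ + C * θ / (θ * ‖l‖ - 1) with hC'
    have hC'0 : 0 ≤ C' := by positivity
    refine ⟨C', hC'0, fun n => ?_⟩
    induction n with
    | zero =>
      simp only [pow_zero, Matrix.one_mulVec, mul_one, hC']
      have : 0 ≤ C * θ / (θ * ‖l‖ - 1) := by positivity
      linarith
    | succ n ihn =>
      have h1 : l • (N ^ (n + 1)).mulVec w =
          (N ^ n).mulVec w - (N ^ (n + 1)).mulVec (M.mulVec w - l • w) := by
        rw [Matrix.mulVec_sub, Matrix.mulVec_mulVec, pow_succ, mul_assoc, hNM, mul_one,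
          Matrix.mulVec_smul]
        abel
      have h2 : ‖l‖ * ‖(N ^ (n + 1)).mulVec w‖ ≤ C' * θ ^ n + C * θ ^ (n + 1) := by
        rw [← norm_smul, h1]
        exact (norm_sub_le _ _).trans (add_le_add ihn (hC _))
      have h3 : C' + C * θ ≤ ‖l‖ * (C' * θ) := by
        have : C * θ ≤ C' * (θ * ‖l‖ - 1) := by
          rw [hC', add_mul, div_mul_cancel₀ _ hpos.ne']
          have : 0 ≤ ‖w‖ * (θ * ‖l‖ - 1) := by positivity
          linarith
        linarith
      have h4 : C' * θ ^ n + C * θ ^ (n + 1) ≤ ‖l‖ * (C' * θ ^ (n + 1)) := by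
        have := mul_le_mul_of_nonneg_right h3 (pow_nonneg hθ.le n)
        rw [pow_succ]
        linarith
      exact le_of_mul_le_mul_left (h2.trans h4) hl0

/-- Lacunarity: sums of sufficiently separated iterates of nonzero vectors of a finite set do not
vanish. -/
lemma exists_gap {d : ℕ} (A : Matrix (Fin d) (Fin d) ℤ) (hdet : A.det = 1)
    (hE : NoRootOfUnityEigenvalue A) (G : Finset (Fin d → ℤ)) (hG : ∀ χ ∈ G, χ ≠ 0) :
    ∃ g : ℕ, 1 ≤ g ∧ ∀ (I : Finset ℤ) (l : ℤ → ℤ) (χ : ℤ → Fin d → ℤ), I.Nonempty →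
      (∀ j ∈ I, χ j ∈ G) → (∀ i ∈ I, ∀ j ∈ I, i < j → l i + g ≤ l j) →
      ∑ j ∈ I, (A ^ l j).mulVec (χ j) ≠ 0 := by
  classical
  obtain ⟨C₀, hC₀, hCχ⟩ := exists_expanding_eigenvector A hdet hE
  set roots := (complexMatrix A).charpoly.roots with hroots
  obtain ⟨ρ, hρ, hρl⟩ := exists_gt_one_le_norm roots
  obtain ⟨ρ', hρ'1, hρ'⟩ := exists_between hρ
  set θ := ρ'⁻¹ with hθ
  have hθ0 : 0 < θ := by positivity
  have hθ1 : θ < 1 := inv_lt_one_of_one_lt₀ hρ'1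
  set P := Polynomial.aeval (complexMatrix A) (rootsPoly (roots.filter fun l => ¬ 1 < ‖l‖))
  have hunit : IsUnit A.det := by rw [hdet]; exact isUnit_one
  have hNM : complexMatrix A⁻¹ * complexMatrix A = 1 := by
    rw [← complexMatrix_mul, Matrix.nonsing_inv_mul A hunit, complexMatrix_one]
  have hdecay : ∀ v : Fin d → ℂ, ∃ C : ℝ, 0 ≤ C ∧
      ∀ n : ℕ, ‖(complexMatrix A⁻¹ ^ n).mulVec (P.mulVec v)‖ ≤ C * θ ^ n := by
    intro v
    refine exists_backward_decay _ _ hNM hθ0 (roots.filter fun l => 1 < ‖l‖) ?_ _ ?_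
    · intro l hl
      rw [Multiset.mem_filter] at hl
      have := hρl l hl.1 hl.2
      rw [hθ, inv_mul_eq_div, one_lt_div (by linarith)]
      linarith
    · rw [Matrix.mulVec_mulVec, ← map_mul]
      have : rootsPoly (roots.filter fun l => 1 < ‖l‖) *
          rootsPoly (roots.filter fun l => ¬ 1 < ‖l‖) = (complexMatrix A).charpoly := by
        rw [rootsPoly, rootsPoly, ← Multiset.prod_add, ← Multiset.map_add,
          Multiset.filter_add_not]
        exact (Polynomial.Splits.eq_prod_roots_of_monic (IsAlgClosed.splits _)
          (Matrix.charpoly_monic _)).symm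
      rw [this, Matrix.aeval_self_charpoly, Matrix.zero_mulVec]
  have hP0 : ∀ χ : Fin d → ℤ, χ ≠ 0 → P.mulVec (complexVec χ) ≠ 0 := by
    intro χ hχ h0
    obtain ⟨s, hs, l, hl, hl1, heig, hz⟩ := hCχ χ hχ
    set z := (Polynomial.aeval (complexMatrix A) (rootsPoly s)).mulVec (complexVec χ) with hzdef
    have hz0 : z ≠ 0 := by
      rintro h
      rw [h, norm_zero, mul_zero] at hz
      linarith
    have h1 : P.mulVec z = 0 := by
      rw [hzdef, aeval_mulVec_comm, h0, Matrix.mulVec_zero]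
    rw [aeval_mulVec_of_eigenvector heig] at h1
    rcases smul_eq_zero.1 h1 with h2 | h2
    · rw [rootsPoly, Polynomial.eval_multiset_prod, Multiset.prod_eq_zero_iff, Multiset.map_map,
        Multiset.mem_map] at h2
      obtain ⟨a, ha, ha0⟩ := h2
      simp only [Function.comp, Polynomial.eval_sub, Polynomial.eval_X, Polynomial.eval_C,
        sub_eq_zero] at ha0
      rw [Multiset.mem_filter] at ha
      rw [ha0] at hl1
      exact ha.2 hl1
    · exact hz0 h2
  choose C hC0 hC using fun χ : Fin d → ℤ => hdecay (complexVec χ)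
  have hsum0 : 0 ≤ ∑ χ ∈ G, C χ := Finset.sum_nonneg fun χ _ => hC0 χ
  set K := 1 + ∑ χ ∈ G, C χ with hK
  have hK0 : 0 < K := by linarith
  have hCK : ∀ χ ∈ G, C χ ≤ K := by
    intro χ hχ
    have := Finset.single_le_sum (fun χ _ => hC0 χ) hχ
    linarith
  obtain ⟨m, hm0, hm⟩ : ∃ m : ℝ, 0 < m ∧ ∀ χ ∈ G, m ≤ ‖P.mulVec (complexVec χ)‖ := by
    rcases G.eq_empty_or_nonempty with rfl | hne
    · exact ⟨1, one_pos, by simp⟩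
    · obtain ⟨χ₀, h0, hmin⟩ := G.exists_min_image (fun χ => ‖P.mulVec (complexVec χ)‖) hne
      exact ⟨_, norm_pos_iff.2 (hP0 χ₀ (hG χ₀ h0)), hmin⟩
  obtain ⟨g, hg⟩ : ∃ g : ℕ, θ ^ g < m * (1 - θ) / K :=
    exists_pow_lt_of_lt_one (div_pos (mul_pos hm0 (by linarith)) hK0) hθ1
  refine ⟨g + 1, by omega, fun I l χ hI hχ hsep hzero => ?_⟩
  set J := I.max' hI with hJ
  have hJI : J ∈ I := I.max'_mem hI
  have hlt : ∀ j ∈ I.erase J, l j + (g + 1 : ℕ) ≤ l J := by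
    intro j hj
    rw [Finset.mem_erase] at hj
    exact hsep j hj.2 J hJI (lt_of_le_of_ne (I.le_max' j hj.2) hj.1)
  -- apply `A ^ (-l J)` and project
  have h1 : ∑ j ∈ I, (A ^ (l j - l J)).mulVec (χ j) = 0 := by
    have := congrArg (fun v => (A ^ (-l J)).mulVec v) hzero
    simp only [Matrix.mulVec_zero, Matrix.mulVec_sum, Matrix.mulVec_mulVec] at this
    rw [← this]
    refine Finset.sum_congr rfl fun j _ => ?_
    rw [← Matrix.zpow_add hunit, neg_add_eq_sub]
  have h2 : ∀ j ∈ I.erase J, P.mulVec (complexVec ((A ^ (l j - l J)).mulVec (χ j))) =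
      (complexMatrix A⁻¹ ^ (l J - l j).toNat).mulVec (P.mulVec (complexVec (χ j))) := by
    intro j hj
    have h3 := hlt j hj
    have h4 : A ^ (l j - l J) = A⁻¹ ^ (l J - l j).toNat := by
      have : l j - l J = -((l J - l j).toNat : ℤ) := by push_cast at h3; omega
      rw [this, Matrix.zpow_neg_natCast, Matrix.inv_pow']
    have hcomm : Commute P (complexMatrix A⁻¹) := by
      have hMN : complexMatrix A * complexMatrix A⁻¹ = 1 := by
        rw [← complexMatrix_mul, Matrix.mul_nonsing_inv A hunit, complexMatrix_one]
      have hPA : P * complexMatrix A = complexMatrix A * P := by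
        have := Polynomial.aeval_X (R := ℂ) (complexMatrix A)
        conv_lhs => rw [← this]
        conv_rhs => rw [← this]
        rw [← map_mul, mul_comm, map_mul, this]
      calc P * complexMatrix A⁻¹ = (complexMatrix A⁻¹ * complexMatrix A) * P * complexMatrix A⁻¹ := by
            rw [hNM, one_mul]
        _ = complexMatrix A⁻¹ * (P * complexMatrix A) * complexMatrix A⁻¹ := by
            rw [hPA]; simp only [mul_assoc]
        _ = complexMatrix A⁻¹ * P := by
            rw [mul_assoc, mul_assoc, hMN, mul_one]
    rw [h4, ← complexMatrix_mulVec, complexMatrix_pow, Matrix.mulVec_mulVec, Matrix.mulVec_mulVec,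
      (hcomm.pow_right _).eq]
  have h3 : P.mulVec (complexVec (χ J)) =
      -∑ j ∈ I.erase J, P.mulVec (complexVec ((A ^ (l j - l J)).mulVec (χ j))) := by
    have h4 : P.mulVec (complexVec (∑ j ∈ I, (A ^ (l j - l J)).mulVec (χ j))) = 0 := by
      rw [h1]
      have : complexVec (0 : Fin d → ℤ) = 0 := by ext; simp
      rw [this, Matrix.mulVec_zero]
    have h5 : complexVec (∑ j ∈ I, (A ^ (l j - l J)).mulVec (χ j)) =
        ∑ j ∈ I, complexVec ((A ^ (l j - l J)).mulVec (χ j)) := by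
      ext i
      simp [complexVec, Finset.sum_apply]
    rw [h5, Matrix.mulVec_sum, ← Finset.add_sum_erase I _ hJI, sub_self, zpow_zero,
      Matrix.one_mulVec] at h4
    exact eq_neg_of_add_eq_zero_left h4
  have h4 : ‖P.mulVec (complexVec (χ J))‖ ≤ ∑ j ∈ I.erase J, K * θ ^ (l J - l j).toNat := by
    rw [h3, norm_neg]
    refine norm_sum_le_of_le _ fun j hj => ?_
    rw [h2 j hj]
    refine (hC _ _).trans ?_
    gcongr
    exact hCK _ (hχ j (Finset.mem_of_mem_erase hj))
  have h5 : ∑ j ∈ I.erase J, θ ^ (l J - l j).toNat ≤ θ ^ g * (1 - θ)⁻¹ := by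
    have hinj : Set.InjOn (fun j => (l J - l j).toNat - g) (I.erase J) := by
      intro i hi j hj hij
      have hi' := hlt i hi
      have hj' := hlt j hj
      simp only at hij
      push_cast at hi' hj'
      have hll : l i = l j := by omega
      rcases lt_trichotomy i j with h | h | h
      · have := hsep i (Finset.mem_of_mem_erase hi) j (Finset.mem_of_mem_erase hj) h
        push_cast at this
        omega
      · exact h
      · have := hsep j (Finset.mem_of_mem_erase hj) i (Finset.mem_of_mem_erase hi) h
        push_cast at this
        omega
    calc ∑ j ∈ I.erase J, θ ^ (l J - l j).toNat
        = ∑ j ∈ I.erase J, θ ^ g * θ ^ ((l J - l j).toNat - g) := by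
          refine Finset.sum_congr rfl fun j hj => ?_
          have := hlt j hj
          push_cast at this
          rw [← pow_add]
          congr 1
          omega
      _ = θ ^ g * ∑ k ∈ (I.erase J).image (fun j => (l J - l j).toNat - g), θ ^ k := by
          rw [← Finset.mul_sum, Finset.sum_image hinj]
      _ ≤ θ ^ g * (1 - θ)⁻¹ := by
          gcongr
          rw [← tsum_geometric_of_lt_one hθ0.le hθ1]
          exact Summable.sum_le_tsum _ (fun k _ => by positivity)
            (summable_geometric_of_lt_one hθ0.le hθ1)
  have h6 := hm _ (hχ J hJI)
  rw [← Finset.mul_sum] at h4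
  have h7 : K * (θ ^ g * (1 - θ)⁻¹) < m := by
    rw [lt_div_iff₀ hK0] at hg
    rw [← mul_assoc, ← div_eq_mul_inv, div_lt_iff₀ (by linarith)]
    linarith
  have h8 := mul_le_mul_of_nonneg_left h5 hK0.le
  linarith

lemma norm_one_add_I_mul_le (y : ℝ) : ‖(1 + Complex.I * y : ℂ)‖ ≤ Real.exp (y ^ 2 / 2) := by
  have h : ‖(1 + Complex.I * y : ℂ)‖ ^ 2 = 1 + y ^ 2 := by
    rw [← Complex.normSq_eq_norm_sq, Complex.normSq_apply]
    simp
    ring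
  refine le_of_sq_le_sq ?_ (Real.exp_pos _).le
  rw [h, ← Real.exp_nat_mul]
  have := Real.add_one_le_exp (y ^ 2)
  have e : ((2 : ℕ) : ℝ) * (y ^ 2 / 2) = y ^ 2 := by push_cast; ring
  rw [e]; linarith

lemma norm_exp_I_mul_sub_le (y : ℝ) :
    ‖Complex.exp (Complex.I * y) - (1 + Complex.I * y) * (Real.exp (-(y ^ 2 / 2)) : ℝ)‖
      ≤ 2 * |y| ^ 3 := by
  have n1 : ‖Complex.exp (Complex.I * y)‖ = 1 := by
    rw [mul_comm]; exact Complex.norm_exp_ofReal_mul_I y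
  rcases le_total |y| 1 with hy | hy
  · have hIy : ‖Complex.I * (y : ℂ)‖ = |y| := by simp
    have h1 := Complex.exp_bound (x := Complex.I * y) (by rw [hIy]; exact hy) (n := 3) (by norm_num)
    rw [hIy] at h1
    simp only [Finset.sum_range_succ, Finset.sum_range_zero, Nat.factorial] at h1
    have hy2 : y ^ 2 ≤ 1 := by rw [← sq_abs]; nlinarith [abs_nonneg y]
    have h2 := Real.abs_exp_sub_one_sub_id_le (x := -(y ^ 2 / 2))
      (by rw [abs_neg, abs_of_nonneg (by positivity)]; linarith)
    have key : Complex.exp (Complex.I * y) - (1 + Complex.I * y) * (Real.exp (-(y ^ 2 / 2)) : ℝ)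
        = (Complex.exp (Complex.I * y) - (1 + Complex.I * y - (y : ℂ) ^ 2 / 2))
          + Complex.I * (y : ℂ) ^ 3 / 2
          - (1 + Complex.I * y) * ((Real.exp (-(y ^ 2 / 2)) - 1 - -(y ^ 2 / 2) : ℝ) : ℂ) := by
      push_cast
      ring
    have hn1 : ‖Complex.exp (Complex.I * y) - (1 + Complex.I * y - (y : ℂ) ^ 2 / 2)‖
        ≤ |y| ^ 3 * (2 / 9) := by
      refine le_trans (le_of_eq ?_) (h1.trans (le_of_eq ?_))
      · congr 2
        simp [mul_pow]
        ring
      · norm_num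
    have hn2 : ‖Complex.I * (y : ℂ) ^ 3 / 2‖ = |y| ^ 3 / 2 := by simp
    have hn3 : ‖(1 + Complex.I * y : ℂ)‖ ≤ 2 := by
      refine (norm_add_le _ _).trans ?_
      rw [hIy]; simp; linarith
    have hn4 : ‖(1 + Complex.I * y) * ((Real.exp (-(y ^ 2 / 2)) - 1 - -(y ^ 2 / 2) : ℝ) : ℂ)‖
        ≤ 2 * (|y| ^ 3 / 4) := by
      rw [norm_mul, Complex.norm_real, Real.norm_eq_abs]
      refine mul_le_mul hn3 (h2.trans ?_) (abs_nonneg _) (by norm_num)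
      have : (-(y ^ 2 / 2)) ^ 2 = |y| ^ 3 * |y| / 4 := by
        rw [← sq_abs y]; ring
      rw [this]
      have := pow_nonneg (abs_nonneg y) 3
      nlinarith
    rw [key]
    refine (norm_sub_le _ _).trans ?_
    have := norm_add_le (Complex.exp (Complex.I * y) - (1 + Complex.I * y - (y : ℂ) ^ 2 / 2))
      (Complex.I * (y : ℂ) ^ 3 / 2)
    have := pow_nonneg (abs_nonneg y) 3
    linarith
  · refine (norm_sub_le _ _).trans ?_
    have h3 : (1 : ℝ) ≤ |y| ^ 3 := one_le_pow₀ hy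
    have h4 : ‖(1 + Complex.I * y) * ((Real.exp (-(y ^ 2 / 2)) : ℝ) : ℂ)‖ ≤ 1 := by
      rw [norm_mul, Complex.norm_real, Real.norm_eq_abs, Real.abs_exp]
      calc _ ≤ Real.exp (y ^ 2 / 2) * Real.exp (-(y ^ 2 / 2)) := by
            gcongr; exact norm_one_add_I_mul_le y
        _ = 1 := by rw [← Real.exp_add]; simp
    linarith

lemma norm_prod_sub_prod_le {ι : Type*} (J : Finset ι) (u v : ι → ℂ)
    (hu : ∀ j ∈ J, ‖u j‖ ≤ 1) (hv : ∀ j ∈ J, ‖v j‖ ≤ 1) :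
    ‖∏ j ∈ J, u j - ∏ j ∈ J, v j‖ ≤ ∑ j ∈ J, ‖u j - v j‖ := by
  classical
  induction J using Finset.induction_on with
  | empty => simp
  | insert a s ha ih =>
    rw [Finset.prod_insert ha, Finset.prod_insert ha, Finset.sum_insert ha]
    have e : u a * ∏ j ∈ s, u j - v a * ∏ j ∈ s, v j
        = (u a - v a) * ∏ j ∈ s, u j + v a * (∏ j ∈ s, u j - ∏ j ∈ s, v j) := by ring
    rw [e]
    refine (norm_add_le _ _).trans (add_le_add ?_ ?_)
    · rw [norm_mul]
      refine mul_le_of_le_one_right (norm_nonneg _) ?_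
      rw [norm_prod]
      exact Finset.prod_le_one (fun _ _ => norm_nonneg _)
        fun j hj => hu j (Finset.mem_insert_of_mem hj)
    · rw [norm_mul]
      refine (mul_le_of_le_one_left (norm_nonneg _) (hv a (Finset.mem_insert_self a s))).trans ?_
      exact ih (fun j hj => hu j (Finset.mem_insert_of_mem hj))
        fun j hj => hv j (Finset.mem_insert_of_mem hj)

lemma norm_prod_one_add_I_mul_le {ι : Type*} (J : Finset ι) (y : ι → ℝ) :
    ‖∏ j ∈ J, (1 + Complex.I * y j : ℂ)‖ ≤ Real.exp ((∑ j ∈ J, y j ^ 2) / 2) := by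
  rw [norm_prod, Finset.sum_div, Real.exp_sum]
  exact Finset.prod_le_prod (fun _ _ => norm_nonneg _) fun j _ => norm_one_add_I_mul_le _

lemma norm_exp_I_sum_sub_le {ι : Type*} (J : Finset ι) (y : ι → ℝ) :
    ‖Complex.exp (Complex.I * (∑ j ∈ J, y j : ℝ)) -
      (∏ j ∈ J, (1 + Complex.I * y j : ℂ)) * (Real.exp (-((∑ j ∈ J, y j ^ 2) / 2)) : ℝ)‖
      ≤ ∑ j ∈ J, 2 * |y j| ^ 3 := by
  have e1 : Complex.exp (Complex.I * (∑ j ∈ J, y j : ℝ))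
      = ∏ j ∈ J, Complex.exp (Complex.I * y j) := by
    rw [← Complex.exp_sum]; push_cast; rw [Finset.mul_sum]
  have e2 : (∏ j ∈ J, (1 + Complex.I * y j : ℂ)) * (Real.exp (-((∑ j ∈ J, y j ^ 2) / 2)) : ℝ)
      = ∏ j ∈ J, ((1 + Complex.I * y j) * (Real.exp (-(y j ^ 2 / 2)) : ℝ)) := by
    rw [Finset.prod_mul_distrib, ← Complex.ofReal_prod, ← Real.exp_sum, Finset.sum_neg_distrib,
      Finset.sum_div]
  rw [e1, e2]
  refine (norm_prod_sub_prod_le J _ _ ?_ ?_).trans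
    (Finset.sum_le_sum fun j _ => norm_exp_I_mul_sub_le (y j))
  · intro j _
    rw [mul_comm]; exact (Complex.norm_exp_ofReal_mul_I _).le
  · intro j _
    rw [norm_mul, Complex.norm_real, Real.norm_eq_abs, Real.abs_exp]
    calc _ ≤ Real.exp (y j ^ 2 / 2) * Real.exp (-(y j ^ 2 / 2)) := by
          gcongr; exact norm_one_add_I_mul_le _
      _ = 1 := by rw [← Real.exp_add]; simp

lemma abs_exp_neg_sub_exp_neg_le {u v : ℝ} (hu : 0 ≤ u) (hv : 0 ≤ v) :
    |Real.exp (-u) - Real.exp (-v)| ≤ |u - v| := by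
  wlog h : u ≤ v generalizing u v
  · rw [abs_sub_comm, abs_sub_comm u v]; exact this hv hu (le_of_not_ge h)
  rw [abs_of_nonneg (sub_nonneg.2 (Real.exp_le_exp.2 (by linarith))), abs_of_nonpos (by linarith)]
  have h1 : Real.exp (-v) = Real.exp (-u) * Real.exp (u - v) := by rw [← Real.exp_add]; ring_nf
  have h2 := Real.add_one_le_exp (u - v)
  have h3 : Real.exp (-u) ≤ 1 := Real.exp_le_one_iff.2 (by linarith)
  have h4 := Real.exp_pos (-u)
  have h5 : Real.exp (-u) * (1 - Real.exp (u - v)) ≤ 1 * (v - u) :=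
    mul_le_mul h3 (by linarith) (by
      have : Real.exp (u - v) ≤ 1 := Real.exp_le_one_iff.2 (by linarith)
      linarith) (by norm_num)
  rw [h1]; linarith

section
variable {X : Type*} [MeasurableSpace X] {μ : Measure X} [IsProbabilityMeasure μ]

lemma integrable_of_abs_le {g : X → ℝ} (hg : Measurable g) {C : ℝ} (h : ∀ x, |g x| ≤ C) :
    Integrable g μ :=
  Integrable.of_bound hg.aestronglyMeasurable C (ae_of_all _ h)

lemma integral_prod_one_add_I_mul {ι : Type*} (J : Finset ι) (Y : ι → X → ℝ) (B : ι → ℝ)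
    (hY : ∀ j, Measurable (Y j)) (hB : ∀ j x, |Y j x| ≤ B j)
    (h0 : ∀ I ⊆ J, I.Nonempty → ∫ x, ∏ j ∈ I, Y j x ∂μ = 0) :
    ∫ x, ∏ j ∈ J, (1 + Complex.I * Y j x : ℂ) ∂μ = 1 := by
  classical
  have hInt : ∀ I : Finset ι, Integrable (fun x => ∏ j ∈ I, Y j x) μ := fun I =>
    integrable_of_abs_le (Finset.measurable_prod I fun j _ => hY j) (C := ∏ j ∈ I, B j) fun x => by
      rw [Finset.abs_prod]
      exact Finset.prod_le_prod (fun _ _ => abs_nonneg _) fun j _ => hB j x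
  have e : ∀ x, ∏ j ∈ J, (1 + Complex.I * Y j x : ℂ)
      = ∑ I ∈ J.powerset, Complex.I ^ I.card * ((∏ j ∈ I, Y j x : ℝ) : ℂ) := by
    intro x
    rw [Finset.prod_one_add]
    refine Finset.sum_congr rfl fun I _ => ?_
    rw [Finset.prod_mul_distrib, Finset.prod_const]
    push_cast; rfl
  simp_rw [e]
  rw [integral_finsetSum _ fun I _ => ((hInt I).ofReal.const_mul _)]
  simp_rw [integral_const_mul, integral_complex_ofReal]
  rw [Finset.sum_eq_single ∅]
  · simp
  · intro I hI hne
    rw [h0 I (Finset.mem_powerset.1 hI) (Finset.nonempty_iff_ne_empty.2 hne)]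
    simp
  · simp

lemma norm_charfun_sub_le {ι : Type*} (J : Finset ι) (Y : ι → X → ℝ) (B : ι → ℝ)
    (hY : ∀ j, Measurable (Y j)) (hB : ∀ j x, |Y j x| ≤ B j)
    (h0 : ∀ I ⊆ J, I.Nonempty → ∫ x, ∏ j ∈ I, Y j x ∂μ = 0) {q : ℝ} (hq : 0 ≤ q) :
    ‖∫ x, Complex.exp (Complex.I * (∑ j ∈ J, Y j x : ℝ)) ∂μ - (Real.exp (-(q / 2)) : ℝ)‖
      ≤ ∑ j ∈ J, 2 * B j ^ 3
        + Real.exp ((∑ j ∈ J, B j ^ 2) / 2) * ∫ x, |∑ j ∈ J, Y j x ^ 2 - q| ∂μ := by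
  set T : X → ℂ := fun x => ∏ j ∈ J, (1 + Complex.I * Y j x : ℂ) with hT
  set Q : X → ℝ := fun x => ∑ j ∈ J, Y j x ^ 2 with hQ
  have hQm : Measurable Q := Finset.measurable_sum J fun j _ => (hY j).pow_const 2
  have hTm : Measurable T := Finset.measurable_prod J fun j _ =>
    (measurable_const.add (measurable_const.mul (Complex.measurable_ofReal.comp (hY j))))
  have hYsq : ∀ j x, Y j x ^ 2 ≤ B j ^ 2 := fun j x => by
    rw [← sq_abs (Y j x)]; exact pow_le_pow_left₀ (abs_nonneg _) (hB j x) 2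
  have hQB : ∀ x, Q x ≤ ∑ j ∈ J, B j ^ 2 := fun x => Finset.sum_le_sum fun j _ => hYsq j x
  have hQ0 : ∀ x, 0 ≤ Q x := fun x => Finset.sum_nonneg fun j _ => sq_nonneg _
  have hTn : ∀ x, ‖T x‖ ≤ Real.exp ((∑ j ∈ J, B j ^ 2) / 2) := fun x =>
    (norm_prod_one_add_I_mul_le J _).trans (Real.exp_le_exp.2 (by
      have := hQB x
      simp only [hQ] at this
      linarith))
  have hTi : Integrable T μ := Integrable.of_bound hTm.aestronglyMeasurable _ (ae_of_all _ hTn)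
  have hE : ∫ x, T x ∂μ = 1 := integral_prod_one_add_I_mul J Y B hY hB h0
  have hexpm : Measurable fun x => Complex.exp (Complex.I * (∑ j ∈ J, Y j x : ℝ)) :=
    Complex.measurable_exp.comp (measurable_const.mul
      (Complex.measurable_ofReal.comp (Finset.measurable_sum J fun j _ => hY j)))
  have hexpi : Integrable (fun x => Complex.exp (Complex.I * (∑ j ∈ J, Y j x : ℝ))) μ :=
    Integrable.of_bound hexpm.aestronglyMeasurable 1 (ae_of_all _ fun x => by
      rw [mul_comm]; exact (Complex.norm_exp_ofReal_mul_I _).le)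
  have hTQm : Measurable fun x => T x * (Real.exp (-(Q x / 2)) : ℝ) :=
    hTm.mul (Complex.measurable_ofReal.comp (Real.measurable_exp.comp (hQm.div_const 2).neg))
  have hTQi : Integrable (fun x => T x * (Real.exp (-(Q x / 2)) : ℝ)) μ :=
    Integrable.of_bound hTQm.aestronglyMeasurable
      (Real.exp ((∑ j ∈ J, B j ^ 2) / 2)) (ae_of_all _ fun x => by
      rw [norm_mul, Complex.norm_real, Real.norm_eq_abs, Real.abs_exp]
      refine (mul_le_of_le_one_right (norm_nonneg _) ?_).trans (hTn x)
      exact Real.exp_le_one_iff.2 (by have := hQ0 x; linarith))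
  have hQi : Integrable (fun x => |Q x - q|) μ :=
    (integrable_of_abs_le (hQm.sub_const q) (C := ∑ j ∈ J, B j ^ 2 + q) fun x => by
      rw [abs_le]; constructor <;> linarith [hQ0 x, hQB x]).abs
  have split : ∫ x, Complex.exp (Complex.I * (∑ j ∈ J, Y j x : ℝ)) ∂μ - (Real.exp (-(q / 2)) : ℝ)
      = ∫ x, (Complex.exp (Complex.I * (∑ j ∈ J, Y j x : ℝ)) - T x * (Real.exp (-(Q x / 2)) : ℝ)) ∂μ
        + ∫ x, T x * ((Real.exp (-(Q x / 2)) - Real.exp (-(q / 2)) : ℝ) : ℂ) ∂μ := by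
    have e2 : ∀ x, T x * ((Real.exp (-(Q x / 2)) - Real.exp (-(q / 2)) : ℝ) : ℂ)
        = T x * (Real.exp (-(Q x / 2)) : ℝ) - T x * (Real.exp (-(q / 2)) : ℝ) := by
      intro x; push_cast; ring
    simp_rw [e2]
    rw [integral_sub hexpi hTQi, integral_sub hTQi (hTi.mul_const _), integral_mul_const, hE]
    ring
  rw [split]
  refine (norm_add_le _ _).trans (add_le_add ?_ ?_)
  · refine (norm_integral_le_of_norm_le_const (C := ∑ j ∈ J, 2 * B j ^ 3)
      (ae_of_all _ fun x => ?_)).trans (by simp)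
    refine (norm_exp_I_sum_sub_le J _).trans (Finset.sum_le_sum fun j _ => ?_)
    gcongr
    exact hB j x
  · refine (norm_integral_le_of_norm_le (hQi.const_mul _) (ae_of_all _ fun x => ?_)).trans
      (integral_const_mul _ _).le
    rw [norm_mul, Complex.norm_real, Real.norm_eq_abs]
    refine mul_le_mul (hTn x) ?_ (abs_nonneg _) (Real.exp_pos _).le
    refine (abs_exp_neg_sub_exp_neg_le (by linarith [hQ0 x]) (by linarith)).trans ?_
    rw [← sub_div, abs_div, abs_two]
    linarith [abs_nonneg (Q x - q)]

end

lemma sq_sub_le_mul_sum_sq (a : ℤ → ℝ) (b : ℤ) {i c p : ℕ} (hic : i ≤ c) (hcp : c ≤ p) :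
    (a (b + c) - a (b + i)) ^ 2
      ≤ p * ∑ k ∈ Finset.range p, (a (b + k + 1) - a (b + k)) ^ 2 := by
  have h1 : a (b + c) - a (b + i) = ∑ k ∈ Finset.Ico i c, (a (b + k + 1) - a (b + k)) := by
    have := Finset.sum_Ico_sub (fun k : ℕ => a (b + k)) hic
    rw [← this]
    refine Finset.sum_congr rfl fun k _ => ?_
    push_cast
    rw [add_assoc]
  rw [h1]
  refine sq_sum_le_card_mul_sum_sq.trans ?_
  refine mul_le_mul ?_ ?_ (Finset.sum_nonneg fun _ _ => sq_nonneg _) (by positivity)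
  · rw [Nat.card_Ico]; exact_mod_cast (Nat.sub_le c i).trans hcp
  · refine Finset.sum_le_sum_of_subset_of_nonneg (fun k hk => ?_) fun _ _ _ => sq_nonneg _
    rw [Finset.mem_Ico] at hk
    exact Finset.mem_range.2 (by omega)

section FiniteSupport
variable {a : ℤ → ℝ}

lemma finite_support_shift (ha : a.support.Finite) (m : ℤ) :
    (fun l => a (l + m)).support.Finite :=
  ha.preimage (f := fun l => l + m) (add_left_injective m).injOn

lemma summable_sq_of_finite_support (ha : a.support.Finite) : Summable fun l => a l ^ 2 :=
  summable_of_hasFiniteSupport (ha.subset fun l hl => by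
    simp only [Function.mem_support] at *; contrapose! hl; simp [hl])

lemma summable_mul_of_finite_support (ha : a.support.Finite) (b : ℤ → ℝ) :
    Summable fun l => a l * b l :=
  summable_of_hasFiniteSupport (ha.subset fun l hl => by
    simp only [Function.mem_support] at *; contrapose! hl; simp [hl])

lemma finite_support_sub_shift (ha : a.support.Finite) (m : ℤ) :
    (fun l => a (l + m) - a l).support.Finite :=
  ((finite_support_shift ha m).union ha).subset fun l hl => by
    simp only [Function.mem_support, Set.mem_union] at *
    by_contra! h
    simp [h.1, h.2] at hl

lemma summable_sq_sub_shift (ha : a.support.Finite) (m : ℤ) :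
    Summable fun l => (a (l + m) - a l) ^ 2 :=
  summable_sq_of_finite_support (finite_support_sub_shift ha m)

lemma tsum_shift (F : ℤ → ℝ) (m : ℤ) : ∑' l, F (l + m) = ∑' l, F l :=
  (Equiv.addRight m).tsum_eq F

lemma tsum_sq_sub_natCast_le (ha : a.support.Finite) (m : ℕ) :
    ∑' l, (a (l + m) - a l) ^ 2 ≤ (m : ℝ) ^ 2 * ∑' l, (a (l + 1) - a l) ^ 2 := by
  have hs : ∀ k : ℕ, Summable fun l : ℤ => (a (l + k + 1) - a (l + k)) ^ 2 := fun k =>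
    (summable_sq_sub_shift ha 1).comp_injective (add_left_injective (k : ℤ))
  calc ∑' l, (a (l + m) - a l) ^ 2
      ≤ ∑' l : ℤ, (m : ℝ) * ∑ k ∈ Finset.range m, (a (l + k + 1) - a (l + k)) ^ 2 := by
        refine (summable_sq_sub_shift ha m).tsum_le_tsum (fun l => ?_)
          ((summable_sum fun k _ => hs k).mul_left _)
        simpa using sq_sub_le_mul_sum_sq a l (Nat.zero_le m) le_rfl
    _ = (m : ℝ) ^ 2 * ∑' l, (a (l + 1) - a l) ^ 2 := by
        rw [tsum_mul_left, Summable.tsum_finsetSum fun k _ => hs k,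
          Finset.sum_congr rfl fun (k : ℕ) _ => tsum_shift (fun l => (a (l + 1) - a l) ^ 2) k]
        simp
        ring

lemma tsum_sq_sub_shift_le (ha : a.support.Finite) (m : ℤ) :
    ∑' l, (a (l + m) - a l) ^ 2 ≤ (m : ℝ) ^ 2 * ∑' l, (a (l + 1) - a l) ^ 2 := by
  obtain ⟨k, rfl | rfl⟩ := m.eq_nat_or_neg
  · exact_mod_cast tsum_sq_sub_natCast_le ha k
  · have := tsum_sq_sub_natCast_le ha k
    rw [← tsum_shift _ (-(k : ℤ))] at this
    refine le_trans (le_of_eq (tsum_congr fun l => ?_)) (this.trans (by push_cast; simp))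
    rw [neg_add_cancel_right]
    ring

lemma tsum_mul_shift (ha : a.support.Finite) (m : ℤ) :
    ∑' l, a l * a (l + m) = ∑' l, a l ^ 2 - (∑' l, (a (l + m) - a l) ^ 2) / 2 := by
  have h1 := summable_sq_of_finite_support ha
  have h2 := summable_sq_of_finite_support (finite_support_shift ha m)
  have h3 := summable_mul_of_finite_support ha fun l => a (l + m)
  have e : ∑' l, (a (l + m) - a l) ^ 2
      = ∑' l, a (l + m) ^ 2 + ∑' l, a l ^ 2 - 2 * ∑' l, a l * a (l + m) := by
    rw [← tsum_mul_left, ← h2.tsum_add h1, ← (h2.add h1).tsum_sub (h3.mul_left 2)]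
    refine tsum_congr fun l => ?_
    ring
  rw [e, tsum_shift fun l => a l ^ 2]
  ring

lemma sum_sum_mul_eq (ha : a.support.Finite) {r : ℤ → ℝ} {g : ℕ}
    (hr : ∀ m : ℤ, (g : ℤ) ≤ |m| → r m = 0) :
    ∑ l ∈ ha.toFinset, ∑ l' ∈ ha.toFinset, a l * a l' * r (l' - l)
      = ∑ m ∈ Finset.Ioo (-(g : ℤ)) g, r m * ∑' l, a l * a (l + m) := by
  have h1 : ∀ l, ∑ l' ∈ ha.toFinset, a l * a l' * r (l' - l)
      = ∑ m ∈ Finset.Ioo (-(g : ℤ)) g, a l * a (l + m) * r m := by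
    intro l
    have h0 : ∀ l' ∉ ha.toFinset, a l * a l' * r (l' - l) = 0 := fun l' hl' => by
      have : a l' = 0 := by simpa using hl'
      simp [this]
    rw [← tsum_eq_sum (L := .unconditional ℤ) h0, ← (Equiv.addLeft l).tsum_eq, tsum_eq_sum (s := Finset.Ioo (-(g : ℤ)) g)]
    · refine Finset.sum_congr rfl fun m _ => ?_
      simp
    · intro m hm
      have : (g : ℤ) ≤ |m| := by
        rw [Finset.mem_Ioo, ← abs_lt] at hm; exact not_lt.1 hm
      simp [hr m this]
  simp_rw [h1]
  rw [Finset.sum_comm]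
  refine Finset.sum_congr rfl fun m _ => ?_
  rw [← Finset.sum_mul, mul_comm]
  congr 1
  rw [tsum_eq_sum]
  intro l hl
  have : a l = 0 := by simpa using hl
  simp [this]

lemma abs_sum_sum_sub_le (ha : a.support.Finite) {r : ℤ → ℝ} {g : ℕ}
    (hr : ∀ m : ℤ, (g : ℤ) ≤ |m| → r m = 0) :
    |∑ l ∈ ha.toFinset, ∑ l' ∈ ha.toFinset, a l * a l' * r (l' - l)
        - (∑' m, r m) * ∑' l, a l ^ 2|
      ≤ (∑ m ∈ Finset.Ioo (-(g : ℤ)) g, |r m| * (m : ℝ) ^ 2) / 2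
          * ∑' l, (a (l + 1) - a l) ^ 2 := by
  rw [sum_sum_mul_eq ha hr, tsum_eq_sum (s := Finset.Ioo (-(g : ℤ)) g) (fun m hm => by
    rw [Finset.mem_Ioo, ← abs_lt] at hm; exact hr m (not_lt.1 hm)), Finset.sum_mul,
    ← Finset.sum_sub_distrib, Finset.sum_div, Finset.sum_mul]
  refine (Finset.abs_sum_le_sum_abs _ _).trans (Finset.sum_le_sum fun m _ => ?_)
  rw [tsum_mul_shift ha]
  have e : r m * (∑' l, a l ^ 2 - (∑' l, (a (l + m) - a l) ^ 2) / 2) - r m * ∑' l, a l ^ 2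
      = - (r m * ((∑' l, (a (l + m) - a l) ^ 2) / 2)) := by ring
  rw [e, abs_neg, abs_mul, abs_of_nonneg (a := (∑' l, (a (l + m) - a l) ^ 2) / 2)
    (div_nonneg (tsum_nonneg fun _ => sq_nonneg _) two_pos.le)]
  have := mul_le_mul_of_nonneg_left (tsum_sq_sub_shift_le ha m) (abs_nonneg (r m))
  linarith

lemma sq_le_of_tsum_le (ha : a.support.Finite) (l : ℤ) {M : ℕ} (hM : 1 ≤ M) :
    a l ^ 2 ≤ 2 / M * ∑' k, a k ^ 2 + 2 * M * ∑' k, (a (k + 1) - a k) ^ 2 := by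
  set D := ∑' k, (a (k + 1) - a k) ^ 2
  have hsum : ∀ {F : ℤ → ℝ}, Summable F → (∀ k, 0 ≤ F k) →
      ∑ i ∈ Finset.range M, F (l + i) ≤ ∑' k, F k := by
    intro F hF h0
    rw [← Finset.sum_image (f := F) (g := fun i : ℕ => l + i) (fun i _ j _ h => by simpa using h)]
    exact hF.sum_le_tsum _ fun k _ => h0 k
  have h1 : ∀ i ∈ Finset.range M, a l ^ 2 ≤ 2 * a (l + i) ^ 2 + 2 * (M * D) := by
    intro i hi
    have := sq_sub_le_mul_sum_sq a l (Nat.zero_le i) (Finset.mem_range.1 hi).le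
    have h2 := mul_le_mul_of_nonneg_left (hsum (summable_sq_sub_shift ha 1) fun _ => sq_nonneg _)
      (Nat.cast_nonneg (α := ℝ) M)
    simp only [Nat.cast_zero, add_zero] at this
    nlinarith [sq_nonneg (a l - 2 * a (l + i))]
  have h2 := Finset.sum_le_sum h1
  rw [Finset.sum_add_distrib, ← Finset.mul_sum] at h2
  simp only [Finset.sum_const, Finset.card_range, nsmul_eq_mul] at h2
  have h3 := hsum (summable_sq_of_finite_support ha) fun _ => sq_nonneg _
  have hM' : (0 : ℝ) < M := by exact_mod_cast hM
  have h4 : (M : ℝ) * a l ^ 2 ≤ M * (2 / M * ∑' k, a k ^ 2 + 2 * M * D) := by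
    have : (M : ℝ) * (2 / M * ∑' k, a k ^ 2 + 2 * M * D) = 2 * ∑' k, a k ^ 2 + M * (2 * (M * D)) := by
      field_simp
    rw [this]; linarith
  exact le_of_mul_le_mul_left h4 hM'

section Blocks
variable {L g : ℕ}

lemma block_injective (hp : 0 < L + g) (J : Finset ℤ) :
    Set.InjOn (fun z : ℤ × ℕ => ((L + g : ℕ) : ℤ) * z.1 + z.2)
      (J ×ˢ Finset.range (L + g) : Finset (ℤ × ℕ)) := by
  rintro ⟨j, i⟩ h ⟨j', i'⟩ h' e
  simp only [Finset.coe_product, Set.mem_prod, Finset.mem_coe, Finset.mem_range] at h h' e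
  have hp' : (0 : ℤ) < ((L + g : ℕ) : ℤ) := by exact_mod_cast hp
  have hj : j = j' := by
    have h1 : (((L + g : ℕ) : ℤ) * j + i) / ((L + g : ℕ) : ℤ) = j := by
      rw [Int.mul_add_ediv_left _ _ hp'.ne', Int.ediv_eq_zero_of_lt (by positivity)
        (by exact_mod_cast h.2), add_zero]
    have h2 : (((L + g : ℕ) : ℤ) * j' + i') / ((L + g : ℕ) : ℤ) = j' := by
      rw [Int.mul_add_ediv_left _ _ hp'.ne', Int.ediv_eq_zero_of_lt (by positivity)
        (by exact_mod_cast h'.2), add_zero]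
    rw [← h1, e, h2]
  subst hj
  simpa using e

lemma sum_block_le_tsum (hp : 0 < L + g) (J : Finset ℤ) {F : ℤ → ℝ} (hF : Summable F)
    (h0 : ∀ l, 0 ≤ F l) :
    ∑ j ∈ J, ∑ i ∈ Finset.range (L + g), F (((L + g : ℕ) : ℤ) * j + i) ≤ ∑' l, F l := by
  rw [← Finset.sum_product' (f := fun j (i : ℕ) => F (((L + g : ℕ) : ℤ) * j + i)),
    ← Finset.sum_image (f := F) (g := fun z : ℤ × ℕ => ((L + g : ℕ) : ℤ) * z.1 + z.2)
      (block_injective hp J)]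
  exact hF.sum_le_tsum _ fun l _ => h0 l

lemma sum_block_eq_sum (hp : 0 < L + g) (s : Finset ℤ) {F : ℤ → ℝ}
    (hF : ∀ l, l ∉ s → F l = 0) :
    ∑ j ∈ s.image (· / ((L + g : ℕ) : ℤ)), ∑ i ∈ Finset.range (L + g),
      F (((L + g : ℕ) : ℤ) * j + i) = ∑ l ∈ s, F l := by
  rw [← Finset.sum_product' (f := fun j (i : ℕ) => F (((L + g : ℕ) : ℤ) * j + i)),
    ← Finset.sum_image (f := F) (g := fun z : ℤ × ℕ => ((L + g : ℕ) : ℤ) * z.1 + z.2)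
      (block_injective hp _)]
  symm
  refine Finset.sum_subset (fun l hl => ?_) fun l _ hl => hF l hl
  have hp' : (0 : ℤ) < ((L + g : ℕ) : ℤ) := by exact_mod_cast hp
  have h1 := Int.emod_nonneg l hp'.ne'
  have h2 := Int.emod_lt_of_pos l hp'
  refine Finset.mem_image.2 ⟨(l / ((L + g : ℕ) : ℤ), (l % ((L + g : ℕ) : ℤ)).toNat), ?_, ?_⟩
  · rw [Finset.mem_product]
    refine ⟨Finset.mem_image_of_mem _ hl, Finset.mem_range.2 ?_⟩
    simp only
    omega
  · simp only
    rw [Int.toNat_of_nonneg h1]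
    exact Int.mul_ediv_add_emod l _

lemma sum_gap_sq_le (hL : 1 ≤ L) (ha : a.support.Finite) (J : Finset ℤ) :
    ∑ j ∈ J, ∑ c ∈ Finset.Ico L (L + g), a (((L + g : ℕ) : ℤ) * j + c) ^ 2
      ≤ g * (2 / L * ∑' l, a l ^ 2 + 2 * (L + g : ℕ) * ∑' l, (a (l + 1) - a l) ^ 2) := by
  have hp : 0 < L + g := by omega
  have hL' : (0 : ℝ) < L := by exact_mod_cast hL
  set p : ℕ := L + g with hpdef
  set S1 : ℤ → ℝ := fun j => ∑ i ∈ Finset.range p, a ((p : ℤ) * j + i) ^ 2 with hS1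
  set S2 : ℤ → ℝ := fun j => ∑ i ∈ Finset.range p,
    (a ((p : ℤ) * j + i + 1) - a ((p : ℤ) * j + i)) ^ 2 with hS2
  have key : ∀ j, ∀ c ∈ Finset.Ico L p, a ((p : ℤ) * j + c) ^ 2 ≤ 2 / L * S1 j + 2 * p * S2 j := by
    intro j c hc
    rw [Finset.mem_Ico] at hc
    have h1 : ∀ i ∈ Finset.range L,
        a ((p : ℤ) * j + c) ^ 2 ≤ 2 * a ((p : ℤ) * j + i) ^ 2 + 2 * (p * S2 j) := by
      intro i hi
      have := sq_sub_le_mul_sum_sq a ((p : ℤ) * j) (i := i) (c := c) (p := p)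
        (by have := Finset.mem_range.1 hi; omega) hc.2.le
      nlinarith [sq_nonneg (a ((p : ℤ) * j + c) - 2 * a ((p : ℤ) * j + i))]
    have h2 := Finset.sum_le_sum h1
    rw [Finset.sum_add_distrib, ← Finset.mul_sum] at h2
    simp only [Finset.sum_const, Finset.card_range, nsmul_eq_mul] at h2
    have h3 : ∑ i ∈ Finset.range L, a ((p : ℤ) * j + i) ^ 2 ≤ S1 j :=
      Finset.sum_le_sum_of_subset_of_nonneg
        (Finset.range_subset_range.2 (by omega)) fun _ _ _ => sq_nonneg _
    have h4 : (L : ℝ) * (2 / L * S1 j + 2 * p * S2 j) = 2 * S1 j + L * (2 * (p * S2 j)) := by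
      field_simp
    exact le_of_mul_le_mul_left (by rw [h4]; linarith) hL'
  have hs1 := sum_block_le_tsum hp J (summable_sq_of_finite_support ha) fun _ => sq_nonneg _
  have hs2 := sum_block_le_tsum hp J (summable_sq_sub_shift ha 1) fun _ => sq_nonneg _
  calc _ ≤ ∑ j ∈ J, ∑ c ∈ Finset.Ico L p, (2 / L * S1 j + 2 * p * S2 j) :=
        Finset.sum_le_sum fun j _ => Finset.sum_le_sum fun c hc => key j c hc
    _ = g * (2 / L * ∑ j ∈ J, S1 j + 2 * p * ∑ j ∈ J, S2 j) := by
        simp only [Finset.sum_const, Nat.card_Ico, nsmul_eq_mul]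
        rw [← Finset.mul_sum, Finset.sum_add_distrib, ← Finset.mul_sum, ← Finset.mul_sum]
        congr 2
        omega
    _ ≤ _ := by
        gcongr
end Blocks
end FiniteSupport

section Hilbert
variable {X : Type*} [MeasurableSpace X] {μ : Measure X}

lemma sq_integral_mul_le {F G : X → ℝ} (hF : Integrable (fun x => F x ^ 2) μ)
    (hG : Integrable (fun x => G x ^ 2) μ) (hFG : Integrable (fun x => F x * G x) μ) :
    (∫ x, F x * G x ∂μ) ^ 2 ≤ (∫ x, F x ^ 2 ∂μ) * ∫ x, G x ^ 2 ∂μ := by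
  have h := discrim_le_zero (a := ∫ x, G x ^ 2 ∂μ) (b := 2 * ∫ x, F x * G x ∂μ)
    (c := ∫ x, F x ^ 2 ∂μ) fun t => by
      have e : (∫ x, G x ^ 2 ∂μ) * (t * t) + 2 * (∫ x, F x * G x ∂μ) * t + ∫ x, F x ^ 2 ∂μ
          = ∫ x, (F x + t * G x) ^ 2 ∂μ := by
        have : ∀ x, (F x + t * G x) ^ 2 = G x ^ 2 * (t * t) + F x * G x * (2 * t) + F x ^ 2 :=
          fun x => by ring
        simp_rw [this]
        have hi := (hG.mul_const (t * t)).add (hFG.mul_const (2 * t))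
        rw [integral_add (f := fun x => G x ^ 2 * (t * t) + F x * G x * (2 * t)) hi hF,
          integral_add (hG.mul_const _) (hFG.mul_const _), integral_mul_const, integral_mul_const]
        ring
      rw [e]
      exact integral_nonneg fun x => sq_nonneg _
  rw [discrim] at h
  nlinarith

lemma abs_integral_mul_le {F G : X → ℝ} (hF : Integrable (fun x => F x ^ 2) μ)
    (hG : Integrable (fun x => G x ^ 2) μ) (hFG : Integrable (fun x => F x * G x) μ) :
    |∫ x, F x * G x ∂μ| ≤ Real.sqrt (∫ x, F x ^ 2 ∂μ) * Real.sqrt (∫ x, G x ^ 2 ∂μ) := by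
  rw [← Real.sqrt_mul (integral_nonneg fun x => sq_nonneg _)]
  exact Real.abs_le_sqrt (sq_integral_mul_le hF hG hFG)

variable [IsProbabilityMeasure μ]

lemma integral_abs_le_sqrt {F : X → ℝ} (hF : Measurable F) {C : ℝ} (hC : ∀ x, |F x| ≤ C) :
    ∫ x, |F x| ∂μ ≤ Real.sqrt (∫ x, F x ^ 2 ∂μ) := by
  have h1 : Integrable F μ := integrable_of_abs_le hF hC
  have h2 : Integrable (fun x => |F x| ^ 2) μ :=
    integrable_of_abs_le (hF.abs.pow_const 2) (C := C ^ 2) fun x => by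
      rw [abs_pow, abs_abs]
      exact pow_le_pow_left₀ (abs_nonneg _) (hC x) 2
  have := abs_integral_mul_le h2 (G := fun _ => 1) (by simp) (by simpa using h1.abs)
  simp only [mul_one, sq_abs, one_pow, integral_const, probReal_univ, smul_eq_mul,
    Real.sqrt_one] at this
  exact (le_abs_self _).trans this

lemma norm_integral_exp_sub_le {F G : X → ℝ} (hF : Measurable F) (hG : Measurable G) {C D : ℝ}
    (hC : ∀ x, |F x| ≤ C) (hD : ∀ x, |G x| ≤ D) :
    ‖∫ x, Complex.exp (Complex.I * (F x : ℝ)) ∂μ - ∫ x, Complex.exp (Complex.I * (G x : ℝ)) ∂μ‖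
      ≤ Real.sqrt (∫ x, (F x - G x) ^ 2 ∂μ) := by
  have hi : ∀ {H : X → ℝ}, Measurable H →
      Integrable (fun x => Complex.exp (Complex.I * (H x : ℝ))) μ := fun {H} hH =>
    Integrable.of_bound (Complex.measurable_exp.comp (measurable_const.mul
      (Complex.measurable_ofReal.comp hH))).aestronglyMeasurable 1 (ae_of_all _ fun x => by
        rw [mul_comm]; exact (Complex.norm_exp_ofReal_mul_I _).le)
  have hb : ∀ x, |F x - G x| ≤ C + D := fun x =>
    (abs_sub _ _).trans (add_le_add (hC x) (hD x))
  rw [← integral_sub (hi hF) (hi hG)]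
  refine (norm_integral_le_of_norm_le (g := fun x => |F x - G x|)
    (integrable_of_abs_le (hF.sub hG) hb).abs (ae_of_all _ fun x => ?_)).trans
    (integral_abs_le_sqrt (hF.sub hG) hb)
  have e : Complex.exp (Complex.I * (F x : ℝ)) - Complex.exp (Complex.I * (G x : ℝ))
      = Complex.exp (Complex.I * (G x : ℝ)) *
        (Complex.exp (Complex.I * ((F x - G x : ℝ) : ℂ)) - 1) := by
    rw [mul_sub, ← Complex.exp_add, mul_one]
    push_cast
    ring_nf
  rw [e, norm_mul, mul_comm Complex.I, Complex.norm_exp_ofReal_mul_I, one_mul]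
  exact Real.norm_exp_I_mul_ofReal_sub_one_le

end Hilbert

section Quadratic
variable {X : Type*} [MeasurableSpace X] {μ : Measure X} [IsProbabilityMeasure μ]
  {ξ : ℤ → X → ℝ} {B : ℝ} {r : ℤ → ℝ}

lemma integral_sum_mul_sum (hm : ∀ l, Measurable (ξ l)) (hB : ∀ l x, |ξ l x| ≤ B)
    (hr : ∀ l l', ∫ x, ξ l x * ξ l' x ∂μ = r (l' - l)) {ι κ : Type*} (s : Finset ι) (s' : Finset κ)
    (u : ι → ℝ) (v : κ → ℝ) (l : ι → ℤ) (l' : κ → ℤ) :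
    ∫ x, (∑ i ∈ s, u i * ξ (l i) x) * (∑ k ∈ s', v k * ξ (l' k) x) ∂μ
      = ∑ i ∈ s, ∑ k ∈ s', u i * v k * r (l' k - l i) := by
  have hInt : ∀ i k, Integrable (fun x => ξ i x * ξ k x) μ := fun i k =>
    integrable_of_abs_le ((hm i).mul (hm k)) (C := B * B) fun x => by
      rw [abs_mul]
      exact mul_le_mul (hB i x) (hB k x) (abs_nonneg _) ((abs_nonneg _).trans (hB i x))
  have e : ∀ x, (∑ i ∈ s, u i * ξ (l i) x) * (∑ k ∈ s', v k * ξ (l' k) x)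
      = ∑ i ∈ s, ∑ k ∈ s', u i * v k * (ξ (l i) x * ξ (l' k) x) := by
    intro x
    rw [Finset.sum_mul_sum]
    exact Finset.sum_congr rfl fun i _ => Finset.sum_congr rfl fun k _ => by ring
  simp_rw [e]
  rw [integral_finsetSum _ fun i _ => integrable_finsetSum _ fun k _ => (hInt _ _).const_mul _]
  refine Finset.sum_congr rfl fun i _ => ?_
  rw [integral_finsetSum _ fun k _ => (hInt _ _).const_mul _]
  refine Finset.sum_congr rfl fun k _ => ?_
  rw [integral_const_mul, hr]

lemma integral_sq_sum_le (hm : ∀ l, Measurable (ξ l)) (hB : ∀ l x, |ξ l x| ≤ B)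
    (hr : ∀ l l', ∫ x, ξ l x * ξ l' x ∂μ = r (l' - l)) (hs : Summable fun m => |r m|)
    (s : Finset ℤ) (a : ℤ → ℝ) :
    ∫ x, (∑ l ∈ s, a l * ξ l x) ^ 2 ∂μ ≤ (∑' m, |r m|) * ∑ l ∈ s, a l ^ 2 := by
  simp_rw [pow_two (∑ l ∈ s, a l * ξ l _)]
  rw [integral_sum_mul_sum hm hB hr]
  have h1 : ∀ l, ∑ k ∈ s, |r (k - l)| ≤ ∑' m, |r m| := fun l => by
    rw [← (Equiv.subRight l).tsum_eq]
    exact ((Equiv.subRight l).summable_iff.2 hs).sum_le_tsum s fun _ _ => abs_nonneg _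
  have h2 : ∀ l, ∑ k ∈ s, |r (l - k)| ≤ ∑' m, |r m| := fun l => by
    rw [← (Equiv.subLeft l).tsum_eq]
    exact ((Equiv.subLeft l).summable_iff.2 hs).sum_le_tsum s fun _ _ => abs_nonneg _
  calc ∑ i ∈ s, ∑ k ∈ s, a i * a k * r (k - i)
      ≤ ∑ i ∈ s, ∑ k ∈ s, (a i ^ 2 / 2 * |r (k - i)| + a k ^ 2 / 2 * |r (k - i)|) := by
        refine Finset.sum_le_sum fun i _ => Finset.sum_le_sum fun k _ => ?_
        rw [← add_mul]
        refine (le_abs_self _).trans ?_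
        rw [abs_mul, abs_mul]
        refine mul_le_mul_of_nonneg_right ?_ (abs_nonneg _)
        nlinarith [sq_nonneg (|a i| - |a k|), sq_abs (a i), sq_abs (a k)]
    _ = ∑ i ∈ s, a i ^ 2 / 2 * ∑ k ∈ s, |r (k - i)| + ∑ k ∈ s, a k ^ 2 / 2 * ∑ i ∈ s, |r (k - i)| := by
        simp_rw [Finset.sum_add_distrib]
        congr 1
        · simp_rw [Finset.mul_sum]
        · rw [Finset.sum_comm]
          simp_rw [Finset.mul_sum]
    _ ≤ ∑ i ∈ s, a i ^ 2 / 2 * (∑' m, |r m|) + ∑ k ∈ s, a k ^ 2 / 2 * (∑' m, |r m|) := by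
        gcongr with i _ k _
        · exact h1 i
        · exact h2 k
    _ = _ := by
        rw [← Finset.sum_mul, ← Finset.sum_div]
        ring

lemma tsum_cov_nonneg (hm : ∀ l, Measurable (ξ l)) (hB : ∀ l x, |ξ l x| ≤ B)
    (hr : ∀ l l', ∫ x, ξ l x * ξ l' x ∂μ = r (l' - l)) {g : ℕ}
    (hg : ∀ m : ℤ, (g : ℤ) ≤ |m| → r m = 0) : 0 ≤ ∑' m, r m := by
  set C := (∑ m ∈ Finset.Ioo (-(g : ℤ)) g, |r m| * (m : ℝ) ^ 2) / 2
  by_contra! hneg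
  have key : ∀ n : ℕ, 0 ≤ (∑' m, r m) * n + C * 2 := by
    intro n
    let a : ℤ → ℝ := fun l => if l ∈ Finset.Ico (0 : ℤ) n then 1 else 0
    have ha : a.support.Finite := (Finset.Ico (0 : ℤ) n).finite_toSet.subset fun l hl => by
      simp only [Function.mem_support, a] at hl
      by_contra h
      exact hl (if_neg h)
    have h1 := abs_sum_sum_sub_le ha hg
    have h2 : ∑' l, a l ^ 2 = n := by
      rw [tsum_eq_sum (s := Finset.Ico (0 : ℤ) n) fun l hl => by simp only [a, if_neg hl]; simp]
      rw [Finset.sum_congr rfl (g := fun _ => (1 : ℝ)) fun l hl => by simp only [a, if_pos hl]; simp]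
      simp
    have h3 : ∑' l, (a (l + 1) - a l) ^ 2 ≤ 2 := by
      rw [tsum_eq_sum (s := {-1, (n : ℤ) - 1})]
      · have hle : ∀ l, (a (l + 1) - a l) ^ 2 ≤ 1 := fun l => by
          simp only [a]; split_ifs <;> norm_num
        refine (Finset.sum_le_card_nsmul _ _ 1 fun l _ => hle l).trans ?_
        simp only [nsmul_eq_mul, mul_one]
        exact_mod_cast Finset.card_le_two
      · intro l hl
        simp only [Finset.mem_insert, Finset.mem_singleton, not_or] at hl
        have : (l + 1 ∈ Finset.Ico (0 : ℤ) n) ↔ (l ∈ Finset.Ico (0 : ℤ) n) := by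
          simp only [Finset.mem_Ico]; omega
        simp only [a, this]
        simp
    have h4 : 0 ≤ ∑ l ∈ ha.toFinset, ∑ l' ∈ ha.toFinset, a l * a l' * r (l' - l) := by
      rw [← integral_sum_mul_sum hm hB hr]
      exact integral_nonneg fun x => mul_self_nonneg _
    have hC : 0 ≤ C := div_nonneg (Finset.sum_nonneg fun _ _ =>
      mul_nonneg (abs_nonneg _) (sq_nonneg _)) two_pos.le
    rw [h2] at h1
    have h5 : _ ≤ C * _ := (abs_le.1 h1).2
    have h6 := mul_le_mul_of_nonneg_left h3 hC
    linarith
  obtain ⟨n, hn⟩ := exists_nat_gt (C * 2 / (-(∑' m, r m)))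
  rw [div_lt_iff₀ (by linarith)] at hn
  have := key n
  linarith

end Quadratic

/-- A bounded weakly stationary process whose joint moments at `g`-separated times vanish, and
whose products of pairs decorrelate exactly at large distance. -/
structure IsGapProcess {X : Type*} [MeasurableSpace X] (μ : Measure X) (ξ : ℤ → X → ℝ) (B : ℝ)
    (r : ℤ → ℝ) (g : ℕ) : Prop where
  meas : ∀ l, Measurable (ξ l)
  nonneg : 0 ≤ B
  bdd : ∀ l x, |ξ l x| ≤ B
  cov : ∀ l l', ∫ x, ξ l x * ξ l' x ∂μ = r (l' - l)
  integral_prod : ∀ (I : Finset ℤ) (l : ℤ → ℤ), I.Nonempty →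
    (∀ i ∈ I, ∀ j ∈ I, i < j → l i + g ≤ l j) → ∫ x, ∏ j ∈ I, ξ (l j) x ∂μ = 0
  factor : ∀ L : ℕ, ∃ h : ℕ, ∀ l₁ l₂ l₃ l₄ : ℤ, |l₁ - l₂| < L → |l₃ - l₄| < L → h ≤ |l₁ - l₃| →
    ∫ x, (ξ l₁ x * ξ l₂ x) * (ξ l₃ x * ξ l₄ x) ∂μ
      = (∫ x, ξ l₁ x * ξ l₂ x ∂μ) * ∫ x, ξ l₃ x * ξ l₄ x ∂μ

section Variance
variable {X : Type*} [MeasurableSpace X] {μ : Measure X} [IsProbabilityMeasure μ]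

lemma integral_sq_sum_le_of_decorrelated (J : Finset ℤ) (Z : ℤ → X → ℝ) (C : ℤ → ℝ)
    (hZ : ∀ j, Measurable (Z j)) (hC : ∀ j x, |Z j x| ≤ C j) (h : ℕ)
    (h0 : ∀ i j, (h : ℤ) < |i - j| → ∫ x, Z i x * Z j x ∂μ = 0) :
    ∫ x, (∑ j ∈ J, Z j x) ^ 2 ∂μ ≤ (2 * h + 1) * ∑ j ∈ J, C j ^ 2 := by
  obtain ⟨x₀⟩ : Nonempty X := μ.nonempty_of_neZero
  have hC0 : ∀ j, 0 ≤ C j := fun j => (abs_nonneg _).trans (hC j x₀)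
  have hb : ∀ i j x, |Z i x * Z j x| ≤ C i * C j := fun i j x => by
    rw [abs_mul]; exact mul_le_mul (hC i x) (hC j x) (abs_nonneg _) (hC0 i)
  have hi : ∀ i j, Integrable (fun x => Z i x * Z j x) μ := fun i j =>
    integrable_of_abs_le ((hZ i).mul (hZ j)) (hb i j)
  have hcount : ∀ i : ℤ, (((J.filter fun j => |i - j| ≤ h).card : ℕ) : ℝ) ≤ 2 * h + 1 := by
    intro i
    have : J.filter (fun j => |i - j| ≤ h) ⊆ Finset.Icc (i - h) (i + h) := fun j hj => by
      have := (Finset.mem_filter.1 hj).2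
      rw [abs_le] at this
      exact Finset.mem_Icc.2 (by omega)
    have := Finset.card_le_card this
    rw [Int.card_Icc] at this
    have h2 : (J.filter fun j => |i - j| ≤ h).card ≤ 2 * h + 1 := by omega
    exact_mod_cast h2
  have hbound : ∀ i j, ∫ x, Z i x * Z j x ∂μ
      ≤ if |i - j| ≤ h then C i ^ 2 / 2 + C j ^ 2 / 2 else 0 := by
    intro i j
    split_ifs with hij
    · have := norm_integral_le_of_norm_le_const (μ := μ) (f := fun x => Z i x * Z j x)
        (ae_of_all _ (hb i j))
      simp only [probReal_univ, mul_one, Real.norm_eq_abs] at this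
      nlinarith [le_abs_self (∫ x, Z i x * Z j x ∂μ), sq_nonneg (C i - C j)]
    · exact (h0 i j (not_le.1 hij)).le
  have e : ∀ x, (∑ j ∈ J, Z j x) ^ 2 = ∑ i ∈ J, ∑ j ∈ J, Z i x * Z j x := fun x => by
    rw [pow_two, Finset.sum_mul_sum]
  simp_rw [e]
  rw [integral_finsetSum _ fun i _ => integrable_finsetSum _ fun j _ => hi i j]
  simp_rw [integral_finsetSum J fun j _ => hi _ j]
  calc ∑ i ∈ J, ∑ j ∈ J, ∫ x, Z i x * Z j x ∂μ
      ≤ ∑ i ∈ J, ∑ j ∈ J, ((if |i - j| ≤ h then C i ^ 2 / 2 else 0)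
          + if |i - j| ≤ h then C j ^ 2 / 2 else 0) := by
        refine Finset.sum_le_sum fun i _ => Finset.sum_le_sum fun j _ => (hbound i j).trans ?_
        split_ifs <;> simp
    _ = ∑ i ∈ J, ∑ j ∈ J, (if |i - j| ≤ h then C i ^ 2 / 2 else 0)
          + ∑ i ∈ J, ∑ j ∈ J, (if |i - j| ≤ h then C i ^ 2 / 2 else 0) := by
        simp_rw [Finset.sum_add_distrib]
        congr 1
        rw [Finset.sum_comm]
        simp_rw [abs_sub_comm]
    _ = ∑ i ∈ J, ((J.filter fun j => |i - j| ≤ h).card : ℝ) * C i ^ 2 := by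
        rw [← Finset.sum_add_distrib]
        refine Finset.sum_congr rfl fun i _ => ?_
        rw [← Finset.sum_filter, Finset.sum_const, nsmul_eq_mul]
        ring
    _ ≤ ∑ i ∈ J, (2 * h + 1) * C i ^ 2 :=
        Finset.sum_le_sum fun i _ => mul_le_mul_of_nonneg_right (hcount i) (sq_nonneg _)
    _ = _ := by rw [Finset.mul_sum]

end Variance

namespace IsGapProcess
variable {X : Type*} [MeasurableSpace X] {μ : Measure X} {ξ : ℤ → X → ℝ}
  {B : ℝ} {r : ℤ → ℝ} {g : ℕ}

lemma cov_eq_zero (H : IsGapProcess μ ξ B r g) (m : ℤ) (hm : (g : ℤ) ≤ |m|) : r m = 0 := by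
  have h1 := H.integral_prod {0, 1} (fun j => if j = 0 then min 0 m else max 0 m) (by simp) (by
    intro i hi j hj hij
    simp only [Finset.mem_insert, Finset.mem_singleton] at hi hj
    obtain rfl : i = 0 := by omega
    obtain rfl : j = 1 := by omega
    simp only [if_true, one_ne_zero, if_false]
    rcases abs_cases m with h | h <;> omega)
  simp only [Finset.mem_singleton, zero_ne_one, not_false_eq_true, Finset.prod_insert,
    Finset.prod_singleton, if_true, one_ne_zero, if_false] at h1
  rw [← sub_zero m, ← H.cov]
  rcases le_total 0 m with h | h
  · rwa [min_eq_left h, max_eq_right h] at h1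
  · rw [min_eq_right h, max_eq_left h] at h1
    simpa only [mul_comm] using h1

lemma summable_cov (H : IsGapProcess μ ξ B r g) : Summable fun m => |r m| :=
  summable_of_hasFiniteSupport ((Finset.Ioo (-(g : ℤ)) g).finite_toSet.subset fun m hm => by
    rw [Finset.coe_Ioo, Set.mem_Ioo, ← abs_lt]
    by_contra h
    exact hm (by simp [H.cov_eq_zero m (not_lt.1 h)]))

lemma measurable_block (H : IsGapProcess μ ξ B r g) {ι : Type*} (t : Finset ι) (u : ι → ℝ)
    (l : ι → ℤ) : Measurable fun x => ∑ i ∈ t, u i * ξ (l i) x :=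
  Finset.measurable_sum t fun _ _ => (H.meas _).const_mul _

lemma abs_block_le (H : IsGapProcess μ ξ B r g) {ι : Type*} (t : Finset ι) (u : ι → ℝ)
    (l : ι → ℤ) (x : X) : |∑ i ∈ t, u i * ξ (l i) x| ≤ B * ∑ i ∈ t, |u i| := by
  refine (Finset.abs_sum_le_sum_abs _ _).trans ?_
  rw [Finset.mul_sum]
  refine Finset.sum_le_sum fun i _ => ?_
  rw [abs_mul, mul_comm]
  exact mul_le_mul_of_nonneg_right (H.bdd _ x) (abs_nonneg _)

variable [IsProbabilityMeasure μ] {L : ℕ}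

lemma integrable_prod (H : IsGapProcess μ ξ B r g) (I : Finset ℤ) (l : ℤ → ℤ) :
    Integrable (fun x => ∏ j ∈ I, ξ (l j) x) μ :=
  integrable_of_abs_le (Finset.measurable_prod I fun j _ => H.meas _) (C := ∏ _j ∈ I, B) fun x => by
    rw [Finset.abs_prod]
    exact Finset.prod_le_prod (fun _ _ => abs_nonneg _) fun j _ => H.bdd _ x

lemma integral_prod_block (H : IsGapProcess μ ξ B r g) (a : ℤ → ℝ) (I : Finset ℤ)
    (hI : I.Nonempty) :
    ∫ x, ∏ j ∈ I, ∑ i ∈ Finset.range L, a (((L + g : ℕ) : ℤ) * j + i)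
      * ξ (((L + g : ℕ) : ℤ) * j + i) x ∂μ = 0 := by
  classical
  set p : ℤ := ((L + g : ℕ) : ℤ) with hp
  let e : (∀ j ∈ I, ℕ) → ℤ → ℕ := fun φ j => if h : j ∈ I then φ j h else 0
  have hexp : ∀ x, ∏ j ∈ I, ∑ i ∈ Finset.range L, a (p * j + i) * ξ (p * j + i) x
      = ∑ φ ∈ I.pi fun _ => Finset.range L,
        (∏ j ∈ I, a (p * j + e φ j)) * ∏ j ∈ I, ξ (p * j + e φ j) x := by
    intro x
    rw [Finset.prod_sum]
    refine Finset.sum_congr rfl fun φ _ => ?_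
    rw [← Finset.prod_mul_distrib, ← Finset.prod_attach I]
    refine Finset.prod_congr rfl fun j _ => ?_
    simp only [e, dif_pos j.2]
  simp_rw [hexp]
  rw [integral_finsetSum _ fun φ _ => (H.integrable_prod I fun j => p * j + e φ j).const_mul _]
  refine Finset.sum_eq_zero fun φ hφ => ?_
  rw [integral_const_mul, H.integral_prod I (fun j => p * j + e φ j) hI, mul_zero]
  intro i hi j hj hij
  have h1 : e φ i < L := by
    simp only [e, dif_pos hi]
    exact Finset.mem_range.1 (Finset.mem_pi.1 hφ i hi)
  have h2 : p * (i + 1) ≤ p * j := mul_le_mul_of_nonneg_left hij (by positivity)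
  have h3 : p = L + g := by rw [hp]; push_cast; rfl
  have h4 : p * (i + 1) = p * i + (L + g) := by rw [mul_add, mul_one, ← h3]
  omega

lemma integral_sq_sum_block_le (H : IsGapProcess μ ξ B r g) (hp : 0 < L + g) (a : ℤ → ℝ)
    (J : Finset ℤ) (t : Finset ℕ) (ht : t ⊆ Finset.range (L + g)) :
    ∫ x, (∑ j ∈ J, ∑ i ∈ t, a (((L + g : ℕ) : ℤ) * j + i) * ξ (((L + g : ℕ) : ℤ) * j + i) x) ^ 2 ∂μ
      ≤ (∑' m, |r m|) * ∑ j ∈ J, ∑ i ∈ t, a (((L + g : ℕ) : ℤ) * j + i) ^ 2 := by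
  have hsum : ∀ F : ℤ → ℝ, ∑ j ∈ J, ∑ i ∈ t, F (((L + g : ℕ) : ℤ) * j + i)
      = ∑ l ∈ (J ×ˢ t).image (fun z : ℤ × ℕ => ((L + g : ℕ) : ℤ) * z.1 + z.2), F l := by
    intro F
    rw [← Finset.sum_product' (f := fun j (i : ℕ) => F (((L + g : ℕ) : ℤ) * j + i)),
      Finset.sum_image ((block_injective hp J).mono
        (Finset.coe_subset.2 (Finset.product_subset_product_right ht)))]
  rw [hsum fun l => a l ^ 2,
    integral_congr_ae (ae_of_all μ fun x => congrArg (· ^ 2) (hsum fun l => a l * ξ l x))]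
  exact integral_sq_sum_le H.meas H.bdd H.cov H.summable_cov _ a

lemma integral_sq_block_mul_sq_block (H : IsGapProcess μ ξ B r g) {h : ℕ}
    (hh : ∀ l₁ l₂ l₃ l₄ : ℤ, |l₁ - l₂| < L → |l₃ - l₄| < L → h ≤ |l₁ - l₃| →
      ∫ x, (ξ l₁ x * ξ l₂ x) * (ξ l₃ x * ξ l₄ x) ∂μ
        = (∫ x, ξ l₁ x * ξ l₂ x ∂μ) * ∫ x, ξ l₃ x * ξ l₄ x ∂μ) (u v : ℕ → ℝ) (b c : ℤ)
    (hbc : h + L ≤ |b - c|) :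
    ∫ x, (∑ i ∈ Finset.range L, u i * ξ (b + i) x) ^ 2
        * (∑ i ∈ Finset.range L, v i * ξ (c + i) x) ^ 2 ∂μ
      = (∫ x, (∑ i ∈ Finset.range L, u i * ξ (b + i) x) ^ 2 ∂μ)
        * ∫ x, (∑ i ∈ Finset.range L, v i * ξ (c + i) x) ^ 2 ∂μ := by
  have hi2 : ∀ l l', Integrable (fun x => ξ l x * ξ l' x) μ := fun l l' =>
    integrable_of_abs_le ((H.meas l).mul (H.meas l')) (C := B * B) fun x => by
      rw [abs_mul]; exact mul_le_mul (H.bdd _ x) (H.bdd _ x) (abs_nonneg _) H.nonneg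
  have hi4 : ∀ k l k' l', Integrable (fun x => (ξ k x * ξ l x) * (ξ k' x * ξ l' x)) μ :=
    fun k l k' l' => (hi2 k' l').bdd_mul ((H.meas k).mul (H.meas l)).aestronglyMeasurable
      (c := B * B) (ae_of_all _ fun x => by
        rw [Real.norm_eq_abs, abs_mul]
        exact mul_le_mul (H.bdd _ x) (H.bdd _ x) (abs_nonneg _) H.nonneg)
  have e : ∀ (w : ℕ → ℝ) (b : ℤ) x, (∑ i ∈ Finset.range L, w i * ξ (b + i) x) ^ 2
      = ∑ z ∈ Finset.range L ×ˢ Finset.range L,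
        w z.1 * w z.2 * (ξ (b + z.1) x * ξ (b + z.2) x) := by
    intro w b x
    rw [pow_two, Finset.sum_mul_sum, ← Finset.sum_product']
    exact Finset.sum_congr rfl fun z _ => by ring
  simp_rw [e]
  rw [integral_finsetSum _ fun z _ => (hi2 _ _).const_mul _,
    integral_finsetSum _ fun z _ => (hi2 _ _).const_mul _]
  have e2 : ∀ (u u' v v' : ℝ), u * u' * (v * v') = u * v * (u' * v') := fun _ _ _ _ => by ring
  simp_rw [Finset.sum_mul_sum]
  rw [integral_congr_ae (ae_of_all μ fun x => Finset.sum_congr rfl fun z _ =>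
    Finset.sum_congr rfl fun z' _ => e2 _ _ _ _),
    integral_finsetSum _ fun z _ => integrable_finsetSum _ fun z' _ => (hi4 _ _ _ _).const_mul _]
  refine Finset.sum_congr rfl fun z hz => ?_
  rw [integral_finsetSum _ fun z' _ => (hi4 _ _ _ _).const_mul _]
  refine Finset.sum_congr rfl fun z' hz' => ?_
  simp only [Finset.mem_product, Finset.mem_range] at hz hz'
  rw [integral_const_mul, integral_const_mul, integral_const_mul, hh]
  · ring
  · rw [abs_lt]; omega
  · rw [abs_lt]; omega
  · have : |b - c| ≤ |b + z.1 - (c + z'.1)| + |(z'.1 : ℤ) - z.1| := by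
      refine le_trans (le_of_eq ?_) (abs_add_le _ _)
      congr 1
      ring
    have h2 : |(z'.1 : ℤ) - z.1| ≤ L := by rw [abs_le]; omega
    omega

end IsGapProcess

namespace IsGapProcess
variable {X : Type*} [MeasurableSpace X] {μ : Measure X} {ξ : ℤ → X → ℝ}
  {B : ℝ} {r : ℤ → ℝ} {g : ℕ} [IsProbabilityMeasure μ]

/-- Upper bound for the mass of the squared coefficients in the gaps between blocks. -/
def gapMass (g : ℕ) (K : ℝ) (L : ℕ) (δ : ℝ) : ℝ := g * (2 / L * K + 2 * (L + g : ℕ) * δ)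

/-- Error term of the blocking argument with block length `L` and decorrelation distance `h`. -/
def blockError (B R C K : ℝ) (g h L : ℕ) (δ : ℝ) : ℝ :=
  2 * (B * (L * δ) * (B ^ 2 * L * K))
    + Real.exp (B ^ 2 * L * K / 2)
      * Real.sqrt ((2 * (h + L : ℕ) + 1) * ((B * (L * δ)) ^ 2 * (B ^ 2 * L * K)))
    + Real.sqrt (R * gapMass g K L δ)
    + (C * δ + 2 * (Real.sqrt (R * K) * Real.sqrt (R * gapMass g K L δ))
      + R * gapMass g K L δ) / 2

lemma norm_charfun_sub_gaussian_le (H : IsGapProcess μ ξ B r g) {L : ℕ} (hL : 1 ≤ L) {h : ℕ}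
    (hh : ∀ l₁ l₂ l₃ l₄ : ℤ, |l₁ - l₂| < L → |l₃ - l₄| < L → h ≤ |l₁ - l₃| →
      ∫ x, (ξ l₁ x * ξ l₂ x) * (ξ l₃ x * ξ l₄ x) ∂μ
        = (∫ x, ξ l₁ x * ξ l₂ x ∂μ) * ∫ x, ξ l₃ x * ξ l₄ x ∂μ)
    {a : ℤ → ℝ} (ha : a.support.Finite) {K δ : ℝ} (hK : ∑' l, a l ^ 2 ≤ K)
    (hδ : ∑' l, (a (l + 1) - a l) ^ 2 ≤ δ) (hmax : ∀ l, |a l| ≤ δ) :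
    ‖∫ x, Complex.exp (Complex.I * (∑ l ∈ ha.toFinset, a l * ξ l x : ℝ)) ∂μ
        - (Real.exp (-((∑' m, r m) * (∑' l, a l ^ 2) / 2)) : ℝ)‖
      ≤ blockError B (∑' m, |r m|)
        ((∑ m ∈ Finset.Ioo (-(g : ℤ)) g, |r m| * (m : ℝ) ^ 2) / 2) K g h L δ := by
  have hp : 0 < L + g := by omega
  have hB := H.nonneg
  have hLr : (0 : ℝ) < L := by exact_mod_cast hL
  have hδ0 : 0 ≤ δ := (abs_nonneg _).trans (hmax 0)
  have hK0 : 0 ≤ K := (tsum_nonneg fun l => sq_nonneg (a l)).trans hK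
  set R := ∑' m, |r m| with hR
  have hR0 : 0 ≤ R := tsum_nonneg fun _ => abs_nonneg _
  set C := (∑ m ∈ Finset.Ioo (-(g : ℤ)) g, |r m| * (m : ℝ) ^ 2) / 2 with hCdef
  have hC0 : 0 ≤ C := div_nonneg (Finset.sum_nonneg fun _ _ =>
      mul_nonneg (abs_nonneg _) (sq_nonneg _)) two_pos.le
  set σ := ∑' m, r m
  have hσ : 0 ≤ σ := tsum_cov_nonneg H.meas H.bdd H.cov H.cov_eq_zero
  set Γ := gapMass g K L δ with hΓ
  set p : ℤ := ((L + g : ℕ) : ℤ) with hpz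
  set J := ha.toFinset.image (· / p) with hJ
  set Y : ℤ → X → ℝ := fun j x => ∑ i ∈ Finset.range L, a (p * j + i) * ξ (p * j + i) x with hY
  set Z : X → ℝ := fun x => ∑ j ∈ J, ∑ i ∈ Finset.Ico L (L + g), a (p * j + i) * ξ (p * j + i) x
    with hZ
  set M : X → ℝ := fun x => ∑ j ∈ J, Y j x with hM
  set b : ℤ → ℝ := fun j => B * ∑ i ∈ Finset.range L, |a (p * j + i)| with hb
  have hYm : ∀ j, Measurable (Y j) := fun j => H.measurable_block _ _ _
  have hYb : ∀ j x, |Y j x| ≤ b j := fun j x => H.abs_block_le _ _ _ x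
  have hb0 : ∀ j, 0 ≤ b j := fun j =>
    mul_nonneg hB (Finset.sum_nonneg fun _ _ => abs_nonneg _)
  have hMm : Measurable M := Finset.measurable_sum J fun j _ => hYm j
  have hMb : ∀ x, |M x| ≤ ∑ j ∈ J, b j := fun x =>
    (Finset.abs_sum_le_sum_abs _ _).trans (Finset.sum_le_sum fun j _ => hYb j x)
  have hZm : Measurable Z := Finset.measurable_sum J fun j _ => H.measurable_block _ _ _
  obtain ⟨CZ, hZb⟩ : ∃ CZ, ∀ x, |Z x| ≤ CZ :=
    ⟨∑ j ∈ J, B * ∑ i ∈ Finset.Ico L (L + g), |a (p * j + i)|, fun x =>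
      (Finset.abs_sum_le_sum_abs _ _).trans
        (Finset.sum_le_sum fun j _ => H.abs_block_le _ _ _ x)⟩
  have hall : ∀ x, ∑ l ∈ ha.toFinset, a l * ξ l x = M x + Z x := by
    intro x
    rw [← sum_block_eq_sum hp ha.toFinset (F := fun l => a l * ξ l x) (fun l hl => by
      have : a l = 0 := by simpa using hl
      simp [this]), hM, hZ, ← Finset.sum_add_distrib]
    refine Finset.sum_congr rfl fun j _ => ?_
    simp only [hY, Finset.range_eq_Ico]
    rw [Finset.sum_Ico_consecutive _ (Nat.zero_le _) (Nat.le_add_right _ _)]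
  -- bounds on the block sizes
  have hbmax : ∀ j, b j ≤ B * (L * δ) := fun j => by
    refine mul_le_mul_of_nonneg_left ?_ hB
    refine (Finset.sum_le_card_nsmul _ _ δ fun i _ => hmax _).trans ?_
    simp
  have hsumL : ∑ j ∈ J, ∑ i ∈ Finset.range L, a (p * j + i) ^ 2 ≤ K := by
    refine le_trans ?_ ((sum_block_le_tsum hp J (summable_sq_of_finite_support ha)
      fun _ => sq_nonneg _).trans hK)
    exact Finset.sum_le_sum fun j _ => Finset.sum_le_sum_of_subset_of_nonneg
      (Finset.range_subset_range.2 (Nat.le_add_right _ _)) fun _ _ _ => sq_nonneg _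
  have hb2 : ∑ j ∈ J, b j ^ 2 ≤ B ^ 2 * L * K := by
    refine le_trans ?_ (mul_le_mul_of_nonneg_left hsumL (by positivity))
    rw [Finset.mul_sum]
    refine Finset.sum_le_sum fun j _ => ?_
    have := sq_sum_le_card_mul_sum_sq (s := Finset.range L) (f := fun i : ℕ => |a (p * j + i)|)
    simp only [sq_abs, Finset.card_range] at this
    rw [hb, mul_pow, mul_assoc]
    exact mul_le_mul_of_nonneg_left this (sq_nonneg B)
  have hb3 : ∑ j ∈ J, 2 * b j ^ 3 ≤ 2 * (B * (L * δ) * (B ^ 2 * L * K)) := by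
    rw [← Finset.mul_sum]
    refine mul_le_mul_of_nonneg_left ?_ two_pos.le
    refine le_trans ?_ (mul_le_mul_of_nonneg_left hb2 (by positivity))
    rw [Finset.mul_sum]
    refine Finset.sum_le_sum fun j _ => ?_
    rw [pow_succ' (b j) 2]
    exact mul_le_mul_of_nonneg_right (hbmax j) (sq_nonneg _)
  have hb4 : ∑ j ∈ J, (b j ^ 2) ^ 2 ≤ (B * (L * δ)) ^ 2 * (B ^ 2 * L * K) := by
    refine le_trans ?_ (mul_le_mul_of_nonneg_left hb2 (by positivity))
    rw [Finset.mul_sum]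
    refine Finset.sum_le_sum fun j _ => ?_
    rw [pow_two (b j ^ 2)]
    exact mul_le_mul_of_nonneg_right (pow_le_pow_left₀ (hb0 j) (hbmax j) 2) (sq_nonneg _)
  -- second moments
  have hYi : ∀ i j, Integrable (fun x => Y i x * Y j x) μ := fun i j =>
    integrable_of_abs_le ((hYm i).mul (hYm j)) (C := b i * b j) fun x => by
      rw [abs_mul]; exact mul_le_mul (hYb i x) (hYb j x) (abs_nonneg _) (hb0 i)
  have hYsq : ∀ j, Integrable (fun x => Y j x ^ 2) μ := fun j => by
    simpa only [pow_two] using hYi j j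
  set q := ∑ j ∈ J, ∫ x, Y j x ^ 2 ∂μ with hq
  have hq0 : 0 ≤ q := Finset.sum_nonneg fun j _ => integral_nonneg fun x => sq_nonneg _
  have hqM : ∫ x, M x ^ 2 ∂μ = q := by
    have e : ∀ x, M x ^ 2 = ∑ i ∈ J, ∑ j ∈ J, Y i x * Y j x := fun x => by
      rw [pow_two, hM, Finset.sum_mul_sum]
    simp_rw [e]
    rw [integral_finsetSum _ fun i _ => integrable_finsetSum _ fun j _ => hYi i j]
    refine Finset.sum_congr rfl fun i hi => ?_
    rw [integral_finsetSum _ fun j _ => hYi i j, Finset.sum_eq_single i]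
    · simp_rw [pow_two]
    · intro j _ hne
      have := H.integral_prod_block (L := L) a {i, j} (by simp)
      simpa only [Finset.prod_pair hne.symm] using this
    · exact fun h => absurd hi h
  have hM2 : ∫ x, M x ^ 2 ∂μ ≤ R * K :=
    (H.integral_sq_sum_block_le hp a J (Finset.range L)
      (Finset.range_subset_range.2 (Nat.le_add_right _ _))).trans
      (mul_le_mul_of_nonneg_left hsumL hR0)
  have hgap := sum_gap_sq_le (g := g) hL ha J
  have hΓle : ∑ j ∈ J, ∑ i ∈ Finset.Ico L (L + g), a (p * j + i) ^ 2 ≤ Γ := by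
    refine hgap.trans ?_
    rw [hΓ, gapMass]
    gcongr
  have hZ2 : ∫ x, Z x ^ 2 ∂μ ≤ R * Γ :=
    (H.integral_sq_sum_block_le hp a J (Finset.Ico L (L + g)) (fun i hi =>
      Finset.mem_range.2 (Finset.mem_Ico.1 hi).2)).trans (mul_le_mul_of_nonneg_left hΓle hR0)
  have sqint : ∀ {F : X → ℝ} {c : ℝ}, Measurable F → (∀ x, |F x| ≤ c) →
      Integrable (fun x => F x ^ 2) μ := fun {F c} hF hc =>
    integrable_of_abs_le (hF.pow_const 2) (C := c ^ 2) fun x => by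
      rw [abs_pow]; exact pow_le_pow_left₀ (abs_nonneg _) (hc x) 2
  have hMZi : Integrable (fun x => M x * Z x) μ :=
    integrable_of_abs_le (hMm.mul hZm) (C := (∑ j ∈ J, b j) * CZ) fun x => by
      rw [abs_mul]
      exact mul_le_mul (hMb x) (hZb x) (abs_nonneg _) (Finset.sum_nonneg fun j _ => hb0 j)
  have hallsq : ∫ x, (M x + Z x) ^ 2 ∂μ
      = q + 2 * ∫ x, M x * Z x ∂μ + ∫ x, Z x ^ 2 ∂μ := by
    have e : ∀ x, (M x + Z x) ^ 2 = (M x ^ 2 + 2 * (M x * Z x)) + Z x ^ 2 := fun x => by ring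
    simp_rw [e]
    have i1 := (sqint hMm hMb).add (hMZi.const_mul 2)
    rw [integral_add (f := fun x => M x ^ 2 + 2 * (M x * Z x)) i1 (sqint hZm hZb),
      integral_add (sqint hMm hMb) (hMZi.const_mul 2), integral_const_mul, hqM]
  have hcross : |∫ x, M x * Z x ∂μ| ≤ Real.sqrt (R * K) * Real.sqrt (R * Γ) :=
    (abs_integral_mul_le (sqint hMm hMb) (sqint hZm hZb) hMZi).trans
      (mul_le_mul (Real.sqrt_le_sqrt hM2) (Real.sqrt_le_sqrt hZ2) (Real.sqrt_nonneg _)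
        (Real.sqrt_nonneg _))
  have hvar : |∫ x, (M x + Z x) ^ 2 ∂μ - σ * ∑' l, a l ^ 2| ≤ C * δ := by
    have h1 := abs_sum_sum_sub_le ha H.cov_eq_zero
    rw [← integral_sum_mul_sum H.meas H.bdd H.cov] at h1
    refine le_trans (le_of_eq ?_) (h1.trans (mul_le_mul_of_nonneg_left hδ hC0))
    congr 2
    exact integral_congr_ae (ae_of_all _ fun x => by simp only [← hall, pow_two])
  have hqσ : |q - σ * ∑' l, a l ^ 2|
      ≤ C * δ + 2 * (Real.sqrt (R * K) * Real.sqrt (R * Γ)) + R * Γ := by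
    have hZ20 : 0 ≤ ∫ x, Z x ^ 2 ∂μ := integral_nonneg fun x => sq_nonneg _
    rw [hallsq] at hvar
    rw [abs_le] at hvar hcross ⊢
    constructor <;> linarith
  -- concentration of the sum of squares
  have hQ : ∫ x, |∑ j ∈ J, Y j x ^ 2 - q| ∂μ
      ≤ Real.sqrt ((2 * (h + L : ℕ) + 1) * ((B * (L * δ)) ^ 2 * (B ^ 2 * L * K))) := by
    have e : ∀ x, ∑ j ∈ J, Y j x ^ 2 - q = ∑ j ∈ J, (Y j x ^ 2 - ∫ y, Y j y ^ 2 ∂μ) := fun x => by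
      rw [Finset.sum_sub_distrib]
    have hYs : ∀ j x, Y j x ^ 2 ≤ b j ^ 2 := fun j x => by
      rw [← sq_abs]; exact pow_le_pow_left₀ (abs_nonneg _) (hYb j x) 2
    have hEY : ∀ j, ∫ y, Y j y ^ 2 ∂μ ≤ b j ^ 2 := fun j => by
      have := integral_mono (hYsq j) (integrable_const (b j ^ 2)) (hYs j)
      simpa using this
    have hEY0 : ∀ j, 0 ≤ ∫ y, Y j y ^ 2 ∂μ := fun j => integral_nonneg fun x => sq_nonneg _
    have hZZ : ∀ j x, |Y j x ^ 2 - ∫ y, Y j y ^ 2 ∂μ| ≤ b j ^ 2 := fun j x => by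
      rw [abs_le]
      constructor <;> linarith [hYs j x, hEY j, hEY0 j, sq_nonneg (Y j x)]
    have hZZm : ∀ j, Measurable fun x => Y j x ^ 2 - ∫ y, Y j y ^ 2 ∂μ := fun j =>
      ((hYm j).pow_const 2).sub_const _
    simp_rw [e]
    refine (integral_abs_le_sqrt (Finset.measurable_sum J fun j _ => hZZm j)
      (C := ∑ j ∈ J, b j ^ 2) fun x => (Finset.abs_sum_le_sum_abs _ _).trans
        (Finset.sum_le_sum fun j _ => hZZ j x)).trans (Real.sqrt_le_sqrt ?_)
    refine (integral_sq_sum_le_of_decorrelated J _ (fun j => b j ^ 2) hZZm hZZ (h + L) ?_).trans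
      (mul_le_mul_of_nonneg_left hb4 (by positivity))
    intro i j hij
    have hdist : (h : ℤ) + L ≤ |p * i - p * j| := by
      rw [← mul_sub, abs_mul]
      have : 1 ≤ |p| := by rw [hpz]; rw [abs_of_nonneg (by positivity)]; exact_mod_cast hp
      push_cast at hij
      nlinarith [abs_nonneg (i - j)]
    have h1 := H.integral_sq_block_mul_sq_block hh (fun k => a (p * i + k))
      (fun k => a (p * j + k)) (p * i) (p * j) hdist
    have hprod : Integrable (fun x => Y i x ^ 2 * Y j x ^ 2) μ :=
      integrable_of_abs_le (((hYm i).pow_const 2).mul ((hYm j).pow_const 2))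
        (C := b i ^ 2 * b j ^ 2) fun x => by
        rw [abs_of_nonneg (by positivity)]
        exact mul_le_mul (hYs i x) (hYs j x) (sq_nonneg _) (sq_nonneg _)
    set u := ∫ y, Y i y ^ 2 ∂μ
    set v := ∫ y, Y j y ^ 2 ∂μ
    have e2 : ∀ x, (Y i x ^ 2 - u) * (Y j x ^ 2 - v)
        = (Y i x ^ 2 * Y j x ^ 2 - u * Y j x ^ 2) - (v * Y i x ^ 2 - u * v) := fun x => by ring
    simp_rw [e2]
    rw [integral_sub (f := fun x => Y i x ^ 2 * Y j x ^ 2 - u * Y j x ^ 2)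
      (g := fun x => v * Y i x ^ 2 - u * v) (hprod.sub ((hYsq j).const_mul u))
      (((hYsq i).const_mul v).sub (integrable_const _)),
      integral_sub hprod ((hYsq j).const_mul u),
      integral_sub ((hYsq i).const_mul v) (integrable_const _), integral_const_mul,
      integral_const_mul]
    have h1' : ∫ x, Y i x ^ 2 * Y j x ^ 2 ∂μ = u * v := h1
    rw [h1']
    simp only [integral_const, probReal_univ, one_smul]
    ring
  -- assembly
  have s1 : ‖∫ x, Complex.exp (Complex.I * (∑ l ∈ ha.toFinset, a l * ξ l x : ℝ)) ∂μ
      - ∫ x, Complex.exp (Complex.I * (M x : ℝ)) ∂μ‖ ≤ Real.sqrt (R * Γ) := by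
    simp_rw [hall]
    refine (norm_integral_exp_sub_le (hMm.add hZm) hMm (C := ∑ j ∈ J, b j + CZ) (fun x =>
      (abs_add_le _ _).trans (add_le_add (hMb x) (hZb x))) hMb).trans (Real.sqrt_le_sqrt ?_)
    simpa only [Pi.add_apply, add_sub_cancel_left] using hZ2
  have s2 := norm_charfun_sub_le J Y b hYm hYb
    (fun I _ hI => H.integral_prod_block (L := L) a I hI) hq0
  have s2' : Real.exp ((∑ j ∈ J, b j ^ 2) / 2) * ∫ x, |∑ j ∈ J, Y j x ^ 2 - q| ∂μ
      ≤ Real.exp (B ^ 2 * L * K / 2)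
      * Real.sqrt ((2 * (h + L : ℕ) + 1) * ((B * (L * δ)) ^ 2 * (B ^ 2 * L * K))) :=
    mul_le_mul (Real.exp_le_exp.2 (by linarith)) hQ (integral_nonneg fun x => abs_nonneg _)
      (Real.exp_pos _).le
  have s3 : ‖((Real.exp (-(q / 2)) : ℝ) : ℂ) - (Real.exp (-(σ * (∑' l, a l ^ 2) / 2)) : ℝ)‖
      ≤ (C * δ + 2 * (Real.sqrt (R * K) * Real.sqrt (R * Γ)) + R * Γ) / 2 := by
    rw [← Complex.ofReal_sub, Complex.norm_real, Real.norm_eq_abs]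
    refine (abs_exp_neg_sub_exp_neg_le (by linarith) (div_nonneg (mul_nonneg hσ
      (tsum_nonneg fun _ => sq_nonneg _)) two_pos.le)).trans ?_
    rw [← sub_div, abs_div, abs_two]
    linarith
  set U := ∫ x, Complex.exp (Complex.I * (∑ l ∈ ha.toFinset, a l * ξ l x : ℝ)) ∂μ
  set V := ∫ x, Complex.exp (Complex.I * (M x : ℝ)) ∂μ
  have s2'' : ‖V - (Real.exp (-(q / 2)) : ℝ)‖ ≤ _ := s2
  have t1 := norm_sub_le_norm_sub_add_norm_sub U V ((Real.exp (-(σ * (∑' l, a l ^ 2) / 2)) : ℝ) : ℂ)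
  have t2 := norm_sub_le_norm_sub_add_norm_sub V ((Real.exp (-(q / 2)) : ℝ) : ℂ)
    ((Real.exp (-(σ * (∑' l, a l ^ 2) / 2)) : ℝ) : ℂ)
  rw [blockError]
  linarith

theorem charfun_approx (H : IsGapProcess μ ξ B r g) {K : ℝ} (hK : 0 ≤ K) {ε : ℝ} (hε : 0 < ε) :
    ∃ δ > 0, ∀ (a : ℤ → ℝ) (ha : a.support.Finite), ∑' l, a l ^ 2 ≤ K →
      ∑' l, (a (l + 1) - a l) ^ 2 ≤ δ →
      ‖∫ x, Complex.exp (Complex.I * (∑ l ∈ ha.toFinset, a l * ξ l x : ℝ)) ∂μ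
        - (Real.exp (-((∑' m, r m) * (∑' l, a l ^ 2) / 2)) : ℝ)‖ ≤ ε := by
  set R := ∑' m, |r m|
  set C := (∑ m ∈ Finset.Ioo (-(g : ℤ)) g, |r m| * (m : ℝ) ^ 2) / 2
  choose h hh using H.factor
  have hlim : Tendsto (fun L : ℕ => blockError B R C K g (h L) L 0) atTop (nhds 0) := by
    have h1 : Tendsto (fun L : ℕ => gapMass g K L 0) atTop (nhds 0) := by
      have := ((tendsto_const_div_atTop_nhds_zero_nat (2 : ℝ)).mul_const K).const_mul (g : ℝ)
      simpa [gapMass] using this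
    have h2 : Tendsto (fun L : ℕ => R * gapMass g K L 0) atTop (nhds 0) := by
      simpa using h1.const_mul R
    have h3 : Tendsto (fun L : ℕ => Real.sqrt (R * gapMass g K L 0)) atTop (nhds 0) := by
      simpa [Function.comp_def] using (Real.continuous_sqrt.tendsto 0).comp h2
    have h4 := h3.add ((((h3.const_mul (Real.sqrt (R * K))).const_mul 2).add h2).div_const 2)
    simpa [blockError] using h4
  obtain ⟨L, hL1, hLε⟩ := ((eventually_ge_atTop 1).and (hlim.eventually_lt_const hε)).exists
  have hcont : Continuous fun δ => blockError B R C K g (h L) L δ := by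
    unfold blockError gapMass
    fun_prop
  obtain ⟨δ, hδε, hδ⟩ := (((hcont.tendsto 0).eventually_lt_const hLε).filter_mono
    nhdsWithin_le_nhds |>.and self_mem_nhdsWithin : ∀ᶠ δ in nhdsWithin (0 : ℝ) (Set.Ioi 0),
      blockError B R C K g (h L) L δ < ε ∧ δ ∈ Set.Ioi 0).exists
  have hδ0 : 0 < δ := hδ
  obtain ⟨M, hM⟩ := exists_nat_gt (4 * K / δ ^ 2)
  have hM0 : (0 : ℝ) < M := lt_of_le_of_lt (by positivity) hM
  have hM1 : 1 ≤ M := by exact_mod_cast hM0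
  refine ⟨min δ (δ ^ 2 / (4 * M)), lt_min hδ0 (by positivity), fun a ha haK haδ => ?_⟩
  refine (H.norm_charfun_sub_gaussian_le hL1 (hh L) ha haK
    (haδ.trans (min_le_left _ _)) fun l => ?_).trans hδε.le
  refine abs_le_of_sq_le_sq ?_ hδ0.le
  have h1 := sq_le_of_tsum_le ha l hM1
  have h2 : 2 / (M : ℝ) * ∑' k, a k ^ 2 ≤ δ ^ 2 / 2 := by
    refine (mul_le_mul_of_nonneg_left haK (by positivity)).trans ?_
    rw [div_mul_eq_mul_div, div_le_iff₀ hM0]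
    rw [div_lt_iff₀ (by positivity)] at hM
    linarith
  have h3 : 2 * (M : ℝ) * ∑' k, (a (k + 1) - a k) ^ 2 ≤ δ ^ 2 / 2 := by
    refine (mul_le_mul_of_nonneg_left (haδ.trans (min_le_right _ _)) (by positivity)).trans ?_
    apply le_of_eq
    field_simp
    ring
  linarith

end IsGapProcess

lemma sum_sum_le_two_mul_of_symm (F : ℕ → ℕ → ℝ) (hsymm : ∀ j k, F j k = F k j)
    (hdiag : ∀ j, 0 ≤ F j j) (n : ℕ) :
    ∑ j ∈ Finset.Icc 1 n, ∑ k ∈ Finset.Icc 1 n, F j k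
      ≤ 2 * ∑ j ∈ Finset.Icc 1 n, ∑ k ∈ Finset.Ico j (n + 1), F j k := by
  have h1 : ∀ j ∈ Finset.Icc 1 n, ∑ k ∈ Finset.Ico j (n + 1), F j k
      = ∑ k ∈ Finset.Icc 1 n, if j ≤ k then F j k else 0 := by
    intro j hj
    rw [← Finset.sum_filter]
    refine Finset.sum_congr ?_ fun _ _ => rfl
    ext k
    simp only [Finset.mem_Ico, Finset.mem_filter, Finset.mem_Icc] at *
    omega
  rw [Finset.sum_congr rfl h1, two_mul]
  nth_rewrite 3 [Finset.sum_comm]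
  rw [← Finset.sum_add_distrib]
  refine Finset.sum_le_sum fun j _ => ?_
  rw [← Finset.sum_add_distrib]
  refine Finset.sum_le_sum fun k _ => ?_
  rcases lt_trichotomy j k with h | rfl | h
  · simp [h.le, h.not_ge]
  · simpa using hdiag j
  · simp [h.le, h.not_ge, hsymm j k]

section LocalTime
variable {Ω : Type*} (W : ℕ → Ω → ℤ) (n : ℕ) (ω : Ω)

lemma localTime_eq_sum (l : ℤ) :
    localTime W n l ω = ∑ j ∈ Finset.Icc 1 n, if l = W j ω then (1 : ℝ) else 0 := by
  rw [localTime, Finset.card_filter]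
  push_cast
  simp_rw [eq_comm (a := l)]

lemma finite_support_localTime : (fun l => localTime W n l ω).support.Finite := by
  refine ((Finset.Icc 1 n).image fun j => W j ω).finite_toSet.subset fun l hl => ?_
  rw [Function.mem_support, localTime_eq_sum] at hl
  obtain ⟨j, hj, h⟩ := Finset.exists_ne_zero_of_sum_ne_zero hl
  rw [Finset.mem_coe, Finset.mem_image]
  exact ⟨j, hj, (by simpa using h : l = W j ω).symm⟩

lemma tsum_localTime_mul (G : ℤ → ℝ) :
    ∑' l, localTime W n l ω * G l = ∑ j ∈ Finset.Icc 1 n, G (W j ω) := by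
  simp_rw [localTime_eq_sum, Finset.sum_mul, ite_mul, one_mul, zero_mul]
  rw [Summable.tsum_finsetSum fun j _ => summable_of_hasFiniteSupport
    ((Set.finite_singleton (W j ω)).subset fun l hl => by
      simp only [Function.mem_support, ne_eq, ite_eq_right_iff, not_forall] at hl
      exact hl.1)]
  exact Finset.sum_congr rfl fun j _ => tsum_ite_eq _ _

lemma tsum_localTime_mul_shift (m : ℤ) :
    ∑' l, localTime W n l ω * localTime W n (l + m) ω
      = ∑ j ∈ Finset.Icc 1 n, ∑ k ∈ Finset.Icc 1 n, if W k ω - W j ω = m then (1 : ℝ) else 0 := by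
  rw [tsum_localTime_mul W n ω fun l => localTime W n (l + m) ω]
  refine Finset.sum_congr rfl fun j _ => ?_
  rw [localTime_eq_sum]
  refine Finset.sum_congr rfl fun k _ => ?_
  congr 1
  rw [eq_iff_iff]
  omega

lemma tsum_localTime_sq :
    ∑' l, localTime W n l ω ^ 2
      = ∑ j ∈ Finset.Icc 1 n, ∑ k ∈ Finset.Icc 1 n, if W k ω - W j ω = 0 then (1 : ℝ) else 0 := by
  rw [← tsum_localTime_mul_shift]
  simp_rw [add_zero, pow_two]

lemma tsum_localTime_sub_sq :
    ∑' l, (localTime W n (l + 1) ω - localTime W n l ω) ^ 2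
      = ∑ j ∈ Finset.Icc 1 n, ∑ k ∈ Finset.Icc 1 n,
        (2 * (if W k ω - W j ω = 0 then (1 : ℝ) else 0) - (if W k ω - W j ω = 1 then (1 : ℝ) else 0)
          - if W k ω - W j ω = -1 then (1 : ℝ) else 0) := by
  have h := tsum_mul_shift (finite_support_localTime W n ω) 1
  have h1 := tsum_localTime_mul_shift W n ω 1
  have h2 : ∑ j ∈ Finset.Icc 1 n, ∑ k ∈ Finset.Icc 1 n, (if W k ω - W j ω = 1 then (1 : ℝ) else 0)
      = ∑ j ∈ Finset.Icc 1 n, ∑ k ∈ Finset.Icc 1 n,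
        if W k ω - W j ω = -1 then (1 : ℝ) else 0 := by
    rw [Finset.sum_comm]
    refine Finset.sum_congr rfl fun j _ => Finset.sum_congr rfl fun k _ => ?_
    congr 1
    rw [eq_iff_iff]
    omega
  simp_rw [Finset.sum_sub_distrib, ← Finset.mul_sum]
  rw [← tsum_localTime_sq, ← h2, ← h1]
  linarith

end LocalTime

namespace IsSSRW
variable {Ω : Type*} [MeasurableSpace Ω] {μ : Measure Ω} {W : ℕ → Ω → ℤ}

lemma indepFun_step (hW : IsSSRW μ W) {j k : ℕ} (hjk : j ≤ k) :
    IndepFun (fun ω => W k ω - W j ω) (fun ω => W (k + 1) ω - W k ω) μ := by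
  have h := hW.indep.indepFun_finsetSum_of_notMem
    (fun i => (hW.meas (i + 1)).sub (hW.meas i)) (s := Finset.Ico j k) (i := k) (by simp)
  convert h using 1
  ext ω
  rw [Finset.sum_apply, Finset.sum_Ico_sub (fun i => W i ω) hjk]

/-- Probability that the increment of the walk between times `j` and `k` equals `m`. -/
def incrProb (μ : Measure Ω) (W : ℕ → Ω → ℤ) (j k : ℕ) (m : ℤ) : ℝ :=
  ∫ ω, (if W k ω - W j ω = m then (1 : ℝ) else 0) ∂μ

lemma incrProb_nonneg (j k : ℕ) (m : ℤ) : 0 ≤ incrProb μ W j k m :=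
  integral_nonneg fun ω => by dsimp only; split_ifs <;> norm_num

lemma incrProb_swap (j k : ℕ) (m : ℤ) : incrProb μ W j k m = incrProb μ W k j (-m) := by
  refine integral_congr_ae (ae_of_all _ fun ω => ?_)
  simp only
  congr 1
  rw [eq_iff_iff]
  omega

variable [IsProbabilityMeasure μ]

lemma step_ae (hW : IsSSRW μ W) (k : ℕ) :
    ∀ᵐ ω ∂μ, W (k + 1) ω - W k ω = 1 ∨ W (k + 1) ω - W k ω = -1 := by
  have hm : Measurable fun ω => W (k + 1) ω - W k ω := (hW.meas _).sub (hW.meas _)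
  have h1 : MeasurableSet {ω | W (k + 1) ω - W k ω = 1} := hm (measurableSet_singleton 1)
  have h2 : MeasurableSet {ω | W (k + 1) ω - W k ω = -1} := hm (measurableSet_singleton (-1))
  have hd : Disjoint {ω | W (k + 1) ω - W k ω = 1} {ω | W (k + 1) ω - W k ω = -1} := by
    rw [Set.disjoint_left]
    intro ω hω hω'
    simp only [Set.mem_ofPred_eq] at hω hω'
    omega
  have hu : μ ({ω | W (k + 1) ω - W k ω = 1} ∪ {ω | W (k + 1) ω - W k ω = -1}) = 1 := by
    rw [measure_union hd h2, hW.step_one, hW.step_neg_one]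
    exact ENNReal.add_halves 1
  exact (mem_ae_iff_prob_eq_one (h1.union h2)).2 hu

lemma abs_sub_le_ae (hW : IsSSRW μ W) (j k : ℕ) :
    ∀ᵐ ω ∂μ, |W (j + k) ω - W j ω| ≤ k := by
  induction k with
  | zero => simp
  | succ k ih =>
    filter_upwards [ih, hW.step_ae (j + k)] with ω h1 h2
    rw [abs_le] at *
    rw [← add_assoc]
    push_cast
    omega

lemma integrable_comp (hW : IsSSRW μ W) {j k : ℕ} (hjk : j ≤ k) (φ : ℤ → ℝ) :
    Integrable (fun ω => φ (W k ω - W j ω)) μ := by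
  obtain ⟨m, rfl⟩ := Nat.exists_eq_add_of_le hjk
  have hm : Measurable fun ω => φ (W (j + m) ω - W j ω) :=
    (Measurable.of_discrete (f := φ)).comp ((hW.meas _).sub (hW.meas _))
  refine Integrable.of_bound hm.aestronglyMeasurable
    (∑ i ∈ Finset.Icc (-(m : ℤ)) m, |φ i|) ?_
  filter_upwards [hW.abs_sub_le_ae j m] with ω hω
  exact Finset.single_le_sum (f := fun i => |φ i|) (fun _ _ => abs_nonneg _)
    (Finset.mem_Icc.2 (abs_le.1 hω))

lemma integral_step (hW : IsSSRW μ W) {j k : ℕ} (hjk : j ≤ k) (φ : ℤ → ℝ) :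
    ∫ ω, φ (W (k + 1) ω - W j ω) ∂μ
      = ((∫ ω, φ (W k ω - W j ω + 1) ∂μ) + ∫ ω, φ (W k ω - W j ω - 1) ∂μ) / 2 := by
  have hstep : ∀ c : ℤ, (μ {ω | W (k + 1) ω - W k ω = c} = 1 / 2) →
      ∫ ω, (if W (k + 1) ω - W k ω = c then (1 : ℝ) else 0) ∂μ = 1 / 2 := by
    intro c hc
    have hms : MeasurableSet {ω | W (k + 1) ω - W k ω = c} :=
      ((hW.meas (k + 1)).sub (hW.meas k)) (measurableSet_singleton c)
    have := integral_indicator_one (μ := μ) hms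
    rw [measureReal_def, hc] at this
    rw [show (1 : ℝ) / 2 = (1 / 2 : ℝ≥0∞).toReal by simp, ← this]
    refine integral_congr_ae (ae_of_all _ fun ω => ?_)
    simp [Set.indicator_apply]
  have hprod : ∀ (c : ℤ) (ψ : ℤ → ℝ), (μ {ω | W (k + 1) ω - W k ω = c} = 1 / 2) →
      ∫ ω, ψ (W k ω - W j ω) * (if W (k + 1) ω - W k ω = c then (1 : ℝ) else 0) ∂μ
        = (∫ ω, ψ (W k ω - W j ω) ∂μ) / 2 := by
    intro c ψ hc
    have hi := (hW.indepFun_step hjk).comp (φ := ψ) (ψ := fun z => if z = c then (1 : ℝ) else 0)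
      Measurable.of_discrete Measurable.of_discrete
    have := hi.integral_fun_mul_eq_mul_integral
      ((Measurable.of_discrete (f := ψ)).comp
        ((hW.meas k).sub (hW.meas j))).aestronglyMeasurable
      ((Measurable.of_discrete (f := fun z : ℤ => if z = c then (1 : ℝ) else 0)).comp
        ((hW.meas (k + 1)).sub (hW.meas k))).aestronglyMeasurable
    simp only [Function.comp_apply] at this
    rw [this, hstep c hc]
    ring
  have hInt : ∀ (c : ℤ) (ψ : ℤ → ℝ), Integrable (fun ω =>
      ψ (W k ω - W j ω) * (if W (k + 1) ω - W k ω = c then (1 : ℝ) else 0)) μ := by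
    intro c ψ
    refine (hW.integrable_comp hjk ψ).mul_bdd (c := 1)
      ((Measurable.of_discrete (f := fun z : ℤ => if z = c then (1 : ℝ) else 0)).comp
        ((hW.meas (k + 1)).sub (hW.meas k))).aestronglyMeasurable (ae_of_all _ fun ω => ?_)
    split_ifs <;> simp
  rw [add_div, ← hprod 1 (fun z => φ (z + 1)) (hW.step_one k),
    ← hprod (-1) (fun z => φ (z - 1)) (hW.step_neg_one k),
    ← integral_add (hInt 1 fun z => φ (z + 1)) (hInt (-1) fun z => φ (z - 1))]
  refine integral_congr_ae ?_
  filter_upwards [hW.step_ae k] with ω hω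
  rcases hω with h | h
  · have : W (k + 1) ω - W j ω = W k ω - W j ω + 1 := by omega
    simp [h, this]
  · have : W (k + 1) ω - W j ω = W k ω - W j ω - 1 := by omega
    simp [h, this]

lemma incrProb_self (j : ℕ) : incrProb μ W j j 0 = 1 := by
  simp [incrProb]

lemma incrProb_le_one (hW : IsSSRW μ W) {j k : ℕ} (hjk : j ≤ k) (m : ℤ) :
    incrProb μ W j k m ≤ 1 := by
  have := integral_mono (hW.integrable_comp hjk fun z => if z = m then (1 : ℝ) else 0)
    (integrable_const (1 : ℝ)) fun ω => by dsimp only; split_ifs <;> norm_num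
  simpa [incrProb] using this

lemma integrable_incr (hW : IsSSRW μ W) (j k : ℕ) (m : ℤ) :
    Integrable (fun ω => if W k ω - W j ω = m then (1 : ℝ) else 0) μ := by
  rcases le_total j k with h | h
  · exact hW.integrable_comp h fun z => if z = m then (1 : ℝ) else 0
  · refine (hW.integrable_comp h fun z => if z = -m then (1 : ℝ) else 0).congr
      (ae_of_all _ fun ω => ?_)
    simp only
    congr 1
    rw [eq_iff_iff]
    omega

lemma integral_abs_step (hW : IsSSRW μ W) {j k : ℕ} (hjk : j ≤ k) :
    ∫ ω, |((W (k + 1) ω - W j ω : ℤ) : ℝ)| ∂μ - ∫ ω, |((W k ω - W j ω : ℤ) : ℝ)| ∂μ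
      = incrProb μ W j k 0 := by
  have h1 := hW.integrable_comp hjk fun z => |((z + 1 : ℤ) : ℝ)|
  have h2 := hW.integrable_comp hjk fun z => |((z - 1 : ℤ) : ℝ)|
  have h3 := hW.integrable_comp hjk fun z => |(z : ℝ)|
  rw [hW.integral_step hjk fun z => |(z : ℝ)|, incrProb, ← integral_add h1 h2,
    ← integral_div, ← integral_sub (f := fun ω => (|((W k ω - W j ω + 1 : ℤ) : ℝ)|
      + |((W k ω - W j ω - 1 : ℤ) : ℝ)|) / 2) ((h1.add h2).div_const 2) h3]
  refine integral_congr_ae (ae_of_all _ fun ω => ?_)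
  simp only
  generalize W k ω - W j ω = z
  rcases lt_trichotomy z 0 with h | rfl | h
  · have h' : (z : ℝ) ≤ -1 := by exact_mod_cast (by omega : z ≤ -1)
    rw [if_neg h.ne, abs_of_nonpos (a := (z : ℝ)) (by linarith)]
    push_cast
    rw [abs_of_nonpos (by linarith), abs_of_nonpos (by linarith)]
    ring
  · simp
  · have h' : (1 : ℝ) ≤ z := by exact_mod_cast (by omega : 1 ≤ z)
    rw [if_neg h.ne', abs_of_nonneg (a := (z : ℝ)) (by linarith)]
    push_cast
    rw [abs_of_nonneg (by linarith), abs_of_nonneg (by linarith)]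
    ring

lemma integral_sq_incr (hW : IsSSRW μ W) (j m : ℕ) :
    ∫ ω, ((W (j + m) ω - W j ω : ℤ) : ℝ) ^ 2 ∂μ = m := by
  induction m with
  | zero => simp
  | succ m ih =>
    have hjm := Nat.le_add_right j m
    have h1 := hW.integrable_comp hjm fun z => ((z + 1 : ℤ) : ℝ) ^ 2
    have h2 := hW.integrable_comp hjm fun z => ((z - 1 : ℤ) : ℝ) ^ 2
    have h3 := hW.integrable_comp hjm fun z => (z : ℝ) ^ 2
    rw [← add_assoc, hW.integral_step hjm fun z => (z : ℝ) ^ 2, ← integral_add h1 h2,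
      ← integral_div]
    have e : ∀ ω, (((W (j + m) ω - W j ω + 1 : ℤ) : ℝ) ^ 2
        + ((W (j + m) ω - W j ω - 1 : ℤ) : ℝ) ^ 2) / 2
        = ((W (j + m) ω - W j ω : ℤ) : ℝ) ^ 2 + 1 := fun ω => by push_cast; ring
    simp_rw [e]
    rw [integral_add h3 (integrable_const _), ih]
    simp

lemma sum_incrProb_le (hW : IsSSRW μ W) (j n : ℕ) (hjn : j ≤ n) :
    ∑ k ∈ Finset.Ico j (n + 1), incrProb μ W j k 0 ≤ Real.sqrt (n + 1) := by
  have h1 : ∑ k ∈ Finset.Ico j (n + 1), incrProb μ W j k 0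
      = ∫ ω, |((W (n + 1) ω - W j ω : ℤ) : ℝ)| ∂μ := by
    rw [Finset.sum_congr rfl fun k hk => (hW.integral_abs_step (Finset.mem_Ico.1 hk).1).symm,
      Finset.sum_Ico_sub (fun k => ∫ ω, |((W k ω - W j ω : ℤ) : ℝ)| ∂μ) (by omega)]
    simp
  rw [h1]
  have hj : j ≤ n + 1 := by omega
  obtain ⟨m, hm⟩ := Nat.exists_eq_add_of_le hj
  set c := Real.sqrt (n + 1)
  have hc : 0 < c := Real.sqrt_pos.2 (by positivity)
  have hcc : c ^ 2 = n + 1 := Real.sq_sqrt (by positivity)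
  have h2 := hW.integral_sq_incr j m
  rw [← hm] at h2
  have h3 := integral_mono (hW.integrable_comp hj fun z => |(z : ℝ)|)
    (((hW.integrable_comp hj fun z => (z : ℝ) ^ 2).div_const (2 * c)).add
      (integrable_const (c / 2))) fun ω => by
      simp only [Pi.add_apply]
      generalize W (n + 1) ω - W j ω = z
      have : |(z : ℝ)| * (2 * c) ≤ (z : ℝ) ^ 2 + c ^ 2 := by
        rw [← sq_abs (z : ℝ)]; nlinarith [sq_nonneg (|(z : ℝ)| - c)]
      have e : (z : ℝ) ^ 2 / (2 * c) + c / 2 = ((z : ℝ) ^ 2 + c ^ 2) / (2 * c) := by field_simp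
      rw [e, le_div_iff₀ (by positivity)]
      exact this
  simp only [Pi.add_apply] at h3
  rw [integral_add ((hW.integrable_comp hj fun z => (z : ℝ) ^ 2).div_const (2 * c))
      (integrable_const (c / 2)), integral_div, h2] at h3
  simp only [integral_const, probReal_univ, one_smul] at h3
  refine h3.trans ?_
  have hmn : (m : ℝ) ≤ n + 1 := by exact_mod_cast (by omega : m ≤ n + 1)
  have : (m : ℝ) / (2 * c) ≤ c / 2 := by
    rw [div_le_iff₀ (by positivity)]
    nlinarith
  linarith

lemma integrable_tsum_localTime_sq (hW : IsSSRW μ W) (n : ℕ) :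
    Integrable (fun ω => ∑' l, localTime W n l ω ^ 2) μ := by
  simp_rw [tsum_localTime_sq]
  exact integrable_finsetSum _ fun j _ => integrable_finsetSum _ fun k _ =>
    hW.integrable_incr j k 0

lemma integral_tsum_localTime_sq_le (hW : IsSSRW μ W) (n : ℕ) :
    ∫ ω, ∑' l, localTime W n l ω ^ 2 ∂μ ≤ 2 * (n * Real.sqrt (n + 1)) := by
  simp_rw [tsum_localTime_sq]
  rw [integral_finsetSum _ fun j _ => integrable_finsetSum _ fun k _ => hW.integrable_incr j k 0]
  simp_rw [integral_finsetSum (Finset.Icc 1 n) fun k _ => hW.integrable_incr _ k 0]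
  refine (sum_sum_le_two_mul_of_symm (fun j k => incrProb μ W j k 0) (fun j k => by
    simpa using incrProb_swap j k 0) (fun j => incrProb_nonneg j j 0) n).trans ?_
  refine mul_le_mul_of_nonneg_left ?_ two_pos.le
  refine (Finset.sum_le_card_nsmul _ _ (Real.sqrt (n + 1)) fun j hj =>
    hW.sum_incrProb_le j n (Finset.mem_Icc.1 hj).2).trans ?_
  simp

lemma integrable_incr_second_difference (hW : IsSSRW μ W) (j k : ℕ) :
    Integrable (fun ω => 2 * (if W k ω - W j ω = 0 then (1 : ℝ) else 0)
      - (if W k ω - W j ω = 1 then (1 : ℝ) else 0)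
      - if W k ω - W j ω = -1 then (1 : ℝ) else 0) μ :=
  (((hW.integrable_incr j k 0).const_mul 2).sub (hW.integrable_incr j k 1)).sub
    (hW.integrable_incr j k (-1))

lemma integrable_tsum_localTime_sub_sq (hW : IsSSRW μ W) (n : ℕ) :
    Integrable (fun ω => ∑' l, (localTime W n (l + 1) ω - localTime W n l ω) ^ 2) μ := by
  simp_rw [tsum_localTime_sub_sq]
  exact integrable_finsetSum _ fun j _ => integrable_finsetSum _ fun k _ =>
    hW.integrable_incr_second_difference j k

lemma incrProb_succ (hW : IsSSRW μ W) {j k : ℕ} (hjk : j ≤ k) :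
    incrProb μ W j (k + 1) 0 = (incrProb μ W j k 1 + incrProb μ W j k (-1)) / 2 := by
  rw [incrProb, hW.integral_step hjk fun z => if z = 0 then (1 : ℝ) else 0, add_comm]
  congr 2 <;> refine integral_congr_ae (ae_of_all _ fun ω => ?_) <;> simp only <;> congr 1 <;>
    rw [eq_iff_iff] <;> omega

lemma integral_tsum_localTime_sub_sq_le (hW : IsSSRW μ W) (n : ℕ) :
    ∫ ω, ∑' l, (localTime W n (l + 1) ω - localTime W n l ω) ^ 2 ∂μ ≤ 4 * n := by
  simp_rw [tsum_localTime_sub_sq]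
  rw [integral_finsetSum _ fun j _ => integrable_finsetSum _ fun k _ =>
    hW.integrable_incr_second_difference j k]
  simp_rw [integral_finsetSum (Finset.Icc 1 n) fun k _ =>
    hW.integrable_incr_second_difference _ k]
  have e : ∀ j k, ∫ ω, (2 * (if W k ω - W j ω = 0 then (1 : ℝ) else 0)
      - (if W k ω - W j ω = 1 then (1 : ℝ) else 0)
      - if W k ω - W j ω = -1 then (1 : ℝ) else 0) ∂μ
      = 2 * incrProb μ W j k 0 - incrProb μ W j k 1 - incrProb μ W j k (-1) := by
    intro j k
    rw [integral_sub (f := fun ω => 2 * (if W k ω - W j ω = 0 then (1 : ℝ) else 0)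
      - (if W k ω - W j ω = 1 then (1 : ℝ) else 0)) (((hW.integrable_incr j k 0).const_mul 2).sub (hW.integrable_incr j k 1))
      (hW.integrable_incr j k (-1)), integral_sub ((hW.integrable_incr j k 0).const_mul 2)
      (hW.integrable_incr j k 1), integral_const_mul]
    rfl
  simp_rw [e]
  have hstep : ∀ {j k : ℕ}, j ≤ k →
      2 * incrProb μ W j k 0 - incrProb μ W j k 1 - incrProb μ W j k (-1)
        = 2 * (incrProb μ W j k 0 - incrProb μ W j (k + 1) 0) := fun {j k} hjk => by
    rw [hW.incrProb_succ hjk]; ring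
  refine (sum_sum_le_two_mul_of_symm (fun j k =>
    2 * incrProb μ W j k 0 - incrProb μ W j k 1 - incrProb μ W j k (-1)) (fun j k => by
      rw [incrProb_swap j k 0, incrProb_swap j k 1, incrProb_swap j k (-1)]
      simp only [neg_zero, neg_neg]
      ring) (fun j => by
      rw [hstep le_rfl, incrProb_self]
      linarith [hW.incrProb_le_one (Nat.le_succ j) 0]) n).trans ?_
  have hrow : ∀ j ∈ Finset.Icc 1 n, ∑ k ∈ Finset.Ico j (n + 1),
      (2 * incrProb μ W j k 0 - incrProb μ W j k 1 - incrProb μ W j k (-1)) ≤ 2 := by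
    intro j hj
    have hjn := (Finset.mem_Icc.1 hj).2
    rw [Finset.sum_congr rfl fun k hk => hstep (Finset.mem_Ico.1 hk).1, ← Finset.mul_sum]
    have := Finset.sum_Ico_sub (fun k => incrProb μ W j k 0) (m := j) (n := n + 1) (by omega)
    have h2 : ∑ k ∈ Finset.Ico j (n + 1), (incrProb μ W j k 0 - incrProb μ W j (k + 1) 0)
        = incrProb μ W j j 0 - incrProb μ W j (n + 1) 0 := by
      rw [← neg_sub (incrProb μ W j (n + 1) 0), ← this, ← Finset.sum_neg_distrib]
      exact Finset.sum_congr rfl fun k _ => by ring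
    rw [h2, incrProb_self]
    linarith [incrProb_nonneg (μ := μ) (W := W) j (n + 1) 0]
  have := Finset.sum_le_card_nsmul _ _ (2 : ℝ) hrow
  simp only [Nat.card_Icc, add_tsub_cancel_right, nsmul_eq_mul] at this
  linarith

end IsSSRW

lemma torusAut_mul {d : ℕ} (M N : Matrix (Fin d) (Fin d) ℤ) (x : Torus d) :
    torusAut (M * N) x = torusAut M (torusAut N x) := by
  ext i
  simp only [torusAut, Matrix.mul_apply, Finset.sum_smul, Finset.smul_sum, smul_smul]
  exact Finset.sum_comm

lemma torusAut_one {d : ℕ} (x : Torus d) : torusAut 1 x = x := by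
  ext i
  simp [torusAut, Matrix.one_apply, ite_smul]

lemma torusAut_iterate {d : ℕ} (M : Matrix (Fin d) (Fin d) ℤ) (n : ℕ) :
    (torusAut M)^[n] = torusAut (M ^ n) := by
  induction n with
  | zero => ext1 x; simp [torusAut_one]
  | succ n ih => ext1 x; rw [Function.iterate_succ_apply', ih, pow_succ', torusAut_mul]

lemma Titer_torusAut {d : ℕ} (S : Matrix (Fin d) (Fin d) ℤ) (k : ℤ) :
    Titer (torusAut S) (torusAut S⁻¹) k = torusAut (S ^ k) := by
  cases k with
  | ofNat n => simp [Titer, torusAut_iterate]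
  | negSucc n => rw [Titer, torusAut_iterate, zpow_negSucc, Matrix.inv_pow']

lemma continuous_torusAut {d : ℕ} (M : Matrix (Fin d) (Fin d) ℤ) : Continuous (torusAut M) := by
  unfold torusAut
  fun_prop

/-- `torusAut` as an additive homomorphism. -/
def torusAutHom {d : ℕ} (M : Matrix (Fin d) (Fin d) ℤ) : Torus d →+ Torus d where
  toFun := torusAut M
  map_zero' := by ext i; simp [torusAut]
  map_add' x y := by ext i; simp [torusAut, Finset.sum_add_distrib]

lemma volume_torus_eq (d : ℕ) :
    (volume : Measure (Torus d)) = Measure.pi fun _ => AddCircle.haarAddCircle := by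
  rw [volume_pi]
  congr 1
  ext1 i
  rw [AddCircle.volume_eq_smul_haarAddCircle]
  simp

instance isProbabilityMeasure_volume_torus (d : ℕ) :
    IsProbabilityMeasure (volume : Measure (Torus d)) := by
  rw [volume_torus_eq]; infer_instance

lemma measurePreserving_torusAut {d : ℕ} {M : Matrix (Fin d) (Fin d) ℤ} (hM : M.det = 1) :
    MeasurePreserving (torusAut M) (volume : Measure (Torus d)) volume := by
  have hu : IsUnit M.det := by rw [hM]; exact isUnit_one
  refine AddMonoidHom.measurePreserving (f := torusAutHom M) (continuous_torusAut M)
    (fun y => ⟨torusAut M⁻¹ y, ?_⟩) rfl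
  change torusAut M (torusAut M⁻¹ y) = y
  rw [← torusAut_mul, Matrix.mul_nonsing_inv _ hu, torusAut_one]

lemma det_zpow_eq_one {d : ℕ} {S : Matrix (Fin d) (Fin d) ℤ} (hS : S.det = 1) (k : ℤ) :
    (S ^ k).det = 1 := by
  have h : ∀ n : ℕ, (S ^ n).det = 1 := fun n => by rw [Matrix.det_pow, hS, one_pow]
  cases k with
  | ofNat n => simpa using h n
  | negSucc n =>
    rw [zpow_negSucc, Matrix.det_nonsing_inv, h]
    simp

lemma mFourier_eq_toCircle_sum {d : ℕ} (χ : Fin d → ℤ) (x : Torus d) :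
    UnitAddTorus.mFourier χ x = ((∑ i, χ i • x i : AddCircle (1 : ℝ)).toCircle : ℂ) := by
  have h : ∀ s : Finset (Fin d), ((∑ i ∈ s, χ i • x i : AddCircle (1 : ℝ)).toCircle : ℂ)
      = ∏ i ∈ s, ((χ i • x i : AddCircle (1 : ℝ)).toCircle : ℂ) := by
    intro s
    induction s using Finset.cons_induction with
    | empty => simp
    | cons a s ha ih =>
      rw [Finset.sum_cons, Finset.prod_cons, AddCircle.toCircle_add, Circle.coe_mul, ih]
  rw [h]
  simp only [UnitAddTorus.mFourier, ContinuousMap.coe_mk, fourier_apply]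

lemma mFourier_torusAut {d : ℕ} (M : Matrix (Fin d) (Fin d) ℤ) (χ : Fin d → ℤ) (x : Torus d) :
    UnitAddTorus.mFourier χ (torusAut M x) = UnitAddTorus.mFourier (M.transpose.mulVec χ) x := by
  rw [mFourier_eq_toCircle_sum, mFourier_eq_toCircle_sum]
  simp only [torusAut, Matrix.mulVec, dotProduct, Matrix.transpose_apply, Finset.smul_sum,
    Finset.sum_smul, smul_smul]
  rw [Finset.sum_comm]
  simp_rw [mul_comm]

lemma mFourier_add_point {d : ℕ} (χ : Fin d → ℤ) (x y : Torus d) :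
    UnitAddTorus.mFourier χ (x + y) = UnitAddTorus.mFourier χ x * UnitAddTorus.mFourier χ y := by
  simp only [mFourier_eq_toCircle_sum, Pi.add_apply, smul_add, Finset.sum_add_distrib,
    AddCircle.toCircle_add, Circle.coe_mul]

lemma norm_mFourier_apply {d : ℕ} (χ : Fin d → ℤ) (x : Torus d) :
    ‖UnitAddTorus.mFourier χ x‖ = 1 := by
  rw [mFourier_eq_toCircle_sum, Circle.norm_coe]

/-- Fourier coefficients of a real function on the torus. -/
def torusCoeff {d : ℕ} (f : Torus d → ℝ) (χ : Fin d → ℤ) : ℂ :=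
  ∫ x, UnitAddTorus.mFourier (-χ) x * (f x : ℂ)

lemma integrable_mFourier_mul {d : ℕ} {f : Torus d → ℝ} (hf : Measurable f) {C : ℝ}
    (hC : ∀ x, |f x| ≤ C) (χ : Fin d → ℤ) :
    Integrable fun x : Torus d => UnitAddTorus.mFourier χ x * (f x : ℂ) := by
  refine (integrable_const (C : ℝ)).mono'
    (((UnitAddTorus.mFourier χ).continuous.measurable.mul
      (Complex.measurable_ofReal.comp hf)).aestronglyMeasurable) (ae_of_all _ fun x => ?_)
  rw [norm_mul, norm_mFourier_apply, one_mul, Complex.norm_real]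
  exact hC x

lemma torusCoeff_comp_torusAut {d : ℕ} {f : Torus d → ℝ} (hf : Measurable f)
    {M : Matrix (Fin d) (Fin d) ℤ} (hM : M.det = 1) (χ : Fin d → ℤ) :
    torusCoeff (fun x => f (torusAut M x)) (M.transpose.mulVec χ) = torusCoeff f χ := by
  have h := measurePreserving_torusAut hM
  unfold torusCoeff
  rw [← Matrix.mulVec_neg]
  simp_rw [← mFourier_torusAut]
  conv_rhs => rw [← h.map_eq]
  rw [integral_map h.measurable.aemeasurable]
  exact ((UnitAddTorus.mFourier (-χ)).continuous.measurable.mul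
      (Complex.measurable_ofReal.comp hf)).aestronglyMeasurable

lemma torusCoeff_translate {d : ℕ} (f : Torus d → ℝ) (v : Torus d) (χ : Fin d → ℤ) :
    torusCoeff (fun x => f (x + v)) χ = UnitAddTorus.mFourier χ v * torusCoeff f χ := by
  unfold torusCoeff
  rw [← integral_const_mul]
  conv_rhs => rw [← integral_add_right_eq_self _ v]
  refine integral_congr_ae (ae_of_all _ fun x => ?_)
  have h : UnitAddTorus.mFourier χ v * UnitAddTorus.mFourier (-χ) v = 1 := by
    rw [← UnitAddTorus.mFourier_add, add_neg_cancel, UnitAddTorus.mFourier_zero]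
    rfl
  simp only [mFourier_add_point]
  linear_combination (-(UnitAddTorus.mFourier (-χ) x * (f (x + v) : ℂ))) * h

lemma torusCoeff_sub {d : ℕ} {f g : Torus d → ℝ} (hf : Measurable f) (hg : Measurable g)
    {C D : ℝ} (hC : ∀ x, |f x| ≤ C) (hD : ∀ x, |g x| ≤ D) (χ : Fin d → ℤ) :
    torusCoeff (fun x => f x - g x) χ = torusCoeff f χ - torusCoeff g χ := by
  unfold torusCoeff
  rw [← integral_sub (integrable_mFourier_mul hf hC _) (integrable_mFourier_mul hg hD _)]
  congr with x
  push_cast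
  ring

lemma torusCoeff_neg {d : ℕ} (f : Torus d → ℝ) (χ : Fin d → ℤ) :
    torusCoeff f (-χ) = (starRingEnd ℂ) (torusCoeff f χ) := by
  unfold torusCoeff
  rw [← integral_conj]
  congr with x
  rw [map_mul, Complex.conj_ofReal, ← UnitAddTorus.mFourier_neg]

lemma torusCoeff_zero {d : ℕ} (f : Torus d → ℝ) : torusCoeff f 0 = (∫ x, f x : ℝ) := by
  unfold torusCoeff
  rw [← integral_complex_ofReal]
  simp [UnitAddTorus.mFourier_zero]

lemma integral_mFourier {d : ℕ} (χ : Fin d → ℤ) :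
    ∫ x : Torus d, UnitAddTorus.mFourier χ x = if χ = 0 then 1 else 0 := by
  have h := orthonormal_iff_ite.mp (UnitAddTorus.orthonormal_mFourier (d := Fin d)) 0 χ
  simp only [ContinuousMap.inner_toLp] at h
  rw [volume_torus_eq]
  simp only [UnitAddTorus.mFourier_zero, eq_comm (a := (0 : Fin d → ℤ))] at h
  rw [← h]
  simp
  rfl

lemma hasSum_torusCoeff {d : ℕ} {f g : Torus d → ℝ} (hf : Measurable f) (hg : Measurable g)
    {C D : ℝ} (hC : ∀ x, |f x| ≤ C) (hD : ∀ x, |g x| ≤ D) :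
    HasSum (fun χ => (starRingEnd ℂ) (torusCoeff f χ) * torusCoeff g χ)
      ((∫ x, f x * g x : ℝ) : ℂ) := by
  have hm : ∀ {f : Torus d → ℝ} {C : ℝ}, Measurable f → (∀ x, |f x| ≤ C) →
      MemLp (fun x => (f x : ℂ)) 2 (Measure.pi fun _ : Fin d => AddCircle.haarAddCircle) :=
    fun {f C} hf hC => MemLp.of_bound (Complex.measurable_ofReal.comp hf).aestronglyMeasurable C
      (ae_of_all _ fun x => by rw [Complex.norm_real]; exact hC x)
  have hco : ∀ {f : Torus d → ℝ} {C : ℝ} (hf : Measurable f) (hC : ∀ x, |f x| ≤ C) χ,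
      UnitAddTorus.mFourierCoeff ((hm hf hC).toLp _) χ = torusCoeff f χ := by
    intro f C hf hC χ
    unfold torusCoeff UnitAddTorus.mFourierCoeff
    rw [volume_torus_eq]
    refine integral_congr_ae ?_
    filter_upwards [(hm hf hC).coeFn_toLp] with x hx
    rw [hx, smul_eq_mul]
  have h := UnitAddTorus.hasSum_prod_mFourierCoeff ((hm hf hC).toLp _) ((hm hg hD).toLp _)
  convert h using 1
  · ext1 χ
    exact congrArg₂ _ (congrArg _ (hco hf hC χ).symm) (hco hg hD χ).symm
  rw [← integral_complex_ofReal, volume_torus_eq]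
  refine integral_congr_ae ?_
  filter_upwards [(hm hf hC).coeFn_toLp, (hm hg hD).coeFn_toLp] with x hx hx'
  rw [hx, hx', Complex.conj_ofReal, Complex.ofReal_mul]

lemma hasSum_norm_sq_torusCoeff {d : ℕ} {f : Torus d → ℝ} (hf : Measurable f)
    {C : ℝ} (hC : ∀ x, |f x| ≤ C) :
    HasSum (fun χ => ‖torusCoeff f χ‖ ^ 2) (∫ x, f x ^ 2) := by
  have h := hasSum_torusCoeff hf hf hC hC
  rw [← Complex.hasSum_ofReal]
  convert h using 2 with χ
  · rw [← Complex.normSq_eq_conj_mul_self, Complex.normSq_eq_norm_sq]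
  · simp_rw [sq]

lemma hasSum_translate_sub {d : ℕ} {f : Torus d → ℝ} (hf : Measurable f) {C : ℝ}
    (hC : ∀ x, |f x| ≤ C) (v : Torus d) :
    HasSum (fun χ => ‖UnitAddTorus.mFourier χ v - 1‖ ^ 2 * ‖torusCoeff f χ‖ ^ 2)
      (∫ x, (f (x + v) - f x) ^ 2) := by
  have hfv : Measurable fun x => f (x + v) := hf.comp (measurable_add_const v)
  have h := hasSum_norm_sq_torusCoeff (f := fun x => f (x + v) - f x) (hfv.sub hf) (C := C + C) fun x =>
    (abs_sub _ _).trans (add_le_add (hC _) (hC _))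
  convert h using 2 with χ
  rw [torusCoeff_sub hfv hf (fun x => hC _) hC, torusCoeff_translate, ← mul_pow, ← norm_mul]
  ring_nf

lemma torusDist_add_single_le {d : ℕ} (x : Torus d) (i : Fin d) (v : ℝ) :
    torusDist (x + Pi.single i (v : AddCircle (1 : ℝ))) x ≤ |v| := by
  unfold torusDist
  rw [Finset.sum_eq_single i]
  · simp only [Pi.add_apply, Pi.single_eq_same, add_sub_cancel_left]
    rw [Real.sqrt_sq (norm_nonneg _)]
    exact QuotientAddGroup.norm_mk_le_norm
  · intro j _ hj
    simp [Pi.single_eq_of_ne hj]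
  · simp

lemma two_le_norm_mFourier_sub_one_sq {d : ℕ} {χ : Fin d → ℤ} {i : Fin d} {k : ℕ}
    (h1 : 2 ^ k ≤ (χ i).natAbs) (h2 : (χ i).natAbs < 2 ^ (k + 1)) :
    2 ≤ ‖UnitAddTorus.mFourier χ
      (Pi.single i (((2 : ℝ) ^ (k + 2))⁻¹ : ℝ) : Torus d) - 1‖ ^ 2 := by
  rw [mFourier_eq_toCircle_sum, Finset.sum_eq_single i
    (fun j _ hj => by simp [Pi.single_eq_of_ne hj]) (by simp)]
  rw [Pi.single_eq_same, ← AddCircle.coe_zsmul, AddCircle.toCircle_apply_mk, Circle.coe_exp]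
  set θ : ℝ := 2 * Real.pi / 1 * (χ i • ((2 : ℝ) ^ (k + 2))⁻¹) with hθ
  have hpi := Real.pi_pos
  have habs : |θ| = 2 * Real.pi * ((χ i).natAbs / (2 : ℝ) ^ (k + 2)) := by
    rw [hθ, zsmul_eq_mul, abs_mul, abs_mul, abs_inv, Nat.cast_natAbs, Int.cast_abs,
      abs_of_pos (show (0 : ℝ) < 2 ^ (k + 2) by positivity), div_one,
      abs_of_pos (show 0 < 2 * Real.pi by positivity)]
    rfl
  have h1' : (2 : ℝ) ^ k ≤ (χ i).natAbs := by exact_mod_cast h1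
  have h2' : ((χ i).natAbs : ℝ) ≤ 2 ^ (k + 1) := by exact_mod_cast h2.le
  have hk : (0 : ℝ) < 2 ^ k := by positivity
  have hlo : 1 / 4 ≤ ((χ i).natAbs : ℝ) / 2 ^ (k + 2) := by
    rw [div_le_div_iff₀ (by norm_num) (by positivity), pow_add]; linarith
  have hhi : ((χ i).natAbs : ℝ) / 2 ^ (k + 2) ≤ 1 / 2 := by
    rw [div_le_div_iff₀ (by positivity) (by norm_num), pow_add]
    rw [pow_add] at h2'; linarith
  have hcos : Real.cos θ ≤ 0 := by
    rw [← Real.cos_abs]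
    refine Real.cos_nonpos_of_pi_div_two_le_of_le ?_ ?_ <;> rw [habs] <;> nlinarith
  rw [← Complex.normSq_eq_norm_sq, Complex.normSq_apply]
  simp only [Complex.sub_re, Complex.sub_im, Complex.exp_ofReal_mul_I_re,
    Complex.exp_ofReal_mul_I_im, Complex.one_re, Complex.one_im]
  nlinarith [Real.sin_sq_add_cos_sq θ]

lemma integral_translate_sub_sq_le {d : ℕ} {η : ℝ} (hη : 0 < η) {f : Torus d → ℝ}
    {c : ℝ} (h : ∀ x y : Torus d, |f x - f y| ≤ c * torusDist x y ^ η) (hc : 0 ≤ c)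
    {v : Torus d} {τ : ℝ} (hv : ∀ x, torusDist (x + v) x ≤ τ) :
    ∫ x, (f (x + v) - f x) ^ 2 ≤ (c * τ ^ η) ^ 2 := by
  have hb : ∀ x, (f (x + v) - f x) ^ 2 ≤ (c * τ ^ η) ^ 2 := by
    intro x
    have h1 : torusDist (x + v) x ^ η ≤ τ ^ η :=
      Real.rpow_le_rpow (Real.sqrt_nonneg _) (hv x) hη.le
    have h2 := (h (x + v) x).trans (mul_le_mul_of_nonneg_left h1 hc)
    rw [← sq_abs]
    exact pow_le_pow_left₀ (abs_nonneg _) h2 2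
  have := integral_mono_of_nonneg (μ := (volume : Measure (Torus d)))
    (ae_of_all _ fun x => sq_nonneg _) (integrable_const ((c * τ ^ η) ^ 2)) (ae_of_all _ hb)
  simpa using this

lemma summable_coord_rpow_mul_sq {d : ℕ} {η : ℝ} (hη : 0 < η) {f : Torus d → ℝ}
    (hf : Measurable f) {C : ℝ} (hC : ∀ x, |f x| ≤ C) (hh : IsHolder η f) (i : Fin d) :
    Summable fun χ : Fin d → ℤ => ((χ i).natAbs : ℝ) ^ η * ‖torusCoeff f χ‖ ^ 2 := by
  obtain ⟨c₀, hc₀⟩ := hh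
  set c := max c₀ 0
  have hc : ∀ x y : Torus d, |f x - f y| ≤ c * torusDist x y ^ η := fun x y =>
    (hc₀ x y).trans (mul_le_mul_of_nonneg_right (le_max_left _ _)
      (Real.rpow_nonneg (Real.sqrt_nonneg _) _))
  have hc0 : 0 ≤ c := le_max_right _ _
  set q : ℝ := 2⁻¹ ^ η with hq
  have hq0 : 0 < q := by positivity
  have hq1 : q < 1 := Real.rpow_lt_one (by norm_num) (by norm_num) hη
  have hqinv : (2 : ℝ) ^ η = q⁻¹ := by rw [hq, Real.inv_rpow (by norm_num), inv_inv]
  have hpow : ∀ m : ℕ, ((2 : ℝ) ^ m) ^ η = (q ^ m)⁻¹ := fun m => by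
    rw [← Real.rpow_natCast, ← Real.rpow_mul (by norm_num), mul_comm, Real.rpow_mul (by norm_num),
      hqinv, Real.rpow_natCast, inv_pow]
  let v : ℕ → Torus d := fun k => Pi.single i ((((2 : ℝ) ^ (k + 2))⁻¹ : ℝ) : AddCircle (1 : ℝ))
  have hshell : ∀ (k : ℕ) (F : Finset (Fin d → ℤ)), (∀ χ ∈ F, Nat.log 2 (χ i).natAbs = k) →
      ∑ χ ∈ F, ((χ i).natAbs : ℝ) ^ η * ‖torusCoeff f χ‖ ^ 2 ≤ c ^ 2 * q ^ k := by
    intro k F hF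
    have hterm : ∀ χ ∈ F, ((χ i).natAbs : ℝ) ^ η * ‖torusCoeff f χ‖ ^ 2 ≤
        (q ^ (k + 1))⁻¹ * (‖UnitAddTorus.mFourier χ (v k) - 1‖ ^ 2 * ‖torusCoeff f χ‖ ^ 2) := by
      intro χ hχ
      rw [← mul_assoc]
      refine mul_le_mul_of_nonneg_right ?_ (sq_nonneg _)
      by_cases h0 : (χ i).natAbs = 0
      · rw [h0, Nat.cast_zero, Real.zero_rpow hη.ne']
        positivity
      have h1 := Nat.pow_log_le_self 2 h0
      have h2 := Nat.lt_pow_succ_log_self one_lt_two (χ i).natAbs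
      rw [hF χ hχ] at h1 h2
      have h3 := two_le_norm_mFourier_sub_one_sq h1 h2
      have h4 : ((χ i).natAbs : ℝ) ^ η ≤ (q ^ (k + 1))⁻¹ := by
        rw [← hpow]
        exact Real.rpow_le_rpow (by positivity) (by exact_mod_cast h2.le) hη.le
      refine h4.trans (le_mul_of_one_le_right (by positivity) (by linarith))
    refine (Finset.sum_le_sum hterm).trans ?_
    rw [← Finset.mul_sum]
    have hs := hasSum_translate_sub hf hC (v k)
    have h5 := (sum_le_hasSum F (fun χ _ => by positivity) hs).trans
      (integral_translate_sub_sq_le hη hc hc0 (τ := ((2 : ℝ) ^ (k + 2))⁻¹) fun x =>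
        (torusDist_add_single_le x i _).trans_eq (abs_of_pos (by positivity)))
    refine (mul_le_mul_of_nonneg_left h5 (by positivity)).trans ?_
    rw [Real.inv_rpow (by positivity), hpow, inv_inv, inv_mul_le_iff₀ (by positivity)]
    have h6 : q ^ 3 ≤ 1 := pow_le_one₀ hq0.le hq1.le
    calc (c * q ^ (k + 2)) ^ 2 = (q ^ (k + 1) * (c ^ 2 * q ^ k)) * q ^ 3 := by ring
      _ ≤ (q ^ (k + 1) * (c ^ 2 * q ^ k)) * 1 := mul_le_mul_of_nonneg_left h6 (by positivity)
      _ = _ := mul_one _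
  have hgeo : Summable fun k : ℕ => c ^ 2 * q ^ k :=
    (summable_geometric_of_lt_one hq0.le hq1).mul_left _
  refine summable_of_sum_le (c := ∑' k : ℕ, c ^ 2 * q ^ k) (fun χ => by positivity) fun F => ?_
  classical
  rw [← Finset.sum_fiberwise_of_maps_to (t := F.image fun χ => Nat.log 2 (χ i).natAbs)
    (g := fun χ => Nat.log 2 (χ i).natAbs) (fun χ hχ => Finset.mem_image_of_mem _ hχ)]
  refine (Finset.sum_le_sum fun k _ => hshell k _ fun χ hχ => (Finset.mem_filter.1 hχ).2).trans ?_
  exact hgeo.sum_le_tsum _ fun k _ => by positivity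

/-- Hölder functions on the torus have some Sobolev regularity. -/
lemma summable_norm_rpow_mul_sq {d : ℕ} {η : ℝ} (hη : 0 < η) {f : Torus d → ℝ}
    (hf : Measurable f) {C : ℝ} (hC : ∀ x, |f x| ≤ C) (hh : IsHolder η f) :
    Summable fun χ : Fin d → ℤ => ‖χ‖ ^ η * ‖torusCoeff f χ‖ ^ 2 := by
  refine Summable.of_nonneg_of_le (fun χ => by positivity) (fun χ => ?_)
    (summable_sum fun (i : Fin d) (_ : i ∈ Finset.univ) => summable_coord_rpow_mul_sq hη hf hC hh i)
  rw [← Finset.sum_mul]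
  refine mul_le_mul_of_nonneg_right ?_ (sq_nonneg _)
  have h0 : 0 ≤ ∑ i, ((χ i).natAbs : ℝ) ^ η := by positivity
  have : ‖χ‖ ≤ (∑ i, ((χ i).natAbs : ℝ) ^ η) ^ η⁻¹ := by
    rw [pi_norm_le_iff_of_nonneg (by positivity)]
    intro i
    rw [Real.le_rpow_inv_iff_of_pos (norm_nonneg _) h0 hη, Int.norm_eq_abs, ← Int.cast_abs,
      ← Nat.cast_natAbs]
    exact Finset.single_le_sum (f := fun i => ((χ i).natAbs : ℝ) ^ η) (fun j _ => by positivity)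
      (Finset.mem_univ i)
  rwa [Real.le_rpow_inv_iff_of_pos (norm_nonneg _) h0 hη] at this

/-- Squared Sobolev seminorm of order `η / 2` on the torus. -/
def sobolevSq {d : ℕ} (η : ℝ) (g : Torus d → ℝ) : ℝ :=
  ∑' χ : Fin d → ℤ, ‖χ‖ ^ η * ‖torusCoeff g χ‖ ^ 2

lemma sobolevSq_nonneg {d : ℕ} (η : ℝ) (g : Torus d → ℝ) : 0 ≤ sobolevSq η g :=
  tsum_nonneg fun χ => by positivity

/-- Bounded measurable centered functions of finite Sobolev seminorm. -/
structure IsSobolev {d : ℕ} (η : ℝ) (g : Torus d → ℝ) : Prop where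
  meas : Measurable g
  bdd : ∃ C, ∀ x, |g x| ≤ C
  coeff_zero : torusCoeff g 0 = 0
  summable : Summable fun χ : Fin d → ℤ => ‖χ‖ ^ η * ‖torusCoeff g χ‖ ^ 2

/-- The permutation of `ℤ^d` induced by a unimodular matrix. -/
def mulVecEquiv {d : ℕ} (M : Matrix (Fin d) (Fin d) ℤ) (hM : M.det = 1) :
    (Fin d → ℤ) ≃ (Fin d → ℤ) where
  toFun := M.mulVec
  invFun := M⁻¹.mulVec
  left_inv χ := by
    rw [Matrix.mulVec_mulVec, Matrix.nonsing_inv_mul _ (by rw [hM]; exact isUnit_one),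
      Matrix.one_mulVec]
  right_inv χ := by
    rw [Matrix.mulVec_mulVec, Matrix.mul_nonsing_inv _ (by rw [hM]; exact isUnit_one),
      Matrix.one_mulVec]

lemma NoRootOfUnityEigenvalue.transpose {d : ℕ} {S : Matrix (Fin d) (Fin d) ℤ}
    (h : NoRootOfUnityEigenvalue S) : NoRootOfUnityEigenvalue S.transpose := by
  intro z hz
  refine h z ?_
  rwa [Matrix.transpose_map, Matrix.charpoly_transpose] at hz

lemma exists_growth_rpow {d : ℕ} (hd : 0 < d) (A : Matrix (Fin d) (Fin d) ℤ) (hdet : A.det = 1)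
    (hE : NoRootOfUnityEigenvalue A) {η : ℝ} (hη : 0 < η) :
    ∃ C θ : ℝ, 0 < C ∧ 0 < θ ∧ θ < 1 ∧ ∀ χ : Fin d → ℤ, χ ≠ 0 → ∀ m : ℕ,
      1 ≤ C * θ ^ m * (‖χ‖ ^ (η / 2) * ‖(A ^ m).mulVec χ‖ ^ (η / 2)) := by
  obtain ⟨c, ρ, hc, hρ, h⟩ := exists_growth A hdet hE
  have hd' : (0 : ℝ) < d := by exact_mod_cast hd
  set e : ℝ := η / (4 * d) with he
  have he0 : 0 < e := by positivity
  have hρ0 : 0 < ρ := by linarith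
  refine ⟨(c ^ e)⁻¹, (ρ ^ e)⁻¹, by positivity, by positivity,
    inv_lt_one_of_one_lt₀ (Real.one_lt_rpow hρ he0), fun χ hχ m => ?_⟩
  have hu := one_le_norm_of_ne_zero hχ
  have hne : (A ^ m).mulVec χ ≠ 0 := by
    intro h0
    have := h χ hχ m
    rw [h0, norm_zero, mul_zero] at this
    have : 0 < c * ρ ^ m := by positivity
    linarith
  have hw := one_le_norm_of_ne_zero hne
  set u := ‖χ‖
  set w := ‖(A ^ m).mulVec χ‖
  have h1 : c * ρ ^ m ≤ (u * w) ^ (2 * d) := by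
    refine (h χ hχ m).trans ?_
    rw [mul_pow]
    exact mul_le_mul_of_nonneg_left (le_self_pow₀ hw (by omega)) (by positivity)
  have h2 := Real.rpow_le_rpow (by positivity) h1 he0.le
  have h3 : ((u * w) ^ (2 * d)) ^ e = u ^ (η / 2) * w ^ (η / 2) := by
    rw [← Real.rpow_natCast, ← Real.rpow_mul (by positivity),
      ← Real.mul_rpow (by positivity) (by positivity)]
    congr 1
    rw [he]
    push_cast
    field_simp
    norm_num
  have h4 : (c * ρ ^ m) ^ e = c ^ e * (ρ ^ e) ^ m := by
    rw [Real.mul_rpow (by positivity) (by positivity), ← Real.rpow_natCast, ← Real.rpow_natCast,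
      ← Real.rpow_mul hρ0.le, ← Real.rpow_mul hρ0.le, mul_comm e]
  rw [h3, h4] at h2
  rw [inv_pow, ← mul_inv, ← div_eq_inv_mul, le_div_iff₀ (by positivity), one_mul]
  exact h2

/-- Exponential decay of correlations for Sobolev functions under a toral automorphism. -/
lemma exists_decay {d : ℕ} (hd : 0 < d) {S : Matrix (Fin d) (Fin d) ℤ} (hdet : S.det = 1)
    (hE : NoRootOfUnityEigenvalue S) {η : ℝ} (hη : 0 < η) :
    ∃ C θ : ℝ, 0 < C ∧ 0 < θ ∧ θ < 1 ∧ ∀ g₁ g₂ : Torus d → ℝ, IsSobolev η g₁ → IsSobolev η g₂ →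
      ∀ m : ℕ, |∫ x, g₁ x * g₂ (torusAut (S ^ m) x)| ≤
        C * θ ^ m * (√(sobolevSq η g₁) * √(sobolevSq η g₂)) := by
  obtain ⟨C, θ, hC, hθ, hθ1, h⟩ := exists_growth_rpow hd S.transpose
    (by rw [Matrix.det_transpose, hdet]) hE.transpose hη
  refine ⟨C, θ, hC, hθ, hθ1, fun g₁ g₂ h₁ h₂ m => ?_⟩
  obtain ⟨C₁, hC₁⟩ := h₁.bdd
  obtain ⟨C₂, hC₂⟩ := h₂.bdd
  have hdm : (S ^ m).det = 1 := by rw [Matrix.det_pow, hdet, one_pow]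
  have hdt : (S.transpose ^ m).det = 1 := by
    rw [← Matrix.transpose_pow, Matrix.det_transpose, hdm]
  have hs := hasSum_torusCoeff h₁.meas
    (h₂.meas.comp (continuous_torusAut (S ^ m)).measurable) hC₁ (fun x => hC₂ _)
  rw [← (mulVecEquiv _ hdt).hasSum_iff] at hs
  have hcoe : ∀ ψ, torusCoeff (g₂ ∘ torusAut (S ^ m)) (mulVecEquiv _ hdt ψ) = torusCoeff g₂ ψ := by
    intro ψ
    have := torusCoeff_comp_torusAut h₂.meas hdm ψ
    rw [Matrix.transpose_pow] at this
    exact this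
  have hs₁ : Summable fun ψ => ‖mulVecEquiv _ hdt ψ‖ ^ η * ‖torusCoeff g₁ (mulVecEquiv _ hdt ψ)‖ ^ 2 :=
    (mulVecEquiv _ hdt).summable_iff.2 h₁.summable
  have ht₁ : ∑' ψ, ‖mulVecEquiv _ hdt ψ‖ ^ η * ‖torusCoeff g₁ (mulVecEquiv _ hdt ψ)‖ ^ 2
      = sobolevSq η g₁ :=
    (mulVecEquiv _ hdt).tsum_eq fun χ => ‖χ‖ ^ η * ‖torusCoeff g₁ χ‖ ^ 2
  have hsq : ∀ (y z : ℝ), 0 ≤ y → (y ^ (η / 2) * z) ^ 2 = y ^ η * z ^ 2 := fun y z hy => by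
    rw [mul_pow, ← Real.rpow_natCast (y ^ (η / 2)), ← Real.rpow_mul hy]
    norm_num
  have hlim := hs.norm
  rw [Complex.norm_real, Real.norm_eq_abs] at hlim
  refine le_of_tendsto hlim (Eventually.of_forall fun F => ?_)
  refine (norm_sum_le _ _).trans ?_
  have hterm : ∀ ψ ∈ F, ‖((fun χ => (starRingEnd ℂ) (torusCoeff g₁ χ) *
      torusCoeff (g₂ ∘ torusAut (S ^ m)) χ) ∘ mulVecEquiv _ hdt) ψ‖ ≤
      C * θ ^ m * ((‖mulVecEquiv _ hdt ψ‖ ^ (η / 2) * ‖torusCoeff g₁ (mulVecEquiv _ hdt ψ)‖) *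
        (‖ψ‖ ^ (η / 2) * ‖torusCoeff g₂ ψ‖)) := by
    intro ψ _
    rw [Function.comp_apply, hcoe, norm_mul, RCLike.norm_conj]
    by_cases hψ : ψ = 0
    · rw [hψ, h₂.coeff_zero]; simp
    have := h ψ hψ m
    calc _ = 1 * (‖torusCoeff g₁ (mulVecEquiv _ hdt ψ)‖ * ‖torusCoeff g₂ ψ‖) := (one_mul _).symm
      _ ≤ _ := mul_le_mul_of_nonneg_right this (by positivity)
      _ = _ := by change _ = C * θ ^ m * ((‖(S.transpose ^ m).mulVec ψ‖ ^ _ * _) * _); ring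
  refine (Finset.sum_le_sum hterm).trans ?_
  rw [← Finset.mul_sum]
  refine mul_le_mul_of_nonneg_left ?_ (by positivity)
  refine (Real.sum_mul_le_sqrt_mul_sqrt _ _ _).trans ?_
  simp only [hsq _ _ (norm_nonneg _)]
  refine mul_le_mul (Real.sqrt_le_sqrt ?_) (Real.sqrt_le_sqrt ?_) (Real.sqrt_nonneg _)
    (Real.sqrt_nonneg _)
  · rw [← ht₁]
    exact hs₁.sum_le_tsum _ fun ψ _ => by positivity
  · exact h₂.summable.sum_le_tsum _ fun ψ _ => by positivity

/-- A real trigonometric polynomial without constant term, with frequencies in `G`. -/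
structure IsTrigPoly {d : ℕ} (G : Finset (Fin d → ℤ)) (a : (Fin d → ℤ) → ℂ) (g : Torus d → ℝ) :
    Prop where
  ne_zero : ∀ χ ∈ G, χ ≠ 0
  eq_sum : ∀ x, (g x : ℂ) = ∑ χ ∈ G, a χ * UnitAddTorus.mFourier χ x

namespace IsTrigPoly

variable {d : ℕ} {G : Finset (Fin d → ℤ)} {a : (Fin d → ℤ) → ℂ} {g : Torus d → ℝ}

lemma measurable (hg : IsTrigPoly G a g) : Measurable g := by
  have h : g = fun x => (∑ χ ∈ G, a χ * UnitAddTorus.mFourier χ x).re := by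
    ext x; rw [← hg.eq_sum, Complex.ofReal_re]
  rw [h]
  fun_prop

lemma abs_le (hg : IsTrigPoly G a g) (x : Torus d) : |g x| ≤ ∑ χ ∈ G, ‖a χ‖ := by
  rw [← Real.norm_eq_abs, ← Complex.norm_real, hg.eq_sum]
  refine (norm_sum_le _ _).trans (Finset.sum_le_sum fun χ _ => ?_)
  rw [norm_mul, norm_mFourier_apply, mul_one]

lemma comp_zpow (hg : IsTrigPoly G a g) (S : Matrix (Fin d) (Fin d) ℤ) (k : ℤ) (x : Torus d) :
    (g (torusAut (S ^ k) x) : ℂ)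
      = ∑ χ ∈ G, a χ * UnitAddTorus.mFourier ((S.transpose ^ k).mulVec χ) x := by
  rw [hg.eq_sum]
  simp_rw [mFourier_torusAut, Matrix.transpose_zpow]

lemma torusCoeff_eq (hg : IsTrigPoly G a g) (χ : Fin d → ℤ) :
    torusCoeff g χ = if χ ∈ G then a χ else 0 := by
  classical
  unfold torusCoeff
  have h : ∀ x, UnitAddTorus.mFourier (-χ) x * (g x : ℂ)
      = ∑ ψ ∈ G, a ψ * UnitAddTorus.mFourier (-χ + ψ) x := fun x => by
    rw [hg.eq_sum, Finset.mul_sum]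
    refine Finset.sum_congr rfl fun ψ _ => ?_
    rw [UnitAddTorus.mFourier_add]
    ring
  simp_rw [h]
  rw [integral_finsetSum _ fun ψ _ => Integrable.const_mul
    ((UnitAddTorus.mFourier (-χ + ψ)).continuous.integrable_of_hasCompactSupport
      (HasCompactSupport.of_compactSpace _)) _]
  simp_rw [integral_const_mul, integral_mFourier, neg_add_eq_zero]
  simp

lemma integral_mFourier_mul_prod (hg : IsTrigPoly G a g) (S : Matrix (Fin d) (Fin d) ℤ)
    (l : ℤ → ℤ) (I : Finset ℤ) (v : Fin d → ℤ)
    (hv : ∀ χ : ℤ → Fin d → ℤ, (∀ j ∈ I, χ j ∈ G) →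
      v + ∑ j ∈ I, (S.transpose ^ l j).mulVec (χ j) ≠ 0) :
    ∫ x, UnitAddTorus.mFourier v x * ∏ j ∈ I, (g (torusAut (S ^ l j) x) : ℂ) = 0 := by
  induction I using Finset.cons_induction generalizing v with
  | empty =>
    have : v ≠ 0 := by simpa using hv (fun _ => 0) (by simp)
    simp [integral_mFourier, this]
  | cons i I hi ih =>
    have h : ∀ x, UnitAddTorus.mFourier v x *
        ∏ j ∈ Finset.cons i I hi, (g (torusAut (S ^ l j) x) : ℂ)
        = ∑ χ ∈ G, a χ * (UnitAddTorus.mFourier (v + (S.transpose ^ l i).mulVec χ) x *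
          ∏ j ∈ I, (g (torusAut (S ^ l j) x) : ℂ)) := fun x => by
      rw [Finset.prod_cons, hg.comp_zpow, Finset.sum_mul, Finset.mul_sum]
      refine Finset.sum_congr rfl fun ψ _ => ?_
      rw [UnitAddTorus.mFourier_add]
      ring
    simp_rw [h]
    have hInt : ∀ w : Fin d → ℤ, Integrable fun x => UnitAddTorus.mFourier w x *
        ∏ j ∈ I, (g (torusAut (S ^ l j) x) : ℂ) := by
      intro w
      have hm : Measurable fun x => ∏ j ∈ I, g (torusAut (S ^ l j) x) :=
        Finset.measurable_fun_prod _ fun j _ =>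
          hg.measurable.comp (continuous_torusAut _).measurable
      have := integrable_mFourier_mul hm (C := ∏ j ∈ I, ∑ χ ∈ G, ‖a χ‖) (fun x => by
        rw [Finset.abs_prod]
        exact Finset.prod_le_prod (fun _ _ => abs_nonneg _) fun j _ => hg.abs_le _) w
      simpa only [Complex.ofReal_prod] using this
    rw [integral_finsetSum _ fun ψ _ => (hInt _).const_mul _]
    refine Finset.sum_eq_zero fun ψ hψ => ?_
    rw [integral_const_mul, ih, mul_zero]
    intro χ hχ
    have h1 := hv (Function.update χ i ψ) (fun j hj => by
      rcases Finset.mem_cons.1 hj with hji | hjI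
      · rw [hji, Function.update_self]
        exact hψ
      · rw [Function.update_of_ne (by rintro rfl; exact hi hjI)]
        exact hχ j hjI)
    rw [Finset.sum_cons, Function.update_self] at h1
    rw [add_assoc]
    convert h1 using 4 with j hj
    rw [Function.update_of_ne (by rintro rfl; exact hi hj)]

lemma integral_prod_eq_zero (hg : IsTrigPoly G a g) (S : Matrix (Fin d) (Fin d) ℤ)
    (l : ℤ → ℤ) (I : Finset ℤ)
    (hv : ∀ χ : ℤ → Fin d → ℤ, (∀ j ∈ I, χ j ∈ G) →
      ∑ j ∈ I, (S.transpose ^ l j).mulVec (χ j) ≠ 0) :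
    ∫ x, ∏ j ∈ I, g (torusAut (S ^ l j) x) = 0 := by
  have := hg.integral_mFourier_mul_prod S l I 0 (by simpa using hv)
  simp only [UnitAddTorus.mFourier_zero, ContinuousMap.one_apply, one_mul] at this
  rw [← Complex.ofReal_inj, ← integral_complex_ofReal]
  simpa using this

lemma integral_mul_eq (hg : IsTrigPoly G a g) (S : Matrix (Fin d) (Fin d) ℤ) (l₁ l₂ : ℤ) :
    ((∫ x, g (torusAut (S ^ l₁) x) * g (torusAut (S ^ l₂) x) : ℝ) : ℂ)
      = ∑ p ∈ G ×ˢ G, a p.1 * a p.2 * (if (S.transpose ^ l₁).mulVec p.1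
          + (S.transpose ^ l₂).mulVec p.2 = 0 then 1 else 0) := by
  rw [← integral_complex_ofReal]
  have h : ∀ x, ((g (torusAut (S ^ l₁) x) * g (torusAut (S ^ l₂) x) : ℝ) : ℂ)
      = ∑ p ∈ G ×ˢ G, a p.1 * a p.2 * UnitAddTorus.mFourier ((S.transpose ^ l₁).mulVec p.1
          + (S.transpose ^ l₂).mulVec p.2) x := fun x => by
    rw [Complex.ofReal_mul, hg.comp_zpow, hg.comp_zpow, Finset.sum_mul_sum,
      ← Finset.sum_product']
    refine Finset.sum_congr rfl fun p _ => ?_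
    rw [UnitAddTorus.mFourier_add]
    ring
  simp_rw [h]
  rw [integral_finsetSum _ fun ψ _ => Integrable.const_mul
    ((UnitAddTorus.mFourier _).continuous.integrable_of_hasCompactSupport
      (HasCompactSupport.of_compactSpace _)) _]
  simp_rw [integral_const_mul, integral_mFourier]

lemma integral_mul_mul_eq (hg : IsTrigPoly G a g) (S : Matrix (Fin d) (Fin d) ℤ)
    (l₁ l₂ l₃ l₄ : ℤ) :
    ((∫ x, (g (torusAut (S ^ l₁) x) * g (torusAut (S ^ l₂) x)) *
        (g (torusAut (S ^ l₃) x) * g (torusAut (S ^ l₄) x)) : ℝ) : ℂ)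
      = ∑ p ∈ G ×ˢ G, ∑ q ∈ G ×ˢ G, (a p.1 * a p.2) * (a q.1 * a q.2) *
          (if ((S.transpose ^ l₁).mulVec p.1 + (S.transpose ^ l₂).mulVec p.2)
            + ((S.transpose ^ l₃).mulVec q.1 + (S.transpose ^ l₄).mulVec q.2) = 0
            then 1 else 0) := by
  rw [← integral_complex_ofReal]
  have h : ∀ x, (((g (torusAut (S ^ l₁) x) * g (torusAut (S ^ l₂) x)) *
        (g (torusAut (S ^ l₃) x) * g (torusAut (S ^ l₄) x)) : ℝ) : ℂ)
      = ∑ p ∈ G ×ˢ G, ∑ q ∈ G ×ˢ G, (a p.1 * a p.2) * (a q.1 * a q.2) *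
          UnitAddTorus.mFourier (((S.transpose ^ l₁).mulVec p.1
          + (S.transpose ^ l₂).mulVec p.2) + ((S.transpose ^ l₃).mulVec q.1
          + (S.transpose ^ l₄).mulVec q.2)) x := fun x => by
    rw [Complex.ofReal_mul, Complex.ofReal_mul, Complex.ofReal_mul, hg.comp_zpow, hg.comp_zpow,
      hg.comp_zpow, hg.comp_zpow, Finset.sum_mul_sum, Finset.sum_mul_sum,
      ← Finset.sum_product', ← Finset.sum_product', Finset.sum_mul_sum]
    refine Finset.sum_congr rfl fun p _ => Finset.sum_congr rfl fun q _ => ?_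
    simp only [UnitAddTorus.mFourier_add]
    ring
  have hi : ∀ v : Fin d → ℤ, Integrable (fun x : Torus d => UnitAddTorus.mFourier v x) := fun v =>
    (UnitAddTorus.mFourier v).continuous.integrable_of_hasCompactSupport
      (HasCompactSupport.of_compactSpace _)
  simp_rw [h]
  rw [integral_finsetSum _ fun p _ => integrable_finsetSum _ fun q _ => (hi _).const_mul _]
  refine Finset.sum_congr rfl fun p _ => ?_
  rw [integral_finsetSum _ fun q _ => (hi _).const_mul _]
  simp_rw [integral_const_mul, integral_mFourier]

end IsTrigPoly

/-- The correlation function of an observable along the orbits of a toral automorphism. -/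
def torusCov {d : ℕ} (S : Matrix (Fin d) (Fin d) ℤ) (g : Torus d → ℝ) (m : ℤ) : ℝ :=
  ∫ y, g y * g (torusAut (S ^ m.natAbs) y)

lemma integral_mul_comp_zpow {d : ℕ} {S : Matrix (Fin d) (Fin d) ℤ} (hS : S.det = 1)
    {g : Torus d → ℝ} (hg : Measurable g) (l l' : ℤ) :
    ∫ x, g (torusAut (S ^ l) x) * g (torusAut (S ^ l') x) = torusCov S g (l' - l) := by
  wlog h : l ≤ l' generalizing l l' with H
  · have h1 := H l' l (by omega)
    rw [torusCov, show (l - l').natAbs = (l' - l).natAbs by omega] at h1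
    rw [torusCov, ← h1]
    simp_rw [mul_comm]
  have hu : IsUnit S.det := by rw [hS]; exact isUnit_one
  have hpow : S ^ l' = S ^ (l' - l).natAbs * S ^ l := by
    rw [← zpow_natCast, ← Matrix.zpow_add hu]
    congr 1
    omega
  have hmp := measurePreserving_torusAut (det_zpow_eq_one hS l)
  simp_rw [hpow, torusAut_mul]
  unfold torusCov
  conv_rhs => rw [← hmp.map_eq]
  rw [integral_map hmp.measurable.aemeasurable]
  exact (hg.mul (hg.comp (continuous_torusAut _).measurable)).aestronglyMeasurable

lemma exists_separation {d : ℕ} {A : Matrix (Fin d) (Fin d) ℤ} (hdet : A.det = 1)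
    (hE : NoRootOfUnityEigenvalue A) (G : Finset (Fin d → ℤ)) (L : ℕ) :
    ∃ h : ℕ, ∀ l₁ l₂ l₃ l₄ : ℤ, |l₁ - l₂| < L → |l₃ - l₄| < L → h ≤ |l₁ - l₃| →
      ∀ p ∈ G ×ˢ G, ∀ q ∈ G ×ˢ G,
        (((A ^ l₁).mulVec p.1 + (A ^ l₂).mulVec p.2)
          + ((A ^ l₃).mulVec q.1 + (A ^ l₄).mulVec q.2) = 0 ↔
        (A ^ l₁).mulVec p.1 + (A ^ l₂).mulVec p.2 = 0 ∧
          (A ^ l₃).mulVec q.1 + (A ^ l₄).mulVec q.2 = 0) := by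
  classical
  have hu : IsUnit A.det := by rw [hdet]; exact isUnit_one
  let G' : Finset (Fin d → ℤ) := (((G ×ˢ G) ×ˢ Finset.Icc (-(L : ℤ)) L).image fun z =>
    z.1.1 + (A ^ z.2).mulVec z.1.2).filter (· ≠ 0)
  obtain ⟨h, -, hh⟩ := exists_gap A hdet hE G' fun χ hχ => (Finset.mem_filter.1 hχ).2
  have key : ∀ (l l' : ℤ) (u w : Fin d → ℤ), u ∈ G' → w ∈ G' → l + h ≤ l' →
      (A ^ l).mulVec u + (A ^ l').mulVec w ≠ 0 := by
    intro l l' u w hu hw hl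
    have := hh {0, 1} (fun j => if j = 0 then l else l') (fun j => if j = 0 then u else w)
      (by simp) (by simp [hu, hw]) (by simpa using by omega)
    rwa [Finset.sum_pair (by norm_num), if_pos rfl, if_pos rfl, if_neg one_ne_zero,
      if_neg one_ne_zero] at this
  have hfac : ∀ l l' : ℤ, |l - l'| < L → ∀ p ∈ G ×ˢ G,
      (A ^ l).mulVec p.1 + (A ^ l').mulVec p.2 ≠ 0 →
      ∃ u ∈ G', (A ^ l).mulVec p.1 + (A ^ l').mulVec p.2 = (A ^ l).mulVec u := by
    intro l l' hl p hp hne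
    have e : (A ^ l).mulVec p.1 + (A ^ l').mulVec p.2
        = (A ^ l).mulVec (p.1 + (A ^ (l' - l)).mulVec p.2) := by
      rw [Matrix.mulVec_add, Matrix.mulVec_mulVec, ← Matrix.zpow_add hu]
      congr 3
      omega
    refine ⟨_, Finset.mem_filter.2 ⟨Finset.mem_image.2 ⟨(p, l' - l), ?_, rfl⟩, ?_⟩, e⟩
    · rw [abs_lt] at hl
      exact Finset.mem_product.2 ⟨hp, Finset.mem_Icc.2 ⟨by omega, by omega⟩⟩
    · intro h0
      rw [e, h0, Matrix.mulVec_zero] at hne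
      exact hne rfl
  refine ⟨h, fun l₁ l₂ l₃ l₄ h12 h34 h13 p hp q hq => ⟨fun hz => ?_, fun hz => ?_⟩⟩
  · by_cases hp0 : (A ^ l₁).mulVec p.1 + (A ^ l₂).mulVec p.2 = 0
    · rw [hp0, zero_add] at hz
      exact ⟨hp0, hz⟩
    by_cases hq0 : (A ^ l₃).mulVec q.1 + (A ^ l₄).mulVec q.2 = 0
    · rw [hq0, add_zero] at hz
      exact ⟨hz, hq0⟩
    obtain ⟨u, hu', eu⟩ := hfac _ _ h12 p hp hp0
    obtain ⟨w, hw', ew⟩ := hfac _ _ h34 q hq hq0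
    rw [eu, ew] at hz
    rcases le_abs.1 h13 with h' | h'
    · rw [add_comm] at hz
      exact absurd hz (key l₃ l₁ w u hw' hu' (by omega))
    · exact absurd hz (key l₁ l₃ u w hu' hw' (by omega))
  · rw [hz.1, hz.2, add_zero]

/-- A trigonometric polynomial along the orbits of an ergodic toral automorphism. -/
lemma IsTrigPoly.exists_isGapProcess {d : ℕ} {G : Finset (Fin d → ℤ)} {a : (Fin d → ℤ) → ℂ}
    {g : Torus d → ℝ} (hg : IsTrigPoly G a g) {S : Matrix (Fin d) (Fin d) ℤ} (hS : S.det = 1)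
    (hE : NoRootOfUnityEigenvalue S) :
    ∃ γ : ℕ, IsGapProcess (volume : Measure (Torus d)) (fun l x => g (torusAut (S ^ l) x))
      (∑ χ ∈ G, ‖a χ‖) (torusCov S g) γ := by
  have hdt : S.transpose.det = 1 := by rw [Matrix.det_transpose, hS]
  obtain ⟨γ, -, hγ⟩ := exists_gap S.transpose hdt hE.transpose G hg.ne_zero
  refine ⟨γ, fun l => hg.measurable.comp (continuous_torusAut _).measurable, by positivity,
    fun l x => hg.abs_le _, integral_mul_comp_zpow hS hg.measurable, fun I l hI hl =>
    hg.integral_prod_eq_zero S l I fun χ hχ => hγ I l χ hI hχ hl, fun L => ?_⟩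
  obtain ⟨h, hh⟩ := exists_separation hdt hE.transpose G L
  refine ⟨h, fun l₁ l₂ l₃ l₄ h12 h34 h13 => ?_⟩
  rw [← Complex.ofReal_inj, hg.integral_mul_mul_eq, Complex.ofReal_mul, hg.integral_mul_eq,
    hg.integral_mul_eq, Finset.sum_mul_sum]
  refine Finset.sum_congr rfl fun p hp => Finset.sum_congr rfl fun q hq => ?_
  simp only [hh l₁ l₂ l₃ l₄ h12 h34 h13 p hp q hq, ite_and]
  split_ifs <;> simp

/-- Truncation of the Fourier series of `f` to the frequencies in `G`. -/
def fourierTrunc {d : ℕ} (f : Torus d → ℝ) (G : Finset (Fin d → ℤ)) (x : Torus d) : ℝ :=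
  (∑ χ ∈ G, torusCoeff f χ * UnitAddTorus.mFourier χ x).re

lemma isTrigPoly_fourierTrunc {d : ℕ} (f : Torus d → ℝ) {G : Finset (Fin d → ℤ)}
    (h0 : ∀ χ ∈ G, χ ≠ 0) (hG : ∀ χ ∈ G, -χ ∈ G) :
    IsTrigPoly G (torusCoeff f) (fourierTrunc f G) := by
  refine ⟨h0, fun x => ?_⟩
  rw [fourierTrunc, ← Complex.conj_eq_iff_re, map_sum]
  refine Finset.sum_nbij' (fun χ => -χ) (fun χ => -χ) hG hG (by simp) (by simp) fun χ _ => ?_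
  rw [map_mul, torusCoeff_neg, UnitAddTorus.mFourier_neg]

lemma summable_pow_natAbs {θ : ℝ} (h0 : 0 ≤ θ) (h1 : θ < 1) :
    Summable fun m : ℤ => θ ^ m.natAbs := by
  refine Summable.of_nat_of_neg ?_ ?_ <;> simpa using summable_geometric_of_lt_one h0 h1

lemma integrable_mul_comp_torusAut {d : ℕ} {g₁ g₂ : Torus d → ℝ} (h₁ : Measurable g₁)
    (h₂ : Measurable g₂) (b₁ : ∃ C, ∀ x, |g₁ x| ≤ C) (b₂ : ∃ C, ∀ x, |g₂ x| ≤ C)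
    (M : Matrix (Fin d) (Fin d) ℤ) : Integrable fun x => g₁ x * g₂ (torusAut M x) := by
  obtain ⟨C₁, hC₁⟩ := b₁
  obtain ⟨C₂, hC₂⟩ := b₂
  refine integrable_of_abs_le (C := C₁ * C₂)
    (h₁.mul (h₂.comp (continuous_torusAut M).measurable)) fun x => ?_
  rw [abs_mul]
  exact mul_le_mul (hC₁ _) (hC₂ _) (abs_nonneg _) ((abs_nonneg _).trans (hC₁ x))

section Approximation
variable {d : ℕ} {η : ℝ} {f : Torus d → ℝ} {G : Finset (Fin d → ℤ)}

lemma isSobolev_fourierTrunc (h0 : ∀ χ ∈ G, χ ≠ 0) (hG : ∀ χ ∈ G, -χ ∈ G) :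
    IsSobolev η (fourierTrunc f G) ∧ sobolevSq η (fourierTrunc f G)
      = ∑ χ ∈ G, ‖χ‖ ^ η * ‖torusCoeff f χ‖ ^ 2 := by
  classical
  have hp := isTrigPoly_fourierTrunc f h0 hG
  have hs : HasSum (fun χ : Fin d → ℤ => ‖χ‖ ^ η * ‖torusCoeff (fourierTrunc f G) χ‖ ^ 2)
      (∑ χ ∈ G, ‖χ‖ ^ η * ‖torusCoeff f χ‖ ^ 2) := by
    rw [Finset.sum_congr rfl fun χ hχ => show ‖χ‖ ^ η * ‖torusCoeff f χ‖ ^ 2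
      = ‖χ‖ ^ η * ‖torusCoeff (fourierTrunc f G) χ‖ ^ 2 by rw [hp.torusCoeff_eq, if_pos hχ]]
    exact hasSum_sum_of_ne_finset_zero fun χ hχ => by rw [hp.torusCoeff_eq, if_neg hχ]; simp
  refine ⟨⟨hp.measurable, ⟨_, hp.abs_le⟩, ?_, hs.summable⟩, hs.tsum_eq⟩
  rw [hp.torusCoeff_eq, if_neg fun h => h0 0 h rfl]

lemma IsSobolev.sub_fourierTrunc (hf : IsSobolev η f) (h0 : ∀ χ ∈ G, χ ≠ 0)
    (hG : ∀ χ ∈ G, -χ ∈ G) :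
    IsSobolev η (fun x => f x - fourierTrunc f G x) ∧
      sobolevSq η (fun x => f x - fourierTrunc f G x)
        = sobolevSq η f - ∑ χ ∈ G, ‖χ‖ ^ η * ‖torusCoeff f χ‖ ^ 2 := by
  classical
  have hp := isTrigPoly_fourierTrunc f h0 hG
  obtain ⟨hs, hs'⟩ := isSobolev_fourierTrunc (η := η) (f := f) h0 hG
  obtain ⟨C, hC⟩ := hf.bdd
  have hco : ∀ χ, torusCoeff (fun x => f x - fourierTrunc f G x) χ
      = torusCoeff f χ - torusCoeff (fourierTrunc f G) χ := fun χ =>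
    torusCoeff_sub hf.meas hp.measurable hC hp.abs_le χ
  have hw : ∀ χ : Fin d → ℤ, ‖χ‖ ^ η * ‖torusCoeff (fun x => f x - fourierTrunc f G x) χ‖ ^ 2
      = ‖χ‖ ^ η * ‖torusCoeff f χ‖ ^ 2 - ‖χ‖ ^ η * ‖torusCoeff (fourierTrunc f G) χ‖ ^ 2 := by
    intro χ
    rw [hco, hp.torusCoeff_eq]
    split_ifs <;> simp
  have hsum := hf.summable.hasSum.sub hs.summable.hasSum
  simp_rw [← hw] at hsum
  refine ⟨⟨hf.meas.sub hp.measurable, ⟨C + ∑ χ ∈ G, ‖torusCoeff f χ‖, fun x =>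
    (abs_sub _ _).trans (add_le_add (hC x) (hp.abs_le x))⟩, ?_, hsum.summable⟩, ?_⟩
  · rw [hco, hf.coeff_zero, hs.coeff_zero, sub_zero]
  · rw [← hs']
    exact hsum.tsum_eq

lemma IsSobolev.exists_sobolevSq_sub_le (hf : IsSobolev η f) {δ : ℝ} (hδ : 0 < δ) :
    ∃ G : Finset (Fin d → ℤ), (∀ χ ∈ G, χ ≠ 0) ∧ (∀ χ ∈ G, -χ ∈ G) ∧
      sobolevSq η (fun x => f x - fourierTrunc f G x) ≤ δ := by
  classical
  obtain ⟨s, hs⟩ := (hf.summable.hasSum.eventually_const_lt (sub_lt_self _ hδ)).exists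
  refine ⟨(s ∪ s.image Neg.neg).erase 0, fun χ hχ => (Finset.mem_erase.1 hχ).1, fun χ hχ => ?_, ?_⟩
  · simp only [Finset.mem_erase, Finset.mem_union, Finset.mem_image] at hχ ⊢
    refine ⟨neg_ne_zero.2 hχ.1, ?_⟩
    rcases hχ.2 with h | ⟨ψ, h, rfl⟩
    · exact Or.inr ⟨χ, h, rfl⟩
    · exact Or.inl (by simpa using h)
  · rw [(hf.sub_fourierTrunc _ _).2]
    · have h1 : ∑ χ ∈ s, ‖χ‖ ^ η * ‖torusCoeff f χ‖ ^ 2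
          ≤ ∑ χ ∈ (s ∪ s.image Neg.neg).erase 0, ‖χ‖ ^ η * ‖torusCoeff f χ‖ ^ 2 := by
        rw [Finset.sum_erase _ (by rw [hf.coeff_zero]; simp)]
        exact Finset.sum_le_sum_of_subset_of_nonneg Finset.subset_union_left
          fun χ _ _ => by positivity
      have h2 : sobolevSq η f - δ < ∑ χ ∈ s, ‖χ‖ ^ η * ‖torusCoeff f χ‖ ^ 2 := hs
      linarith
    · exact fun χ hχ => (Finset.mem_erase.1 hχ).1
    · intro χ hχ
      simp only [Finset.mem_erase, Finset.mem_union, Finset.mem_image] at hχ ⊢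
      refine ⟨neg_ne_zero.2 hχ.1, ?_⟩
      rcases hχ.2 with h | ⟨ψ, h, rfl⟩
      · exact Or.inr ⟨χ, h, rfl⟩
      · exact Or.inl (by simpa using h)

/-- Sobolev observables are approximated by trigonometric polynomials, uniformly along orbits. -/
lemma IsSobolev.exists_trigPoly_approx (hd : 0 < d) {S : Matrix (Fin d) (Fin d) ℤ}
    (hdet : S.det = 1) (hE : NoRootOfUnityEigenvalue S) (hη : 0 < η) (hf : IsSobolev η f)
    {ε : ℝ} (hε : 0 < ε) :
    ∃ (G : Finset (Fin d → ℤ)) (a : (Fin d → ℤ) → ℂ) (g : Torus d → ℝ), IsTrigPoly G a g ∧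
      Summable (fun m => |torusCov S (fun x => f x - g x) m|) ∧
      ∑' m, |torusCov S (fun x => f x - g x) m| ≤ ε ∧
      |(∑' m, torusCov S f m) - ∑' m, torusCov S g m| ≤ ε := by
  obtain ⟨C, θ, hC, hθ, hθ1, hdec⟩ := exists_decay hd hdet hE hη
  have hgeo := summable_pow_natAbs hθ.le hθ1
  set K := ∑' m : ℤ, θ ^ m.natAbs with hK
  have hK0 : 0 ≤ K := tsum_nonneg fun m => by positivity
  set w := √(sobolevSq η f)
  have hw0 : 0 ≤ w := Real.sqrt_nonneg _
  set q := 2 * C * K * w + 1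
  have hq : 0 < q := by positivity
  obtain ⟨G, h0, hG, hδ⟩ := hf.exists_sobolevSq_sub_le (δ := (ε / q) ^ 2) (by positivity)
  have hp := isTrigPoly_fourierTrunc f h0 hG
  obtain ⟨hg, hg'⟩ := isSobolev_fourierTrunc (η := η) (f := f) h0 hG
  obtain ⟨hh, hh'⟩ := hf.sub_fourierTrunc h0 hG
  set g := fourierTrunc f G
  set h : Torus d → ℝ := fun x => f x - g x with hhdef
  set τ := √(sobolevSq η h)
  have hτ : τ ≤ ε / q := Real.sqrt_le_iff.2 ⟨by positivity, hδ⟩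
  have hτ0 : 0 ≤ τ := Real.sqrt_nonneg _
  have hτw : τ ≤ w := Real.sqrt_le_sqrt (by
    rw [hh', sub_le_self_iff]; positivity)
  have hgw : √(sobolevSq η g) ≤ w := Real.sqrt_le_sqrt (by
    have := sobolevSq_nonneg η h
    rw [hh'] at this
    rw [hg']; linarith)
  have hfin : 2 * (C * (τ * w)) * K ≤ ε := by
    calc 2 * (C * (τ * w)) * K = τ * (2 * C * K * w) := by ring
      _ ≤ ε / q * q := mul_le_mul hτ (by simp [q]) (by positivity) (by positivity)
      _ = ε := div_mul_cancel₀ _ hq.ne'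
  have hbound : Summable fun m : ℤ => C * (τ * w) * θ ^ m.natAbs := hgeo.mul_left _
  have hb2 : Summable fun m : ℤ => 2 * (C * (τ * w)) * θ ^ m.natAbs := hgeo.mul_left _
  have hcovh : ∀ m, |torusCov S h m| ≤ C * (τ * w) * θ ^ m.natAbs := fun m => by
    refine (hdec h h hh hh m.natAbs).trans ?_
    have : τ * τ ≤ τ * w := mul_le_mul_of_nonneg_left hτw hτ0
    calc C * θ ^ m.natAbs * (τ * τ) ≤ C * θ ^ m.natAbs * (τ * w) := by gcongr
      _ = _ := by ring
  have hdiff : ∀ m, |torusCov S f m - torusCov S g m| ≤ 2 * (C * (τ * w)) * θ ^ m.natAbs := by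
    intro m
    have e : torusCov S f m - torusCov S g m = (∫ x, h x * f (torusAut (S ^ m.natAbs) x))
        + ∫ x, g x * h (torusAut (S ^ m.natAbs) x) := by
      unfold torusCov
      rw [← integral_sub (integrable_mul_comp_torusAut hf.meas hf.meas hf.bdd hf.bdd _)
          (integrable_mul_comp_torusAut hg.meas hg.meas hg.bdd hg.bdd _),
        ← integral_add (integrable_mul_comp_torusAut hh.meas hf.meas hh.bdd hf.bdd _)
          (integrable_mul_comp_torusAut hg.meas hh.meas hg.bdd hh.bdd _)]
      congr with x
      simp only [hhdef]
      ring
    rw [e]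
    refine (abs_add_le _ _).trans ((add_le_add (hdec h f hh hf m.natAbs)
      (hdec g h hg hh m.natAbs)).trans ?_)
    have : √(sobolevSq η g) * τ ≤ w * τ := mul_le_mul_of_nonneg_right hgw hτ0
    calc C * θ ^ m.natAbs * (τ * w) + C * θ ^ m.natAbs * (√(sobolevSq η g) * τ)
        ≤ C * θ ^ m.natAbs * (τ * w) + C * θ ^ m.natAbs * (w * τ) := by gcongr
      _ = _ := by ring
  have hsf : Summable (torusCov S f) := by
    refine Summable.of_norm_bounded (g := fun m : ℤ => C * (w * w) * θ ^ m.natAbs)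
      (hgeo.mul_left _) fun m => ?_
    refine (hdec f f hf hf m.natAbs).trans_eq ?_
    ring
  have hsd : Summable fun m => torusCov S f m - torusCov S g m :=
    Summable.of_norm_bounded hb2 hdiff
  have hsg : Summable (torusCov S g) := by
    simpa using hsf.sub hsd
  have hsh : Summable fun m => |torusCov S h m| :=
    Summable.of_nonneg_of_le (fun m => abs_nonneg _) hcovh hbound
  refine ⟨G, torusCoeff f, g, hp, hsh, ?_, ?_⟩
  · refine (hsh.tsum_le_tsum hcovh hbound).trans ?_
    rw [tsum_mul_left, ← hK]
    refine le_trans ?_ hfin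
    have : 0 ≤ C * (τ * w) * K := by positivity
    linarith
  · rw [← hsf.tsum_sub hsg, ← Real.norm_eq_abs]
    refine (norm_tsum_le_tsum_norm hsd.norm).trans ?_
    refine (hsd.norm.tsum_le_tsum hdiff hb2).trans ?_
    rw [tsum_mul_left]
    exact hfin

end Approximation

section Assembly
variable {d : ℕ} {S : Matrix (Fin d) (Fin d) ℤ} {η : ℝ} {f : Torus d → ℝ}

lemma IsTrigPoly.tsum_torusCov_nonneg {G : Finset (Fin d → ℤ)} {a : (Fin d → ℤ) → ℂ}
    {g : Torus d → ℝ} (hg : IsTrigPoly G a g) (hdet : S.det = 1)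
    (hE : NoRootOfUnityEigenvalue S) : 0 ≤ ∑' m, torusCov S g m := by
  obtain ⟨γ, H⟩ := hg.exists_isGapProcess hdet hE
  exact tsum_cov_nonneg H.meas H.bdd H.cov H.cov_eq_zero

lemma IsSobolev.tsum_torusCov_nonneg (hd : 0 < d) (hdet : S.det = 1)
    (hE : NoRootOfUnityEigenvalue S) (hη : 0 < η) (hf : IsSobolev η f) :
    0 ≤ ∑' m, torusCov S f m := by
  refine le_of_forall_pos_sub_le fun ε hε => ?_
  obtain ⟨G, a, g, hg, -, -, h⟩ := hf.exists_trigPoly_approx hd hdet hE hη hε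
  linarith [(abs_le.1 h).1, hg.tsum_torusCov_nonneg hdet hE]

lemma abs_sum_mul_le {X : Type*} {ξ : ℤ → X → ℝ} {B : ℝ} (hB : ∀ l x, |ξ l x| ≤ B)
    (s : Finset ℤ) (a : ℤ → ℝ) (x : X) : |∑ l ∈ s, a l * ξ l x| ≤ ∑ l ∈ s, |a l| * B :=
  (Finset.abs_sum_le_sum_abs _ _).trans <| Finset.sum_le_sum fun l _ => by
    rw [abs_mul]
    exact mul_le_mul_of_nonneg_left (hB l x) (abs_nonneg _)

/-- Gaussian approximation of linear statistics of a toral automorphism with slowly varying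
coefficients. -/
lemma IsSobolev.charfun_approx (hd : 0 < d) (hdet : S.det = 1)
    (hE : NoRootOfUnityEigenvalue S) (hη : 0 < η) (hf : IsSobolev η f) {K : ℝ} (hK : 0 ≤ K)
    {ε : ℝ} (hε : 0 < ε) :
    ∃ δ > 0, ∀ (a : ℤ → ℝ) (ha : a.support.Finite), ∑' l, a l ^ 2 ≤ K →
      ∑' l, (a (l + 1) - a l) ^ 2 ≤ δ →
      ‖(∫ x, Complex.exp (Complex.I * (∑ l ∈ ha.toFinset, a l * f (torusAut (S ^ l) x) : ℝ)))
        - (Real.exp (-((∑' m, torusCov S f m) * (∑' l, a l ^ 2) / 2)) : ℝ)‖ ≤ ε := by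
  have hK1 : 0 < K + 1 := by linarith
  obtain ⟨C, hC⟩ := hf.bdd
  obtain ⟨ε', hε', h1, h2⟩ : ∃ ε' > 0, ε' * K ≤ (ε / 3) ^ 2 ∧ ε' * K ≤ ε / 3 := by
    refine ⟨min ((ε / 3) ^ 2) (ε / 3) / (K + 1), by positivity, ?_, ?_⟩ <;>
    · rw [div_mul_eq_mul_div, div_le_iff₀ hK1]
      refine mul_le_mul ?_ (by linarith) hK (by positivity)
      first | exact min_le_left _ _ | exact min_le_right _ _
  obtain ⟨G, b, g, hg, hs, hle, hσ⟩ := hf.exists_trigPoly_approx hd hdet hE hη hε'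
  obtain ⟨γ, H⟩ := hg.exists_isGapProcess hdet hE
  obtain ⟨δ, hδ, hδ'⟩ := H.charfun_approx hK (show 0 < ε / 3 by positivity)
  refine ⟨δ, hδ, fun a ha haK haδ => ?_⟩
  have hsum : ∑ l ∈ ha.toFinset, a l ^ 2 = ∑' l, a l ^ 2 :=
    (tsum_eq_sum (L := .unconditional ℤ) fun l hl => by simpa using hl).symm
  have hsq0 : 0 ≤ ∑' l, a l ^ 2 := tsum_nonneg fun l => sq_nonneg _
  have hfm : ∀ l : ℤ, Measurable fun x => f (torusAut (S ^ l) x) := fun l =>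
    hf.meas.comp (continuous_torusAut _).measurable
  have hgm : ∀ l : ℤ, Measurable fun x => g (torusAut (S ^ l) x) := H.meas
  have hL2 := integral_sq_sum_le (μ := (volume : Measure (Torus d)))
    (ξ := fun l x => f (torusAut (S ^ l) x) - g (torusAut (S ^ l) x))
    (fun l => (hfm l).sub (hgm l)) (B := C + ∑ χ ∈ G, ‖b χ‖)
    (fun l x => (abs_sub _ _).trans (add_le_add (hC _) (hg.abs_le _)))
    (integral_mul_comp_zpow hdet (hf.meas.sub hg.measurable)) hs ha.toFinset a
  have hfirst := norm_integral_exp_sub_le (μ := (volume : Measure (Torus d)))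
    (F := fun x => ∑ l ∈ ha.toFinset, a l * f (torusAut (S ^ l) x))
    (G := fun x => ∑ l ∈ ha.toFinset, a l * g (torusAut (S ^ l) x))
    (Finset.measurable_fun_sum _ fun l _ => (hfm l).const_mul _)
    (Finset.measurable_fun_sum _ fun l _ => (hgm l).const_mul _)
    (abs_sum_mul_le (ξ := fun l x => f (torusAut (S ^ l) x)) (fun l x => hC _) ha.toFinset a)
    (abs_sum_mul_le (ξ := fun l x => g (torusAut (S ^ l) x)) (fun l x => hg.abs_le _)
      ha.toFinset a)
  simp_rw [← Finset.sum_sub_distrib, ← mul_sub] at hfirst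
  have hroot : √(∫ x, (∑ l ∈ ha.toFinset,
      a l * (f (torusAut (S ^ l) x) - g (torusAut (S ^ l) x))) ^ 2) ≤ ε / 3 := by
    refine Real.sqrt_le_iff.2 ⟨by positivity, hL2.trans ?_⟩
    rw [hsum]
    exact (mul_le_mul hle haK hsq0 hε'.le).trans h1
  have hlast : ‖((Real.exp (-((∑' m, torusCov S g m) * (∑' l, a l ^ 2) / 2)) : ℝ) : ℂ)
      - (Real.exp (-((∑' m, torusCov S f m) * (∑' l, a l ^ 2) / 2)) : ℝ)‖ ≤ ε / 3 := by
    rw [← Complex.ofReal_sub, Complex.norm_real, Real.norm_eq_abs]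
    refine (abs_exp_neg_sub_exp_neg_le
      (by have := hg.tsum_torusCov_nonneg hdet hE; positivity)
      (by have := hf.tsum_torusCov_nonneg hd hdet hE hη; positivity)).trans ?_
    rw [← sub_div, ← sub_mul, abs_div, abs_mul, abs_of_nonneg hsq0, abs_sub_comm, abs_two]
    have := mul_le_mul hσ haK hsq0 hε'.le
    linarith
  calc _ ≤ _ := norm_sub_le_norm_sub_add_norm_sub _ (∫ x, Complex.exp (Complex.I *
        (∑ l ∈ ha.toFinset, a l * g (torusAut (S ^ l) x) : ℝ))) _
    _ ≤ ε / 3 + (ε / 3 + ε / 3) := add_le_add (hfirst.trans hroot)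
        ((norm_sub_le_norm_sub_add_norm_sub _ _ _).trans
          (add_le_add (hδ' a ha haK haδ) hlast))
    _ = ε := by ring

end Assembly

section Limit
variable {d : ℕ} {S : Matrix (Fin d) (Fin d) ℤ} {η : ℝ} {f : Torus d → ℝ}
  {Ω : Type*} {W : ℕ → Ω → ℤ}

/-- The exponent of the characteristic function of the walk in the toral scenery. -/
def sceneryExp (S : Matrix (Fin d) (Fin d) ℤ) (f : Torus d → ℝ) (W : ℕ → Ω → ℤ) (c : ℝ) (n : ℕ)
    (x : Torus d) (ω : Ω) : ℂ :=
  Complex.exp (Complex.I * (c * ∑ k ∈ Finset.Icc 1 n, f (torusAut (S ^ W k ω) x) : ℝ))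

/-- The conditional Gaussian characteristic function given the walk. -/
def gaussExp (S : Matrix (Fin d) (Fin d) ℤ) (f : Torus d → ℝ) (W : ℕ → Ω → ℤ) (c : ℝ) (n : ℕ)
    (ω : Ω) : ℝ :=
  Real.exp (-((∑' m, torusCov S f m) * (c ^ 2 * ∑' l, localTime W n l ω ^ 2) / 2))

lemma norm_sceneryExp (c : ℝ) (n : ℕ) (x : Torus d) (ω : Ω) : ‖sceneryExp S f W c n x ω‖ = 1 := by
  rw [sceneryExp, mul_comm, Complex.norm_exp_ofReal_mul_I]

lemma gaussExp_pos (c : ℝ) (n : ℕ) (ω : Ω) : 0 < gaussExp S f W c n ω := Real.exp_pos _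

lemma gaussExp_le_one (h : 0 ≤ ∑' m, torusCov S f m) (c : ℝ) (n : ℕ) (ω : Ω) :
    gaussExp S f W c n ω ≤ 1 := by
  have : 0 ≤ ∑' l, localTime W n l ω ^ 2 := tsum_nonneg fun l => sq_nonneg _
  exact Real.exp_le_one_iff.2 (neg_nonpos.2 (by positivity))

lemma IsSobolev.norm_integral_sceneryExp_sub_le (hd : 0 < d) (hdet : S.det = 1)
    (hE : NoRootOfUnityEigenvalue S) (hη : 0 < η) (hf : IsSobolev η f) {K : ℝ} (hK : 0 < K)
    {ε : ℝ} (hε : 0 < ε) :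
    ∃ δ > 0, ∀ (c : ℝ) (n : ℕ) (ω : Ω),
      ‖(∫ x, sceneryExp S f W c n x ω) - (gaussExp S f W c n ω : ℝ)‖ ≤
        ε + 2 * (c ^ 2 / K) * (∑' l, localTime W n l ω ^ 2)
          + 2 * (c ^ 2 / δ) * ∑' l, (localTime W n (l + 1) ω - localTime W n l ω) ^ 2 := by
  have hσ := hf.tsum_torusCov_nonneg hd hdet hE hη
  obtain ⟨δ, hδ, h⟩ := hf.charfun_approx hd hdet hE hη hK.le hε
  refine ⟨δ, hδ, fun c n ω => ?_⟩
  set L := ∑' l, localTime W n l ω ^ 2 with hL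
  set V := ∑' l, (localTime W n (l + 1) ω - localTime W n l ω) ^ 2 with hV
  have hL0 : 0 ≤ L := tsum_nonneg fun l => sq_nonneg _
  have hV0 : 0 ≤ V := tsum_nonneg fun l => sq_nonneg _
  have hLK : 0 ≤ 2 * (c ^ 2 / K) * L := by positivity
  have hVδ : 0 ≤ 2 * (c ^ 2 / δ) * V := by positivity
  have htriv : ‖(∫ x, sceneryExp S f W c n x ω) - (gaussExp S f W c n ω : ℝ)‖ ≤ 2 := by
    refine (norm_sub_le _ _).trans ?_
    have h1 := norm_integral_le_of_norm_le_const (μ := (volume : Measure (Torus d)))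
      (f := fun x => sceneryExp S f W c n x ω) (C := 1)
      (ae_of_all _ fun x => (norm_sceneryExp c n x ω).le)
    have h2 : ‖((gaussExp S f W c n ω : ℝ) : ℂ)‖ ≤ 1 := by
      rw [Complex.norm_real, Real.norm_of_nonneg (gaussExp_pos c n ω).le]
      exact gaussExp_le_one hσ c n ω
    simp only [probReal_univ, mul_one] at h1
    linarith
  have ha : (Function.support fun l => c * localTime W n l ω).Finite :=
    (finite_support_localTime W n ω).subset fun l hl => right_ne_zero_of_mul hl
  have haL : ∑' l, (c * localTime W n l ω) ^ 2 = c ^ 2 * L := by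
    rw [hL, ← tsum_mul_left]; simp_rw [mul_pow]
  have haV : ∑' l, (c * localTime W n (l + 1) ω - c * localTime W n l ω) ^ 2 = c ^ 2 * V := by
    rw [hV, ← tsum_mul_left]; simp_rw [← mul_sub, mul_pow]
  have hexp : ∀ x, ∑ l ∈ ha.toFinset, c * localTime W n l ω * f (torusAut (S ^ l) x)
      = c * ∑ k ∈ Finset.Icc 1 n, f (torusAut (S ^ W k ω) x) := fun x => by
    rw [← tsum_localTime_mul W n ω fun l => f (torusAut (S ^ l) x), ← tsum_mul_left,
      ← tsum_eq_sum (L := .unconditional ℤ)]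
    · simp_rw [mul_assoc]
    · intro l hl
      rw [Set.Finite.mem_toFinset, Function.notMem_support] at hl
      rw [hl, zero_mul]
  by_cases hc1 : c ^ 2 * L ≤ K
  · by_cases hc2 : c ^ 2 * V ≤ δ
    · have := h _ ha (haL.trans_le hc1) (haV.trans_le hc2)
      simp_rw [haL, hexp] at this
      have h' : ‖(∫ x, sceneryExp S f W c n x ω) - (gaussExp S f W c n ω : ℝ)‖ ≤ ε := this
      linarith
    · have : 1 ≤ c ^ 2 / δ * V := by
        rw [div_mul_eq_mul_div, one_le_div hδ]; exact (not_le.1 hc2).le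
      linarith
  · have : 1 ≤ c ^ 2 / K * L := by
      rw [div_mul_eq_mul_div, one_le_div hK]; exact (not_le.1 hc1).le
    linarith

variable [MeasurableSpace Ω] {P : Measure Ω}

lemma measurable_sceneryExp (hf : Measurable f) (hW : ∀ n, Measurable (W n)) (c : ℝ) (n : ℕ) :
    Measurable fun z : Torus d × Ω => sceneryExp S f W c n z.1 z.2 := by
  have h : Measurable fun p : Torus d × ℤ => f (torusAut (S ^ p.2) p.1) :=
    measurable_from_prod_countable_left fun l =>
      (hf.comp (continuous_torusAut (S ^ l)).measurable :)
  have hk : ∀ k, Measurable fun z : Torus d × Ω => f (torusAut (S ^ W k z.2) z.1) := fun k =>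
    h.comp (measurable_fst.prodMk ((hW k).comp measurable_snd))
  unfold sceneryExp
  exact Complex.measurable_exp.comp ((Complex.measurable_ofReal.comp
    ((Finset.measurable_fun_sum _ fun k _ => hk k).const_mul c)).const_mul _)

lemma IsSSRW.measurable_gaussExp (hW : IsSSRW P W) (c : ℝ) (n : ℕ) :
    Measurable (gaussExp S f W c n) := by
  have : Measurable fun ω => ∑' l, localTime W n l ω ^ 2 := by
    simp_rw [tsum_localTime_sq]
    refine Finset.measurable_fun_sum _ fun j _ => Finset.measurable_fun_sum _ fun k _ => ?_
    exact Measurable.ite (((hW.meas k).sub (hW.meas j)) (measurableSet_singleton 0))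
      measurable_const measurable_const
  exact Real.measurable_exp.comp (((this.const_mul _).const_mul _).div_const 2).neg

variable [IsProbabilityMeasure P]

/-- The difference of the two expectations is controlled by the local-time functionals. -/
lemma IsSobolev.exists_norm_sub_le (hd : 0 < d) (hdet : S.det = 1)
    (hE : NoRootOfUnityEigenvalue S) (hη : 0 < η) (hf : IsSobolev η f) (hW : IsSSRW P W)
    {K : ℝ} (hK : 0 < K) {ε : ℝ} (hε : 0 < ε) :
    ∃ δ > 0, ∀ (c : ℝ) (n : ℕ),
      ‖(∫ z : Torus d × Ω, sceneryExp S f W c n z.1 z.2 ∂(volume : Measure (Torus d)).prod P)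
        - ((∫ z : Torus d × Ω, gaussExp S f W c n z.2 ∂(volume : Measure (Torus d)).prod P : ℝ)
          : ℂ)‖ ≤
        ε + 2 * (c ^ 2 / K) * (2 * (n * √(n + 1))) + 2 * (c ^ 2 / δ) * (4 * n) := by
  obtain ⟨δ, hδ, h⟩ := hf.norm_integral_sceneryExp_sub_le (W := W) hd hdet hE hη hK hε
  refine ⟨δ, hδ, fun c n => ?_⟩
  have hσ := hf.tsum_torusCov_nonneg hd hdet hE hη
  have hi : Integrable (fun z : Torus d × Ω => sceneryExp S f W c n z.1 z.2)
      ((volume : Measure (Torus d)).prod P) :=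
    Integrable.of_bound (measurable_sceneryExp hf.meas hW.meas c n).aestronglyMeasurable 1
      (ae_of_all _ fun z => (norm_sceneryExp c n z.1 z.2).le)
  have hg : Integrable (gaussExp S f W c n) P :=
    integrable_of_abs_le (hW.measurable_gaussExp c n) (C := 1) fun ω => by
      rw [abs_of_pos (gaussExp_pos c n ω)]; exact gaussExp_le_one hσ c n ω
  have hL := hW.integrable_tsum_localTime_sq n
  have hV := hW.integrable_tsum_localTime_sub_sq n
  rw [integral_prod_symm _ hi, integral_fun_snd (gaussExp S f W c n),
    probReal_univ, one_smul, ← integral_complex_ofReal]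
  have hsub := integral_sub (f := fun ω => ∫ x, sceneryExp S f W c n x ω)
    (g := fun ω => ((gaussExp S f W c n ω : ℝ) : ℂ)) hi.integral_prod_right hg.ofReal
  dsimp only
  rw [← hsub]
  refine (norm_integral_le_of_norm_le (((integrable_const ε).add (hL.const_mul _)).add
    (hV.const_mul _)) (ae_of_all _ (h c n))).trans ?_
  simp only [Pi.add_apply]
  rw [integral_add (f := fun ω => ε + 2 * (c ^ 2 / K) * ∑' l, localTime W n l ω ^ 2)
    ((integrable_const ε).add (hL.const_mul _)) (hV.const_mul _),
    integral_add (integrable_const ε) (hL.const_mul _), integral_const_mul, integral_const_mul,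
    integral_const, probReal_univ, one_smul]
  gcongr
  · exact hW.integral_tsum_localTime_sq_le n
  · exact hW.integral_tsum_localTime_sub_sq_le n

lemma IsSobolev.tendsto_sceneryExp_sub (hd : 0 < d) (hdet : S.det = 1)
    (hE : NoRootOfUnityEigenvalue S) (hη : 0 < η) (hf : IsSobolev η f) (hW : IsSSRW P W)
    (t : ℝ) :
    Tendsto (fun n : ℕ =>
      (∫ z : Torus d × Ω, sceneryExp S f W (t / (n : ℝ) ^ ((3 : ℝ) / 4)) n z.1 z.2
        ∂(volume : Measure (Torus d)).prod P)
      - ((∫ z : Torus d × Ω, gaussExp S f W (t / (n : ℝ) ^ ((3 : ℝ) / 4)) n z.2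
        ∂(volume : Measure (Torus d)).prod P : ℝ) : ℂ)) atTop (nhds 0) := by
  rw [NormedAddGroup.tendsto_nhds_zero]
  intro ε hε
  obtain ⟨δ, hδ, h⟩ := hf.exists_norm_sub_le hd hdet hE hη hW
    (show 0 < 32 * (t ^ 2 + 1) / ε by positivity) (show 0 < ε / 4 by positivity)
  have hlim : Tendsto (fun n : ℕ => 8 * t ^ 2 / δ / √(n : ℝ)) atTop (nhds 0) :=
    (Real.tendsto_sqrt_atTop.comp tendsto_natCast_atTop_atTop).const_div_atTop _
  filter_upwards [hlim.eventually_lt_const (show 0 < ε / 4 by positivity),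
    eventually_ge_atTop 1] with n hn hn1
  have hn1' : (1 : ℝ) ≤ n := by exact_mod_cast hn1
  have hn0 : (0 : ℝ) < n := by linarith
  refine (h _ n).trans_lt ?_
  have hs : 0 < √(n : ℝ) := Real.sqrt_pos.2 hn0
  have hc : (t / (n : ℝ) ^ ((3 : ℝ) / 4)) ^ 2 = t ^ 2 / (n * √n) := by
    rw [div_pow, ← Real.rpow_natCast (_ ^ _), ← Real.rpow_mul hn0.le, Real.sqrt_eq_rpow]
    congr 1
    nth_rewrite 2 [← Real.rpow_one (n : ℝ)]
    rw [← Real.rpow_add hn0]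
    norm_num
  have hs2 : √((n : ℝ) + 1) ≤ 2 * √n := by
    rw [Real.sqrt_le_left (by positivity), mul_pow, Real.sq_sqrt hn0.le]
    linarith
  have e1 : 2 * (t ^ 2 / (n * √n) / (32 * (t ^ 2 + 1) / ε)) * (2 * (n * √((n : ℝ) + 1)))
      ≤ ε / 4 := by
    calc _ ≤ 2 * (t ^ 2 / (n * √n) / (32 * (t ^ 2 + 1) / ε)) * (2 * (n * (2 * √n))) := by gcongr
      _ = ε / 4 * (t ^ 2 / (t ^ 2 + 1)) := by field_simp; ring
      _ ≤ ε / 4 := mul_le_of_le_one_right (by positivity)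
        ((div_le_one (by positivity)).2 (by linarith))
  have e2 : 2 * (t ^ 2 / (n * √n) / δ) * (4 * n) = 8 * t ^ 2 / δ / √(n : ℝ) := by
    field_simp; ring
  rw [hc, e2]
  linarith

end Limit

/-- Random walk in the scenery generated by an ergodic algebraic toral
automorphism: the characteristic function of `n^{-3/4} Σ_{k=1}^n ξ_{S_k}` is asymptotically
that of the Kesten–Spitzer self-intersection functional with variance `σ²`. -/
theorem statement16 (d : ℕ) (hd : 2 ≤ d) (S : Matrix (Fin d) (Fin d) ℤ) (hdet : S.det = 1)
    (hEig : NoRootOfUnityEigenvalue S) (η : ℝ) (hη : 0 < η)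
    (f : Torus d → ℝ) (hfmeas : Measurable f) (hfbdd : ∃ c : ℝ, ∀ x, |f x| ≤ c)
    (hfholder : IsHolder η f)
    (hcent : (∫ x, f x ∂(volume : Measure (Torus d))) = 0)
    {Ω' : Type*} [MeasurableSpace Ω'] (P' : Measure Ω') [IsProbabilityMeasure P']
    (W : ℕ → Ω' → ℤ) (hW : IsSSRW P' W) (t : ℝ) :
    Tendsto (fun n : ℕ =>
        (∫ x : Torus d × Ω',
            Complex.exp (Complex.I * (t : ℂ) / (((n : ℝ) ^ ((3 : ℝ) / 4) : ℝ) : ℂ) *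
              ((∑ k ∈ Finset.Icc 1 n,
                  f (Titer (torusAut S) (torusAut S⁻¹) (W k x.2) x.1) : ℝ) : ℂ))
          ∂((volume : Measure (Torus d)).prod P')) -
        ((∫ x : Torus d × Ω',
            Real.exp (-(t ^ 2 *
                (∑' m : ℤ, ∫ y, f y * f ((torusAut S)^[m.natAbs] y)
                    ∂(volume : Measure (Torus d))) /
                (2 * (n : ℝ) ^ ((3 : ℝ) / 2))) *
              ∑' ℓ : ℤ, (localTime W n ℓ x.2) ^ 2)
          ∂((volume : Measure (Torus d)).prod P') : ℝ) : ℂ))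
      atTop (nhds 0) := by
  obtain ⟨C, hC⟩ := hfbdd
  have hf : IsSobolev η f := ⟨hfmeas, ⟨C, hC⟩, by rw [torusCoeff_zero, hcent, Complex.ofReal_zero],
    summable_norm_rpow_mul_sq hη hfmeas hC hfholder⟩
  refine (hf.tendsto_sceneryExp_sub (by omega) hdet hEig hη hW t).congr fun n => ?_
  have hpow : ((n : ℝ) ^ ((3 : ℝ) / 4)) ^ 2 = (n : ℝ) ^ ((3 : ℝ) / 2) := by
    rw [← Real.rpow_natCast, ← Real.rpow_mul n.cast_nonneg]
    norm_num
  refine congr_arg₂ (· - ·) ?_ (congr_arg Complex.ofReal ?_)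
  · refine integral_congr_ae (ae_of_all _ fun z => ?_)
    simp only [sceneryExp, Titer_torusAut]
    congr 1
    push_cast
    ring
  · refine integral_congr_ae (ae_of_all _ fun z => ?_)
    simp only [gaussExp, torusCov, torusAut_iterate, div_pow, hpow]
    congr 1
    ring
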